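/- arXiv:1705.00293 — 2 statements merged into one kernel-verified Lean document; each statement's English description precedes it below -/
import Mathlib

section
/- For each n ∈ {22, 30, 31, 34, 35, 36, 40, 41} there exists a (2,4)-regular matchstick graph with exactly n vertices that contains exactly two vertices of degree 2 (and all other vertices of degree 4). -/
open scoped Classical

/-- A matchstick graph: a finite set of points in the Euclidean plane together with
a finite set of unit-length non-crossing straight edges between distinct points. -/
structure MatchstickGraph where
  V : Finset (EuclideanSpace ℝ (Fin 2))
  E : Finset (Sym2 (EuclideanSpace ℝ (Fin 2)))
  edge_mem : ∀ e ∈ E, ∀ u v : EuclideanSpace ℝ (Fin 2), e = s(u, v) → u ∈ V ∧ v ∈ V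
  edge_ne : ∀ e ∈ E, ¬ e.IsDiag
  edge_unit : ∀ e ∈ E, ∀ u v : EuclideanSpace ℝ (Fin 2), e = s(u, v) → dist u v = 1
  noncross : ∀ e₁ ∈ E, ∀ e₂ ∈ E, e₁ ≠ e₂ →
    ∀ u v x y : EuclideanSpace ℝ (Fin 2), e₁ = s(u, v) → e₂ = s(x, y) →
      segment ℝ u v ∩ segment ℝ x y ⊆ (({u, v} : Set (EuclideanSpace ℝ (Fin 2))) ∩ {x, y})

/-- The degree of a vertex: the number of edges containing it. -/
noncomputable def MatchstickGraph.degree (G : MatchstickGraph)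
    (v : EuclideanSpace ℝ (Fin 2)) : ℕ :=
  (G.E.filter (fun e => v ∈ e)).card

/-- A matchstick graph is 4-regular if every vertex has degree 4. -/
def MatchstickGraph.IsFourRegular (G : MatchstickGraph) : Prop :=
  ∀ v ∈ G.V, G.degree v = 4

/-- A matchstick graph is (2,4)-regular if every vertex has degree 2 or degree 4. -/
def MatchstickGraph.IsTwoFourRegular (G : MatchstickGraph) : Prop :=
  ∀ v ∈ G.V, G.degree v = 2 ∨ G.degree v = 4

/-- A map of `ι → ℝ` that is within Lipschitz distance `1/2` of the identity near the origin and is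
small there has a zero. -/
theorem exists_zero_of_close_to_id {ι : Type*} [Fintype ι] (f : (ι → ℝ) → ι → ℝ) {r : ℝ}
    (hr : 0 ≤ r) (h0 : ‖f 0‖ ≤ r / 2)
    (h1 : ∀ z w : ι → ℝ, ‖z‖ ≤ r → ‖w‖ ≤ r → ‖f z - f w - (z - w)‖ ≤ 1 / 2 * ‖z - w‖) :
    ∃ z, ‖z‖ ≤ r ∧ f z = 0 := by
  have happ : ApproximatesLinearOn f (ContinuousLinearMap.id ℝ (ι → ℝ))
      (Metric.closedBall 0 r) (1 / 2) := by
    intro z hz w hw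
    simpa using h1 z w (by simpa using hz) (by simpa using hw)
  let R : (ContinuousLinearMap.id ℝ (ι → ℝ)).NonlinearRightInverse :=
    { toFun := id
      nnnorm := 1
      bound' := fun y => by simp
      right_inv' := fun y => rfl }
  have hmem : (0 : ι → ℝ) ∈
      Metric.closedBall (f 0) (((R.nnnorm : ℝ)⁻¹ - (1 / 2 : NNReal)) * r) := by
    have hR : ((R.nnnorm : ℝ)⁻¹ - (1 / 2 : NNReal)) * r = r / 2 := by
      simp only [R]; push_cast; ring
    rw [hR, mem_closedBall_iff_norm]
    simpa using h0
  obtain ⟨z, hz, hfz⟩ :=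
    happ.surjOn_closedBall_of_nonlinearRightInverse R hr subset_rfl hmem
  exact ⟨z, by simpa using hz, hfz⟩

theorem abs_sum_mul_le_of_norm_le {ι : Type*} [Fintype ι] (a z : ι → ℝ) :
    |∑ j, a j * z j| ≤ (∑ j, |a j|) * ‖z‖ := by
  rw [Finset.sum_mul]
  refine (Finset.abs_sum_le_sum_abs _ _).trans (Finset.sum_le_sum fun j _ => ?_)
  rw [abs_mul]
  exact mul_le_mul_of_nonneg_left (norm_le_pi_norm z j) (abs_nonneg _)

/-- Newton-type existence for a system of unit-length conditions `‖d e + b e z‖ = 1` in the plane,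
where the linear maps `b e` form an approximate right inverse of the derivative. -/
theorem exists_unit_system {ι : Type*} [Fintype ι] [DecidableEq ι] (d : ι → Fin 2 → ℝ)
    (b : ι → Fin 2 → ι → ℝ)
    {r : ℝ} (hr : 0 ≤ r) (h0 : ∀ e, |∑ c, d e c ^ 2 - 1| ≤ r / 2)
    (h1 : ∀ e, ∑ j, |∑ c, 2 * d e c * b e c j - if e = j then 1 else 0| +
      2 * r * ∑ c, (∑ j, |b e c j|) ^ 2 ≤ 1 / 2) :
    ∃ z : ι → ℝ, ‖z‖ ≤ r ∧ ∀ e, ∑ c, (d e c + ∑ j, b e c j * z j) ^ 2 = 1 := by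
  suffices h : ∀ z w : ι → ℝ, ‖z‖ ≤ r → ‖w‖ ≤ r →
      ‖(fun z e => ∑ c, (d e c + ∑ j, b e c j * z j) ^ 2 - 1) z -
        (fun z e => ∑ c, (d e c + ∑ j, b e c j * z j) ^ 2 - 1) w - (z - w)‖ ≤ 1 / 2 * ‖z - w‖ by
    obtain ⟨z, hz, hfz⟩ := exists_zero_of_close_to_id
      (fun z e => ∑ c, (d e c + ∑ j, b e c j * z j) ^ 2 - 1) hr
      ((pi_norm_le_iff_of_nonneg (by linarith)).2 fun e => by simpa using h0 e) h
    exact ⟨z, hz, fun e => sub_eq_zero.1 (congrFun hfz e)⟩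
  intro z w hz hw
  rw [pi_norm_le_iff_of_nonneg (by positivity)]
  intro e
  have key : ((fun z e => ∑ c, (d e c + ∑ j, b e c j * z j) ^ 2 - 1) z -
        (fun z e => ∑ c, (d e c + ∑ j, b e c j * z j) ^ 2 - 1) w - (z - w)) e =
      ∑ j, (∑ c, 2 * d e c * b e c j - if e = j then 1 else 0) * (z - w) j +
        ∑ c, (∑ j, b e c j * (z + w) j) * (∑ j, b e c j * (z - w) j) := by
    have hlin : ∑ j, (∑ c, 2 * d e c * b e c j - if e = j then 1 else 0) * (z - w) j =
        ∑ c, 2 * d e c * ∑ j, b e c j * (z - w) j - (z - w) e := by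
      simp only [sub_mul, Finset.sum_sub_distrib, ite_mul, one_mul, zero_mul,
        Finset.sum_ite_eq, Finset.mem_univ, if_true, Finset.sum_mul, Finset.mul_sum]
      rw [Finset.sum_comm]
      simp only [mul_assoc]
    rw [hlin]
    simp only [Pi.sub_apply, Pi.add_apply, mul_add, mul_sub, Finset.sum_add_distrib,
      Finset.sum_sub_distrib, Fin.sum_univ_two]
    ring
  rw [key, Real.norm_eq_abs]
  have hA := abs_sum_mul_le_of_norm_le
    (fun j => ∑ c, 2 * d e c * b e c j - if e = j then 1 else 0) (z - w)
  have hB : |∑ c, (∑ j, b e c j * (z + w) j) * (∑ j, b e c j * (z - w) j)| ≤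
      (2 * r * ∑ c, (∑ j, |b e c j|) ^ 2) * ‖z - w‖ := by
    rw [Finset.mul_sum, Finset.sum_mul]
    refine (Finset.abs_sum_le_sum_abs _ _).trans (Finset.sum_le_sum fun c _ => ?_)
    rw [abs_mul]
    have h2 : ‖z + w‖ ≤ 2 * r := (norm_add_le z w).trans (by linarith)
    have hs : 0 ≤ ∑ j, |b e c j| := Finset.sum_nonneg fun _ _ => abs_nonneg _
    calc _ ≤ ((∑ j, |b e c j|) * ‖z + w‖) * ((∑ j, |b e c j|) * ‖z - w‖) :=
          mul_le_mul (abs_sum_mul_le_of_norm_le _ _) (abs_sum_mul_le_of_norm_le _ _)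
            (abs_nonneg _) (by positivity)
      _ ≤ ((∑ j, |b e c j|) * (2 * r)) * ((∑ j, |b e c j|) * ‖z - w‖) := by gcongr
      _ = _ := by ring
  calc _ ≤ _ := abs_add_le _ _
    _ ≤ _ := add_le_add hA hB
    _ = _ := (add_mul _ _ _).symm
    _ ≤ _ := mul_le_mul_of_nonneg_right (h1 e) (norm_nonneg _)

theorem segment_inter_segment_of_dist_eq {v u x : EuclideanSpace ℝ (Fin 2)} (hu : dist v u = 1)
    (hx : dist v x = 1) (hne : u ≠ x) : segment ℝ v u ∩ segment ℝ v x ⊆ {v} := by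
  rintro p ⟨hp, hq⟩
  rw [segment_eq_image'] at hp hq
  obtain ⟨a, ⟨ha, -⟩, rfl⟩ := hp
  obtain ⟨b, ⟨hb, -⟩, hab⟩ := hq
  have hvec : b • (x - v) = a • (u - v) := add_left_cancel hab
  have hnorm := congrArg norm hvec
  rw [norm_smul, norm_smul, ← dist_eq_norm, ← dist_eq_norm, dist_comm x, dist_comm u, hu, hx,
    mul_one, mul_one, Real.norm_of_nonneg ha, Real.norm_of_nonneg hb] at hnorm
  subst hnorm
  rcases eq_or_ne b 0 with rfl | hb0
  · simp
  · exact absurd (sub_left_injective (smul_right_injective _ hb0 hvec)).symm hne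

theorem disjoint_segment_of_linear_lt {u v x y : EuclideanSpace ℝ (Fin 2)} {a b m : ℝ}
    (hu : a * u 0 + b * u 1 < m) (hv : a * v 0 + b * v 1 < m)
    (hx : m ≤ a * x 0 + b * x 1) (hy : m ≤ a * y 0 + b * y 1) :
    Disjoint (segment ℝ u v) (segment ℝ x y) := by
  rw [Set.disjoint_left]
  rintro p ⟨s, t, hs, ht, hst, rfl⟩ ⟨s', t', hs', ht', hst', h⟩
  have e0 := congrArg (fun p : EuclideanSpace ℝ (Fin 2) => p 0) h
  have e1 := congrArg (fun p : EuclideanSpace ℝ (Fin 2) => p 1) h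
  simp only [PiLp.add_apply, PiLp.smul_apply, smul_eq_mul] at e0 e1
  have h1 : s * (a * u 0 + b * u 1) + t * (a * v 0 + b * v 1) < m := by
    rcases hs.eq_or_lt with rfl | hs
    · obtain rfl : t = 1 := by linarith
      linarith
    · obtain rfl : t = 1 - s := by linarith
      nlinarith
  have h2 : m ≤ s' * (a * x 0 + b * x 1) + t' * (a * y 0 + b * y 1) := by
    obtain rfl : t' = 1 - s' := by linarith
    nlinarith
  have h3 : s' * (a * x 0 + b * x 1) + t' * (a * y 0 + b * y 1) =
      s * (a * u 0 + b * u 1) + t * (a * v 0 + b * v 1) := by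
    linear_combination a * e0 + b * e1
  linarith

/-- The number of edges incident to `i` in the multigraph with edge endpoints `s e` and `t e`. -/
def incidence {κ ι : Type*} [DecidableEq κ] [Fintype ι] (s t : ι → κ) (i : κ) : ℕ :=
  (Finset.univ.filter fun e => s e = i ∨ t e = i).card

/-- Two edges with given endpoints are parallel if they have the same endpoints in some order. -/
def Parallel {κ ι : Type*} (s t : ι → κ) (e f : ι) : Prop :=
  s e = s f ∧ t e = t f ∨ s e = t f ∧ t e = s f

/-- Two edges are independent if they have no common endpoint. -/
def Independent {κ ι : Type*} (s t : ι → κ) (e f : ι) : Prop :=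
  s e ≠ s f ∧ s e ≠ t f ∧ t e ≠ s f ∧ t e ≠ t f

instance {κ ι : Type*} [DecidableEq κ] (s t : ι → κ) (e f : ι) : Decidable (Parallel s t e f) := by
  unfold Parallel; infer_instance

instance {κ ι : Type*} [DecidableEq κ] (s t : ι → κ) (e f : ι) :
    Decidable (Independent s t e f) := by
  unfold Independent; infer_instance

theorem segment_inter_subset_of_embedding {κ ι : Type*} {W : Finset κ} {s t : ι → κ}
    {pos : κ → EuclideanSpace ℝ (Fin 2)} (hinj : Set.InjOn pos W)
    (hs : ∀ e, s e ∈ W) (ht : ∀ e, t e ∈ W) (hunit : ∀ e, dist (pos (s e)) (pos (t e)) = 1)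
    (hsimple : ∀ e f, Parallel s t e f → e = f)
    (hsep : ∀ e f, Independent s t e f →
      Disjoint (segment ℝ (pos (s e)) (pos (t e))) (segment ℝ (pos (s f)) (pos (t f))))
    {e f : ι} (hef : e ≠ f) :
    segment ℝ (pos (s e)) (pos (t e)) ∩ segment ℝ (pos (s f)) (pos (t f)) ⊆
      ({pos (s e), pos (t e)} : Set (EuclideanSpace ℝ (Fin 2))) ∩ {pos (s f), pos (t f)} := by
  have hpar : ¬ Parallel s t e f := fun h => hef (hsimple e f h)
  have hne {i j : κ} (hi : i ∈ W) (hj : j ∈ W) (h : i ≠ j) : pos i ≠ pos j :=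
    fun h' => h (hinj hi hj h')
  have he := hunit e
  have hf := hunit f
  unfold Parallel at hpar
  push Not at hpar
  by_cases h1 : s e = s f
  · have := segment_inter_segment_of_dist_eq he (h1 ▸ hf) (hne (ht e) (ht f) (hpar.1 h1))
    rw [← h1]
    exact this.trans (by simp)
  by_cases h2 : s e = t f
  · rw [dist_comm, ← h2] at hf
    have := segment_inter_segment_of_dist_eq he hf (hne (ht e) (hs f) (hpar.2 h2))
    rw [← h2, segment_symm ℝ (pos (s f))]
    exact this.trans (by simp)
  by_cases h3 : t e = s f
  · rw [dist_comm] at he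
    have := segment_inter_segment_of_dist_eq he (h3 ▸ hf) (hne (hs e) (ht f) h2)
    rw [← h3, segment_symm ℝ (pos (s e))]
    exact this.trans (by simp)
  by_cases h4 : t e = t f
  · rw [dist_comm] at he hf
    rw [← h4] at hf
    have := segment_inter_segment_of_dist_eq he hf (hne (hs e) (hs f) h1)
    rw [← h4, segment_symm ℝ (pos (s e)), segment_symm ℝ (pos (s f))]
    exact this.trans (by simp)
  · rw [(hsep e f ⟨h1, h2, h3, h4⟩).inter_eq]
    exact Set.empty_subset _

/-- A planar unit-length embedding of a finite graph with vertex set `W`, all of whose degrees are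
`2` or `4`, yields a (2,4)-regular matchstick graph. -/
theorem exists_matchstickGraph_of_embedding {κ ι : Type*} [DecidableEq κ] [Fintype ι]
    {W : Finset κ} {s t : ι → κ}
    {pos : κ → EuclideanSpace ℝ (Fin 2)} (hinj : Set.InjOn pos W)
    (hs : ∀ e, s e ∈ W) (ht : ∀ e, t e ∈ W) (hunit : ∀ e, dist (pos (s e)) (pos (t e)) = 1)
    (hsimple : ∀ e f, Parallel s t e f → e = f)
    (hsep : ∀ e f, Independent s t e f →
      Disjoint (segment ℝ (pos (s e)) (pos (t e))) (segment ℝ (pos (s f)) (pos (t f))))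
    (hdeg : ∀ i ∈ W, incidence s t i = 2 ∨ incidence s t i = 4) :
    ∃ G : MatchstickGraph, G.IsTwoFourRegular ∧ G.V.card = W.card ∧
      (G.V.filter (fun v => G.degree v = 2)).card =
        (W.filter fun i => incidence s t i = 2).card := by
  let edge : ι → Sym2 (EuclideanSpace ℝ (Fin 2)) := fun e => s(pos (s e), pos (t e))
  have hedge : Function.Injective edge := by
    intro e f h
    refine hsimple e f ?_
    rcases Sym2.eq_iff.1 h with ⟨h1, h2⟩ | ⟨h1, h2⟩
    · exact Or.inl ⟨hinj (hs e) (hs f) h1, hinj (ht e) (ht f) h2⟩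
    · exact Or.inr ⟨hinj (hs e) (ht f) h1, hinj (ht e) (hs f) h2⟩
  have hends {e : ι} {u v : EuclideanSpace ℝ (Fin 2)} (h : edge e = s(u, v)) :
      pos (s e) = u ∧ pos (t e) = v ∨ pos (s e) = v ∧ pos (t e) = u := Sym2.eq_iff.1 h
  let G : MatchstickGraph :=
    { V := W.image pos
      E := Finset.univ.image edge
      edge_mem := by
        intro e he u v huv
        obtain ⟨e, -, rfl⟩ := Finset.mem_image.1 he
        have h1 := Finset.mem_image_of_mem pos (hs e)
        have h2 := Finset.mem_image_of_mem pos (ht e)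
        rcases hends huv with ⟨rfl, rfl⟩ | ⟨rfl, rfl⟩
        · exact ⟨h1, h2⟩
        · exact ⟨h2, h1⟩
      edge_ne := by
        intro e he hdiag
        obtain ⟨e, -, rfl⟩ := Finset.mem_image.1 he
        have h := hunit e
        rw [Sym2.mk_isDiag_iff.1 hdiag, dist_self] at h
        exact zero_ne_one h
      edge_unit := by
        intro e he u v huv
        obtain ⟨e, -, rfl⟩ := Finset.mem_image.1 he
        rcases hends huv with ⟨rfl, rfl⟩ | ⟨rfl, rfl⟩
        · exact hunit e
        · rw [dist_comm]
          exact hunit e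
      noncross := by
        intro e he f hf hne u v x y huv hxy
        obtain ⟨e, -, rfl⟩ := Finset.mem_image.1 he
        obtain ⟨f, -, rfl⟩ := Finset.mem_image.1 hf
        have key := segment_inter_subset_of_embedding hinj hs ht hunit hsimple hsep
          (fun h => hne (congrArg edge h) : e ≠ f)
        rcases hends huv with ⟨rfl, rfl⟩ | ⟨rfl, rfl⟩ <;>
          rcases hends hxy with ⟨rfl, rfl⟩ | ⟨rfl, rfl⟩
        · exact key
        · rwa [segment_symm ℝ (pos (t f)), Set.pair_comm (pos (t f))]
        · rwa [segment_symm ℝ (pos (t e)), Set.pair_comm (pos (t e))]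
        · rwa [segment_symm ℝ (pos (t f)), Set.pair_comm (pos (t f)),
            segment_symm ℝ (pos (t e)), Set.pair_comm (pos (t e))] }
  have hdegree : ∀ i ∈ W, G.degree (pos i) = incidence s t i := by
    intro i hi
    have : G.E.filter (fun e => pos i ∈ e) =
        (Finset.univ.filter fun e => s e = i ∨ t e = i).image edge := by
      rw [Finset.filter_image]
      congr 1
      ext e
      simp only [Finset.mem_filter, Finset.mem_univ, true_and, edge, Sym2.mem_iff]
      exact or_congr ⟨fun h => (hinj hi (hs e) h).symm, fun h => h ▸ rfl⟩
        ⟨fun h => (hinj hi (ht e) h).symm, fun h => h ▸ rfl⟩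
    rw [MatchstickGraph.degree, this, Finset.card_image_of_injective _ hedge, incidence]
  refine ⟨G, ?_, Finset.card_image_of_injOn hinj, ?_⟩
  · intro v hv
    obtain ⟨i, hi, rfl⟩ := Finset.mem_image.1 hv
    rw [hdegree i hi]
    exact hdeg i hi
  · have : G.V.filter (fun v => G.degree v = 2) =
        (W.filter fun i => incidence s t i = 2).image pos := by
      rw [Finset.filter_image]
      congr 1
      exact Finset.filter_congr fun i hi => by rw [hdegree i hi]
    rw [this, Finset.card_image_of_injOn (hinj.mono (Finset.filter_subset _ _))]

/-- Numerical data for one half of a mirror-symmetric planar graph with unit edges. The first `axis`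
of the `half` vertices lie on the axis of symmetry. Approximate coordinates are given in units of
`10 ^ (-6)`, and `inverse` holds, for each vertex and in units of `10 ^ (-3)`, the rows of an
approximate right inverse of the derivative of the squared edge lengths. -/
structure MirrorFrame where
  axis : ℕ
  half : ℕ
  point : List (ℤ × ℤ)
  edge : List (ℕ × ℕ)
  inverse : List (List ℤ × List ℤ)
  radius : ℕ
  tol : ℕ

namespace MirrorFrame

variable (D : MirrorFrame)

def source (e : Fin D.edge.length) : ℕ := (D.edge.get e).1

def target (e : Fin D.edge.length) : ℕ := (D.edge.get e).2

def coord (v : ℕ) (c : Fin 2) : ℤ :=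
  if c = 0 then (D.point.getD v (0, 0)).1 else (D.point.getD v (0, 0)).2

def inv (v : ℕ) (c : Fin 2) (j : ℕ) : ℤ :=
  if c = 0 then (D.inverse.getD v ([], [])).1.getD j 0
  else (D.inverse.getD v ([], [])).2.getD j 0

/-- The approximate edge vector. -/
def edgeCoord (e : Fin D.edge.length) (c : Fin 2) : ℤ :=
  D.coord (D.source e) c - D.coord (D.target e) c

/-- The response of an edge vector to the `j`-th parameter. -/
def edgeInv (e : Fin D.edge.length) (c : Fin 2) (j : ℕ) : ℤ :=
  D.inv (D.source e) c j - D.inv (D.target e) c j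

/-- The number of vertices of the whole graph. -/
def size : ℕ := 2 * D.half - D.axis

/-- The vertex of the whole graph obtained from the half vertex `v`, reflected if `x` is true. -/
def copy (x : Bool) (v : ℕ) : ℕ := if x ∧ D.axis ≤ v then v + (D.half - D.axis) else v

/-- The half vertex underlying a vertex of the whole graph. -/
def fold (w : ℕ) : ℕ := if D.half ≤ w then w - (D.half - D.axis) else w

/-- The approximate coordinates of the vertices of the whole graph. -/
def fullCoord (w : ℕ) (c : Fin 2) : ℤ :=
  if D.half ≤ w ∧ c = 1 then -D.coord (D.fold w) c else D.coord (D.fold w) c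

def fullSource (e : Fin D.edge.length × Bool) : ℕ := D.copy e.2 (D.source e.1)

def fullTarget (e : Fin D.edge.length × Bool) : ℕ := D.copy e.2 (D.target e.1)

/-- The numerical conditions ensuring that the half graph is close to an exact one. -/
structure Newton : Prop where
  start : ∀ e, 2 * |∑ c, D.edgeCoord e c ^ 2 - 10 ^ 12| ≤ (D.radius : ℤ) * 10 ^ 6
  contract : ∀ e : Fin D.edge.length, 2 * 10 ^ 3 * ∑ j : Fin D.edge.length,
      |∑ c, 2 * D.edgeCoord e c * D.edgeInv e c j - if e = j then (10 : ℤ) ^ 9 else 0| +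
    4 * (D.radius : ℤ) * ∑ c, (∑ j : Fin D.edge.length, |D.edgeInv e c j|) ^ 2 ≤ 10 ^ 12
  error : ∀ v < D.half, ∀ c,
    (D.radius : ℤ) * ∑ j : Fin D.edge.length, |D.inv v c j| ≤ D.tol * 10 ^ 3
  coord_axis : ∀ v < D.axis, D.coord v 1 = 0
  inv_axis : ∀ v < D.axis, ∀ j : Fin D.edge.length, D.inv v 1 j = 0

/-- The linear functional with coefficients `a` robustly separates the edges `uv` and `xy`. -/
def SepBy (a : ℤ × ℤ) (u v x y : ℕ) : Prop :=
  ∀ i ∈ [u, v], ∀ k ∈ [x, y],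
    a.1 * D.fullCoord i 0 + a.2 * D.fullCoord i 1 + 2 * (|a.1| + |a.2|) * (D.tol : ℤ) <
      a.1 * D.fullCoord k 0 + a.2 * D.fullCoord k 1

instance (a : ℤ × ℤ) (u v x y : ℕ) : Decidable (D.SepBy a u v x y) := by
  unfold SepBy; infer_instance

/-- Coefficients of the functionals tried in order to separate the edge `uv` from another edge. -/
def directions (u v : ℕ) : List (ℤ × ℤ) :=
  let d := (D.fullCoord u 0 - D.fullCoord v 0, D.fullCoord u 1 - D.fullCoord v 1)
  [(1, 0), (0, 1), (-d.2, d.1)]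

/-- The combinatorial conditions and the robust separation of the edges of the whole graph. -/
structure Planar : Prop where
  axis_le : D.axis ≤ D.half
  source_lt : ∀ e, D.source e < D.half
  target_lt : ∀ e, D.target e < D.half
  simple : ∀ e f, Parallel D.fullSource D.fullTarget e f → e = f
  inj : ∀ v < D.size, ∀ w < v, ∃ c, 2 * (D.tol : ℤ) < |D.fullCoord v c - D.fullCoord w c|
  sep : ∀ e f : Fin D.edge.length × Bool, e.1 ≤ f.1 → Independent D.fullSource D.fullTarget e f →
    ∃ a ∈ D.directions (D.fullSource e) (D.fullTarget e),
      D.SepBy a (D.fullSource e) (D.fullTarget e) (D.fullSource f) (D.fullTarget f) ∨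
      D.SepBy a (D.fullSource f) (D.fullTarget f) (D.fullSource e) (D.fullTarget e)
  deg : ∀ w < D.size, incidence D.fullSource D.fullTarget w = 2 ∨
    incidence D.fullSource D.fullTarget w = 4
  two : ((Finset.range D.size).filter
    fun w => incidence D.fullSource D.fullTarget w = 2).card = 2

variable {D}

theorem Newton.exists_half (h : D.Newton) : ∃ q : ℕ → Fin 2 → ℝ,
    (∀ v < D.half, ∀ c, |10 ^ 6 * q v c - (D.coord v c : ℝ)| ≤ (D.tol : ℝ)) ∧
      (∀ v < D.axis, q v 1 = 0) ∧ ∀ e, ∑ c, (q (D.source e) c - q (D.target e) c) ^ 2 = 1 := by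
  obtain ⟨z, hz, hq⟩ := exists_unit_system
    (fun e c => (D.edgeCoord e c : ℝ) / 10 ^ 6) (fun e c j => (D.edgeInv e c j : ℝ) / 10 ^ 3)
    (r := (D.radius : ℝ) / 10 ^ 6) (by positivity)
    (fun e => by
      have h0 : (2 * |∑ c, (D.edgeCoord e c : ℝ) ^ 2 - 10 ^ 12| : ℝ) ≤ (D.radius : ℝ) * 10 ^ 6 := by
        exact_mod_cast h.start e
      have h1 : ∑ c, ((D.edgeCoord e c : ℝ) / 10 ^ 6) ^ 2 - 1 =
          (∑ c, (D.edgeCoord e c : ℝ) ^ 2 - 10 ^ 12) / 10 ^ 12 := by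
        simp only [div_pow, ← Finset.sum_div]; ring
      rw [h1, abs_div, abs_of_pos (by positivity : (0 : ℝ) < 10 ^ 12), div_le_iff₀ (by positivity)]
      generalize |∑ c, (D.edgeCoord e c : ℝ) ^ 2 - 10 ^ 12| = A at h0 ⊢
      linarith)
    (fun e => by
      have h0 : (2 * 10 ^ 3 * ∑ j : Fin D.edge.length,
            |∑ c, 2 * (D.edgeCoord e c : ℝ) * D.edgeInv e c j - if e = j then (10 : ℝ) ^ 9 else 0| +
          4 * (D.radius : ℝ) * ∑ c, (∑ j : Fin D.edge.length, |(D.edgeInv e c j : ℝ)|) ^ 2 : ℝ) ≤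
          10 ^ 12 := by
        have h0' := h.contract e
        simpa only [Int.cast_ite, Int.cast_pow, Int.cast_ofNat, Int.cast_zero, Int.cast_add,
          Int.cast_mul, Int.cast_abs, Int.cast_sum, Int.cast_sub, Int.cast_natCast] using
          (Int.cast_le (R := ℝ)).2 h0'
      have h1 : ∀ j : Fin D.edge.length,
          |∑ c, 2 * ((D.edgeCoord e c : ℝ) / 10 ^ 6) * ((D.edgeInv e c j : ℝ) / 10 ^ 3) -
            if e = j then 1 else 0| =
          |∑ c, 2 * (D.edgeCoord e c : ℝ) * D.edgeInv e c j - if e = j then (10 : ℝ) ^ 9 else 0| /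
            10 ^ 9 := by
        intro j
        rw [← abs_of_pos (by positivity : (0 : ℝ) < 10 ^ 9), ← abs_div, sub_div,
          abs_of_pos (by positivity : (0 : ℝ) < 10 ^ 9), Finset.sum_div]
        congr 2
        · exact Finset.sum_congr rfl fun c _ => by ring
        · split_ifs <;> norm_num
      have h2 : ∑ c, (∑ j : Fin D.edge.length, |(D.edgeInv e c j : ℝ) / 10 ^ 3|) ^ 2 =
          (∑ c, (∑ j : Fin D.edge.length, |(D.edgeInv e c j : ℝ)|) ^ 2) / 10 ^ 6 := by
        rw [Finset.sum_div]
        refine Finset.sum_congr rfl fun c _ => ?_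
        simp only [abs_div, ← Finset.sum_div]
        rw [abs_of_pos (by positivity : (0 : ℝ) < 10 ^ 3)]
        ring
      rw [h2]
      simp only [h1]
      rw [← Finset.sum_div]
      generalize ∑ j : Fin D.edge.length, |∑ c, 2 * (D.edgeCoord e c : ℝ) * D.edgeInv e c j -
        if e = j then (10 : ℝ) ^ 9 else 0| = A at h0 ⊢
      generalize ∑ c, (∑ j : Fin D.edge.length, |(D.edgeInv e c j : ℝ)|) ^ 2 = A' at h0 ⊢
      linarith)
  refine ⟨fun v c => (D.coord v c : ℝ) / 10 ^ 6 +
    ∑ j : Fin D.edge.length, (D.inv v c j : ℝ) / 10 ^ 3 * z j, ?_, ?_, ?_⟩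
  · intro v hv c
    have h0 : (D.radius : ℝ) * ∑ j : Fin D.edge.length, |(D.inv v c j : ℝ)| ≤
        (D.tol : ℝ) * 10 ^ 3 := by
      exact_mod_cast h.error v hv c
    have h1 := abs_sum_mul_le_of_norm_le (fun j : Fin D.edge.length => (D.inv v c j : ℝ) / 10 ^ 3) z
    have h2 : ∑ j : Fin D.edge.length, |(D.inv v c j : ℝ) / 10 ^ 3| =
        (∑ j : Fin D.edge.length, |(D.inv v c j : ℝ)|) / 10 ^ 3 := by
      simp only [abs_div, ← Finset.sum_div]
      rw [abs_of_pos (by positivity : (0 : ℝ) < 10 ^ 3)]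
    have h3 : 0 ≤ ∑ j : Fin D.edge.length, |(D.inv v c j : ℝ)| :=
      Finset.sum_nonneg fun _ _ => abs_nonneg _
    have h4 : 10 ^ 6 * ((D.coord v c : ℝ) / 10 ^ 6 +
          ∑ j : Fin D.edge.length, (D.inv v c j : ℝ) / 10 ^ 3 * z j) - (D.coord v c : ℝ) =
        10 ^ 6 * ∑ j : Fin D.edge.length, (D.inv v c j : ℝ) / 10 ^ 3 * z j := by ring
    rw [h4, abs_mul, abs_of_pos (by positivity : (0 : ℝ) < 10 ^ 6)]
    rw [h2] at h1
    have h5 := h1.trans (mul_le_mul_of_nonneg_left hz (by positivity))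
    linarith
  · intro v hv
    simp [h.coord_axis v hv, h.inv_axis v hv]
  · intro e
    rw [← hq e]
    refine Finset.sum_congr rfl fun c _ => ?_
    simp only [edgeCoord, edgeInv, Int.cast_sub, sub_div, sub_mul, Finset.sum_sub_distrib]
    ring

/-- The plane point of a vertex of the whole graph, given the coordinates `q` of the half graph. -/
noncomputable def position (D : MirrorFrame) (q : ℕ → Fin 2 → ℝ) (w : ℕ) :
    EuclideanSpace ℝ (Fin 2) :=
  !₂[q (D.fold w) 0, if D.half ≤ w then -q (D.fold w) 1 else q (D.fold w) 1]

theorem fold_lt (hax : D.axis ≤ D.half) {w : ℕ} (hw : w < D.size) : D.fold w < D.half := by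
  unfold fold size at *
  split_ifs <;> omega

theorem copy_lt_size (hax : D.axis ≤ D.half) (x : Bool) {v : ℕ} (hv : v < D.half) :
    D.copy x v < D.size := by
  unfold copy size
  split_ifs <;> omega

theorem position_copy {q : ℕ → Fin 2 → ℝ} (hq : ∀ v < D.axis, q v 1 = 0) (x : Bool) {v : ℕ}
    (hv : v < D.half) :
    D.position q (D.copy x v) = !₂[q v 0, if x then -q v 1 else q v 1] := by
  unfold position
  cases x
  · simp [copy, fold, hv.not_ge]
  · by_cases hxv : D.axis ≤ v
    · have h1 : D.half ≤ v + (D.half - D.axis) := by omega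
      simp [copy, fold, hxv, h1]
    · simp [copy, fold, hv.not_ge, hxv, hq v (not_le.1 hxv)]

theorem abs_position_sub_le {q : ℕ → Fin 2 → ℝ}
    (hq : ∀ v < D.half, ∀ c, |10 ^ 6 * q v c - (D.coord v c : ℝ)| ≤ (D.tol : ℝ))
    (hax : D.axis ≤ D.half) {w : ℕ} (hw : w < D.size) (c : Fin 2) :
    |10 ^ 6 * D.position q w c - (D.fullCoord w c : ℝ)| ≤ (D.tol : ℝ) := by
  have h := hq _ (fold_lt hax hw) c
  fin_cases c
  · simpa [position, fullCoord] using h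
  · by_cases hw' : D.half ≤ w
    · rw [← abs_neg]
      simpa [position, fullCoord, hw', add_comm, sub_eq_add_neg] using h
    · simpa [position, fullCoord, hw'] using h

theorem disjoint_segment_of_sepBy {pos : ℕ → EuclideanSpace ℝ (Fin 2)} {a : ℤ × ℤ} {u v x y : ℕ}
    (happ : ∀ w ∈ [u, v, x, y], ∀ c, |10 ^ 6 * pos w c - (D.fullCoord w c : ℝ)| ≤ (D.tol : ℝ))
    (h : D.SepBy a u v x y) :
    Disjoint (segment ℝ (pos u) (pos v)) (segment ℝ (pos x) (pos y)) := by
  have hlin : ∀ w ∈ [u, v, x, y],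
      |(a.1 * (10 ^ 6 * pos w 0) + a.2 * (10 ^ 6 * pos w 1) -
        (a.1 * D.fullCoord w 0 + a.2 * D.fullCoord w 1) : ℝ)| ≤
      (|(a.1 : ℝ)| + |(a.2 : ℝ)|) * (D.tol : ℝ) := by
    intro w hw
    calc _ = |(a.1 * (10 ^ 6 * pos w 0 - D.fullCoord w 0) +
          a.2 * (10 ^ 6 * pos w 1 - D.fullCoord w 1) : ℝ)| := by congr 1; ring
      _ ≤ |(a.1 : ℝ)| * |10 ^ 6 * pos w 0 - D.fullCoord w 0| +
          |(a.2 : ℝ)| * |10 ^ 6 * pos w 1 - D.fullCoord w 1| := by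
        rw [← abs_mul, ← abs_mul]; exact abs_add_le _ _
      _ ≤ |(a.1 : ℝ)| * (D.tol : ℝ) + |(a.2 : ℝ)| * (D.tol : ℝ) := by
        gcongr
        · exact happ w hw 0
        · exact happ w hw 1
      _ = _ := by ring
  have hlt : ∀ i ∈ [u, v], ∀ k ∈ [x, y],
      (a.1 * (10 ^ 6 * pos i 0) + a.2 * (10 ^ 6 * pos i 1) : ℝ) <
        a.1 * (10 ^ 6 * pos k 0) + a.2 * (10 ^ 6 * pos k 1) := by
    intro i hi k hk
    have h1 := abs_le.1 (hlin i (by simp at hi ⊢; tauto))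
    have h2 := abs_le.1 (hlin k (by simp at hk ⊢; tauto))
    have h3 : ((a.1 * D.fullCoord i 0 + a.2 * D.fullCoord i 1 +
          2 * (|a.1| + |a.2|) * (D.tol : ℤ) : ℤ) : ℝ) <
        (a.1 * D.fullCoord k 0 + a.2 * D.fullCoord k 1 : ℤ) := Int.cast_lt.2 (h i hi k hk)
    push_cast at h1 h2 h3
    linarith [h1.2, h2.1]
  let m : ℝ := min (a.1 * (10 ^ 6 * pos x 0) + a.2 * (10 ^ 6 * pos x 1))
    (a.1 * (10 ^ 6 * pos y 0) + a.2 * (10 ^ 6 * pos y 1))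
  have hm : ∀ i ∈ [u, v], (a.1 * 10 ^ 6 : ℝ) * pos i 0 + (a.2 * 10 ^ 6 : ℝ) * pos i 1 < m := by
    intro i hi
    rw [mul_assoc, mul_assoc]
    exact lt_min (hlt i hi x (by simp)) (hlt i hi y (by simp))
  refine disjoint_segment_of_linear_lt (hm u (by simp)) (hm v (by simp)) ?_ ?_ <;>
    rw [mul_assoc, mul_assoc]
  · exact min_le_left _ _
  · exact min_le_right _ _

theorem exists_matchstickGraph (hN : D.Newton) (hP : D.Planar) :
    ∃ G : MatchstickGraph, G.IsTwoFourRegular ∧ G.V.card = D.size ∧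
      (G.V.filter (fun v => G.degree v = 2)).card = 2 := by
  obtain ⟨q, happ, hax, hunit⟩ := hN.exists_half
  have hpos {w : ℕ} (hw : w < D.size) (c : Fin 2) :=
    abs_position_sub_le happ hP.axis_le hw c
  have hs (e) : D.fullSource e < D.size := copy_lt_size hP.axis_le _ (hP.source_lt _)
  have ht (e) : D.fullTarget e < D.size := copy_lt_size hP.axis_le _ (hP.target_lt _)
  have hne {v w : ℕ} (hv : v < D.size) (hw : w < v) : D.position q v ≠ D.position q w := by
    intro heq
    obtain ⟨c, hc⟩ := hP.inj v hv w hw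
    have h1 := abs_le.1 (hpos hv c)
    have h2 := abs_le.1 (hpos (hw.trans hv) c)
    have hc' : 2 * (D.tol : ℝ) < |(D.fullCoord v c - D.fullCoord w c : ℝ)| := by exact_mod_cast hc
    rw [heq] at h1
    rcases lt_abs.1 hc' with h | h <;> linarith
  have hsep (e f : Fin D.edge.length × Bool) (hle : e.1 ≤ f.1)
      (hind : Independent D.fullSource D.fullTarget e f) :
      Disjoint (segment ℝ (D.position q (D.fullSource e)) (D.position q (D.fullTarget e)))
        (segment ℝ (D.position q (D.fullSource f)) (D.position q (D.fullTarget f))) := by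
    obtain ⟨a, -, h | h⟩ := hP.sep e f hle hind
    · refine disjoint_segment_of_sepBy (fun w hw => hpos ?_) h
      simp only [List.mem_cons, List.not_mem_nil, or_false] at hw
      rcases hw with rfl | rfl | rfl | rfl <;> first | apply hs | apply ht
    · refine (disjoint_segment_of_sepBy (fun w hw => hpos ?_) h).symm
      simp only [List.mem_cons, List.not_mem_nil, or_false] at hw
      rcases hw with rfl | rfl | rfl | rfl <;> first | apply hs | apply ht
  have key := exists_matchstickGraph_of_embedding (W := Finset.range D.size) (s := D.fullSource)
    (t := D.fullTarget) (pos := D.position q) ?_ (by simpa using hs) (by simpa using ht) ?_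
    hP.simple ?_ (by simpa using hP.deg)
  · rwa [Finset.card_range, hP.two] at key
  · intro v hv w hw h
    simp only [Finset.coe_range, Set.mem_Iio] at hv hw
    rcases lt_trichotomy v w with hvw | hvw | hvw
    · exact absurd h.symm (hne hw hvw)
    · exact hvw
    · exact absurd h (hne hv hvw)
  · intro e
    have h := hunit e.1
    rw [fullSource, fullTarget, position_copy hax _ (hP.source_lt _),
      position_copy hax _ (hP.target_lt _), EuclideanSpace.dist_eq, Real.sqrt_eq_one,
      ← h, Fin.sum_univ_two, Fin.sum_univ_two, Real.dist_eq, Real.dist_eq, sq_abs, sq_abs]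
    cases e.2
    · simp
    · simp only [Matrix.cons_val_zero, Matrix.cons_val_one, if_true]
      simp
      ring
  · intro e f hind
    rcases le_total e.1 f.1 with h | h
    · exact hsep e f h hind
    · refine (hsep f e h ?_).symm
      exact ⟨hind.1.symm, hind.2.2.1.symm, hind.2.1.symm, hind.2.2.2.symm⟩

end MirrorFrame

/-- Half of a mirror-symmetric graph with 22 vertices. -/
def frameTwentyTwo : MirrorFrame where
  axis := 2
  half := 12
  point :=
    [(0, 0), (2975584, 0), (420086, 907485), (840171, 1814969), (995947, 89937), (1416033, 997422),
     (1668084, 2375825), (1739843, 1378403), (1991895, 179875), (2495997, 2936682),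
     (2567757, 1939260), (2639516, 941838)]
  edge :=
    [(0, 2), (0, 4), (1, 8), (1, 11), (2, 3), (2, 4), (2, 5), (3, 5), (3, 6), (3, 7), (4, 5),
     (4, 8), (5, 8), (6, 7), (6, 9), (6, 10), (7, 10), (7, 11), (8, 11), (9, 10), (10, 11)]
  inverse :=
    [([], []),
     ([-52, 524, 544, -104, -52, 0, 0, 107, 0, -93, 0, 524, 107, 0, 0, 0, 0, -93, 75, 0, 0], []),
     ([123, 450, 59, -173, -87, -262, -262, 179, 0, -155, 262, 188, -83, 0, 0, 0, 0, -155, 125, 0,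
       0],
      [494, -208, -27, 80, 40, 121, 121, -83, 0, 72, -121, -87, 38, 0, 0, 0, 0, 72, -58, 0, 0]),
     ([299, 376, 118, -346, 299, 0, 0, -166, 0, -310, 0, 376, -166, 0, 0, 0, 0, -310, 251, 0, 0],
      [413, -174, -55, 160, 413, 0, 0, 77, 0, 143, 0, -174, 77, 0, 0, 0, 0, 143, -116, 0, 0]),
     ([-35, 517, 6, -17, -9, 26, -26, 18, 0, -15, 26, 19, -8, 0, 0, 0, 0, -15, 12, 0, 0],
      [383, -161, -65, 190, 95, -288, 288, -196, 0, 170, -288, -206, 91, 0, 0, 0, 0, 170, -138, 0,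
       0]),
     ([141, 443, 65, -190, -95, -236, 236, 197, 0, -170, 236, 207, -91, 0, 0, 0, 0, -170, 138, 0,
       0],
      [301, -127, -92, 270, 135, -166, 166, -279, 0, 242, 166, -293, 130, 0, 0, 0, 0, 242, -196, 0,
       0]),
     ([407, 330, 155, -453, 407, 0, 0, -100, 414, -127, 0, 330, -100, -162, 0, -162, 162, -288, 183,
       0, -162],
      [253, -107, -109, 318, 253, 0, 0, -20, 280, -127, 0, -107, -20, 239, 0, 239, -239, 112, -17,
       0, 239]),
     ([214, 412, 90, -263, 214, 0, 0, -217, 126, 123, 0, 412, -217, -126, 0, 126, -126, -327, 303,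
       0, 126],
      [239, -101, -113, 332, 239, 0, 0, -29, 260, -109, 0, -101, -29, -260, 0, 260, -260, 109, -8,
       0, 260]),
     ([-17, 509, 12, -34, -17, 0, 0, 35, 0, -31, 0, 509, 35, 0, 0, 0, 0, -31, 25, 0, 0],
      [190, -80, -130, 380, 190, 0, 0, -393, 0, 340, 0, -80, -393, 0, 0, 0, 0, 340, -275, 0, 0]),
     ([516, 285, 191, -561, 516, 0, 0, -35, 576, -267, 0, 285, -35, 0, 576, 0, 0, -267, 116, -324,
       -324],
      [93, -39, -163, 476, 93, 0, 0, -117, 41, 80, 0, -39, -117, 0, 41, 0, 0, 80, 83, 478, 478]),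
     ([323, 366, 126, -370, 323, 0, 0, -152, 288, -17, 0, 366, -152, -288, 0, 288, 288, -305, 236,
       0, -36],
      [79, -33, -167, 490, 79, 0, 0, -126, 21, 98, 0, -33, -126, -21, 0, 21, 21, 77, 91, 0, 499]),
     ([130, 447, 61, -180, 130, 0, 0, -269, 0, 233, 0, 447, -269, 0, 0, 0, 0, 233, 356, 0, 0],
      [65, -27, -172, 504, 65, 0, 0, -134, 0, 116, 0, -27, -134, 0, 0, 0, 0, 116, 100, 0, 0])]
  radius := 5
  tol := 25

theorem newton_frameTwentyTwo : frameTwentyTwo.Newton where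
  start := by decide +kernel
  contract := by decide +kernel
  error := by decide +kernel
  coord_axis := by decide +kernel
  inv_axis := by decide +kernel

theorem planar_frameTwentyTwo : frameTwentyTwo.Planar where
  axis_le := by decide +kernel
  source_lt := by decide +kernel
  target_lt := by decide +kernel
  simple := by decide +kernel
  inj := by decide +kernel
  sep := by decide +kernel
  deg := by decide +kernel
  two := by decide +kernel

/-- Half of a mirror-symmetric graph with 30 vertices. -/
def frameThirty : MirrorFrame where
  axis := 2
  half := 16
  point :=
    [(0, 0), (2916366, 0), (238363, 971176), (476727, 1942352), (715090, 2913528), (960245, 279159),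
     (1198608, 1250335), (1436972, 2221511), (1570791, 3430999), (1591084, 2431205),
     (1735509, 1267113), (1960154, 292672), (2426492, 3948470), (2446785, 2948676),
     (2467077, 1948882), (2691722, 974441)]
  edge :=
    [(0, 2), (0, 5), (1, 11), (1, 15), (2, 3), (2, 5), (2, 6), (3, 4), (3, 6), (3, 7), (4, 7),
     (4, 8), (4, 9), (5, 6), (5, 11), (6, 7), (7, 10), (8, 9), (8, 12), (8, 13), (9, 13), (9, 14),
     (10, 11), (10, 14), (10, 15), (11, 15), (12, 13), (13, 14), (14, 15)]
  inverse :=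
    [([], []),
     ([-161, 561, 563, -169, -94, 67, -67, -26, 67, -67, 99, 0, -89, 105, 562, 38, 53, 0, 0, 0, 0,
       -89, 127, 76, -72, 72, 0, 0, -97], []),
     ([23, 515, 43, -184, -201, -386, -175, -26, 175, -175, 98, 0, -88, 421, 116, 246, -128, 0, 0,
       0, 0, -88, -46, 76, -87, 87, 0, 0, -97],
      [509, -126, -11, 45, 49, 95, 43, 6, -43, 43, -24, 0, 22, -103, -28, -60, 31, 0, 0, 0, 0, 22,
       11, -19, 21, -21, 0, 0, 24]),
     ([208, 469, 86, -368, -3, -211, 211, -53, -211, -350, 197, 0, -176, 282, 231, 493, -257, 0, 0,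
       0, 0, -176, -93, 152, -174, 174, 0, 0, -193],
      [464, -115, -21, 90, 516, 52, -52, 13, 52, 86, -48, 0, 43, -69, -57, -121, 63, 0, 0, 0, 0, 43,
       23, -37, 43, -43, 0, 0, 47]),
     ([393, 423, 130, -552, 357, -36, 36, 321, -36, 36, -266, 0, -264, 142, 347, 178, -385, 0, 0, 0,
       0, -264, -139, 228, -262, 262, 0, 0, -290],
      [418, -104, -32, 135, 427, 9, -9, 436, 9, -9, 65, 0, 65, -35, -85, -44, 94, 0, 0, 0, 0, 65,
       34, -56, 64, -64, 0, 0, 71]),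
     ([-108, 548, 12, -53, -58, 50, -50, -8, 50, -50, 28, 0, -25, 121, 33, 71, -37, 0, 0, 0, 0, -25,
       -13, 22, -25, 25, 0, 0, -28],
      [372, -92, -43, 182, 199, -173, 173, 26, -173, 173, -97, 0, 87, -417, -114, -244, 127, 0, 0,
       0, 0, 87, 46, -75, 86, -86, 0, 0, 96]),
     ([77, 502, 56, -237, -259, -336, 336, -34, 225, -225, 127, 0, -113, 381, 149, 317, -165, 0, 0,
       0, 0, -113, -60, 98, -112, 112, 0, 0, -124],
      [327, -81, -53, 227, 248, -78, 78, 32, -216, 216, -121, 0, 109, 34, -143, -304, 158, 0, 0, 0,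
       0, 109, 57, -94, 108, -108, 0, 0, 119]),
     ([261, 456, 99, -421, 101, -161, 161, -60, -161, 161, 225, 0, -202, 242, 264, 402, -293, 0, 0,
       0, 0, -202, -106, 173, -199, 199, 0, 0, -221],
      [281, -70, -64, 272, 160, -121, 121, 39, -121, 121, -145, 0, 130, 69, -171, 190, 190, 0, 0, 0,
       0, 130, 69, -112, 129, -129, 0, 0, 143]),
     ([491, 399, 153, -649, 466, -25, 25, 441, -25, 25, -215, 428, -120, 128, 335, 153, -319, -149,
       0, -149, 149, -270, -107, 197, -225, 225, 0, -149, -425],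
      [256, -63, -70, 297, 246, -9, 9, 237, -9, 9, -18, 259, -173, -11, -65, -1, -15, 247, 0, 247,
       -247, 74, -19, -5, 4, -4, 0, 247, 294]),
     ([301, 446, 108, -460, 255, -46, 46, 208, -46, 46, -313, 139, 179, 156, 358, 202, -446, -139,
       0, 139, -139, -259, -169, 256, -296, 296, 0, 139, -165],
      [252, -63, -71, 301, 242, -10, 10, 232, -10, 10, -20, 253, -167, -10, -65, 0, -17, -253, 0,
       253, -253, 74, -20, -4, 2, -2, 0, 253, 299]),
     ([80, 501, 56, -240, 67, -13, 13, 53, -13, 13, -200, 0, 179, 147, 436, 161, -312, 0, 0, 0, 0,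
       179, -282, -154, -436, 436, 0, 0, 196],
      [224, -56, -77, 329, 149, -75, 75, 74, -75, 75, -278, 0, 249, 39, -117, 114, -340, 0, 0, 0, 0,
       249, 14, -215, 55, -55, 0, 0, 274]),
     ([-106, 547, 13, -55, -57, 49, -49, -8, 49, -49, 30, 0, -27, 115, 533, 66, -31, 0, 0, 0, 0,
       -27, -7, 23, -26, 26, 0, 0, -29],
      [182, -45, -87, 371, 121, -61, 61, 60, -61, 61, -225, 0, 202, 32, -95, 92, -275, 0, 0, 0, 0,
       202, -436, -174, 149, -149, 0, 0, 222]),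
     ([589, 374, 176, -747, 576, -14, 14, 562, -14, 14, -165, 577, -275, 113, 323, 127, -253, 0,
       577, 0, 0, -275, -75, 166, -188, 188, -299, -299, -559],
      [93, -23, -108, 459, 65, -28, 28, 38, -28, 28, -102, 12, 83, 14, -45, 41, -124, 0, 12, 0, 0,
       83, -73, 46, -57, 57, 494, 494, 516]),
     ([399, 422, 131, -558, 364, -35, 35, 329, -35, 35, -262, 289, 24, 141, 346, 177, -380, -289, 0,
       289, 289, -265, -137, 225, -259, 259, 0, -10, -299],
      [89, -22, -109, 463, 61, -28, 28, 33, -28, 28, -104, 6, 89, 14, -45, 42, -127, -6, 0, 6, 6,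
       83, -74, 47, -58, 58, 0, 500, 521]),
     ([209, 469, 87, -369, 153, -57, 57, 96, -57, 57, -360, 0, 323, 170, 369, 226, -508, 0, 0, 0, 0,
       323, -199, 285, -330, 330, 0, 0, -39],
      [85, -21, -110, 467, 57, -29, 29, 28, -29, 29, -106, 0, 95, 15, -45, 43, -129, 0, 0, 0, 0, 95,
       -75, 48, -59, 59, 0, 0, 526]),
     ([24, 515, 43, -184, 29, 5, -5, 35, 5, -5, -131, 0, 117, 138, 465, 132, -228, 0, 0, 0, 0, 117,
       -318, -101, 81, 482, 0, 0, 128],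
      [43, -11, -120, 510, 28, -14, 14, 14, -14, 14, -53, 0, 47, 7, -22, 22, -65, 0, 0, 0, 0, 47,
       -102, -41, 35, 95, 0, 0, 52])]
  radius := 4
  tol := 31

theorem newton_frameThirty : frameThirty.Newton where
  start := by decide +kernel
  contract := by decide +kernel
  error := by decide +kernel
  coord_axis := by decide +kernel
  inv_axis := by decide +kernel

theorem planar_frameThirty : frameThirty.Planar where
  axis_le := by decide +kernel
  source_lt := by decide +kernel
  target_lt := by decide +kernel
  simple := by decide +kernel
  inj := by decide +kernel
  sep := by decide +kernel
  deg := by decide +kernel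
  two := by decide +kernel

/-- Half of a mirror-symmetric graph with 31 vertices. -/
def frameThirtyOne : MirrorFrame where
  axis := 3
  half := 17
  point :=
    [(0, 0), (1978719, 0), (3977371, 0), (368679, 929557), (737358, 1859114), (853392, 2852359),
     (969426, 3845604), (989359, 145493), (1358038, 1075050), (1655551, 2255248),
     (1771584, 3248493), (2042293, 1804293), (2510169, 920499), (2573743, 2651382),
     (2978045, 36705), (3041619, 1767588), (3509495, 883794)]
  edge :=
    [(0, 3), (0, 7), (1, 7), (1, 14), (2, 14), (2, 16), (3, 4), (3, 7), (3, 8), (4, 5), (4, 8),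
     (4, 9), (5, 6), (5, 9), (5, 10), (6, 10), (7, 8), (8, 11), (9, 10), (9, 13), (10, 13),
     (11, 12), (11, 13), (11, 15), (12, 14), (12, 15), (12, 16), (13, 15), (14, 16), (15, 16)]
  inverse :=
    [([], []),
     ([-128, 553, 518, 13, 20, -44, -98, 30, -30, 0, 72, -88, 0, 0, 0, 0, 143, 99, 0, -88, 0, 15,
       101, 7, 8, -7, 7, -57, -7, -51], []),
     ([-139, 557, 529, 524, 536, -76, -102, 37, -37, 0, 75, -92, 0, 0, 0, 0, 139, 89, 0, -92, 0, 28,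
       105, -8, 36, 8, -8, -60, 8, -68], []),
     ([45, 489, 42, 41, 65, -139, -312, -442, -95, 0, 229, -280, 0, 0, 0, 0, 455, 316, 0, -280, 0,
       48, 322, 22, 26, -22, 22, -184, -22, -161],
      [520, -194, -17, -16, -26, 55, 124, 175, 38, 0, -91, 111, 0, 0, 0, 0, -181, -125, 0, 111, 0,
       -19, -128, -9, -10, 9, -9, 73, 9, 64]),
     ([174, 440, 84, 83, 130, -278, -172, -346, 346, 0, -79, -560, 0, 0, 0, 0, 374, 631, 0, -560, 0,
       96, 645, 44, 51, -44, 44, -367, -44, -323],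
      [469, -175, -33, -33, -52, 110, 606, 137, -137, 0, 31, 222, 0, 0, 0, 0, -148, -250, 0, 222, 0,
       -38, -256, -18, -20, 18, -18, 146, 18, 128]),
     ([308, 391, 173, 171, 202, -432, 111, -197, 197, 58, -29, 57, 0, -287, -287, 0, 254, 395, 287,
       -230, -287, 63, 407, 24, 39, -24, 24, -480, -24, -456],
      [453, -169, -44, -43, -60, 128, 573, 120, -120, 497, 26, 150, 0, 33, 33, 0, -134, -223, -33,
       184, 33, -34, -228, -15, -19, 15, -15, 159, 15, 144]),
     ([441, 341, 262, 259, 274, -585, 394, -47, 47, 345, 20, 101, 345, 0, 0, -573, 134, 158, 0, 101,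
       -573, 31, 168, 4, 26, -4, 4, -594, -4, -590],
      [438, -163, -54, -53, -68, 146, 540, 102, -102, 463, 20, 145, 463, 0, 0, 67, -120, -195, 0,
       145, 67, -30, -200, -13, -17, 13, -13, 172, 13, 159]),
     ([-64, 529, 7, 6, 10, -22, -49, 15, -15, 0, 36, -44, 0, 0, 0, 0, 71, 49, 0, -44, 0, 7, 50, 3,
       4, -3, 3, -29, -3, -25],
      [434, -162, -44, -44, -69, 148, 333, -101, 101, 0, -244, 298, 0, 0, 0, 0, -485, -336, 0, 298,
       0, -51, -343, -24, -27, 24, -24, 195, 24, 172]),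
     ([65, 481, 48, 48, 75, -161, -361, -427, 427, 0, 265, -324, 0, 0, 0, 0, 443, 365, 0, -324, 0,
       55, 373, 26, 30, -26, 26, -212, -26, -187],
      [383, -143, -61, -60, -95, 203, 456, 74, -74, 0, -334, 409, 0, 0, 0, 0, -94, -461, 0, 409, 0,
       -70, -471, -32, -37, 32, -32, 268, 32, 236]),
     ([227, 421, 119, 118, 159, -340, -59, -287, 287, -114, -59, 31, 0, 114, -114, 0, 326, 537, 114,
       -428, -114, 83, 550, 36, 46, -36, 36, -412, -36, -376],
      [346, -129, -116, -114, -118, 252, 344, -1, 1, 265, -15, 115, 0, -265, 265, 0, -37, -32, -265,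
       -83, 265, -8, -35, 1, -9, -1, 1, 250, -1, 251]),
     ([361, 371, 208, 206, 231, -493, 224, -137, 137, 172, -10, 75, 0, -172, 172, 0, 206, 300, 172,
       -98, -401, 50, 311, 16, 34, -16, 16, -526, -16, -509],
      [330, -123, -126, -125, -126, 270, 311, -19, 19, 232, -20, 109, 0, -232, 232, 0, -23, -4, 232,
       -122, 299, -4, -8, 3, -7, -3, 3, 264, -3, 267]),
     ([146, 451, 274, 272, 136, -290, 4, -143, 143, 0, -3, 4, 0, 0, 0, 0, 234, 329, 0, 4, 0, -270,
       -4, -146, -123, 146, -146, 2, 146, -144],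
      [306, -114, -273, -270, -152, 325, 114, -193, 193, 0, -83, 102, 0, 0, 0, 0, 102, 258, 0, 102,
       0, 235, -117, 129, 106, -129, 129, 67, -129, 196]),
     ([7, 503, 399, 395, 82, -175, -48, -55, 55, 0, 35, -43, 0, 0, 0, 0, 187, 212, 0, -43, 0, -135,
       50, 182, -295, -182, -329, -28, 329, 153],
      [232, -87, -207, -205, -181, 386, 86, -146, 146, 0, -63, 77, 0, 0, 0, 0, 77, 196, 0, 77, 0,
       -259, -89, 303, 15, -303, 32, 51, -32, 353]),
     ([281, 401, 155, 153, 188, -401, 54, -227, 227, 0, -39, 48, 0, 0, 0, 0, 278, 442, 0, 48, 0, 70,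
       455, 28, 41, -28, 28, -458, -28, -429],
      [222, -83, -198, -196, -184, 394, 82, -140, 140, 0, -60, 74, 0, 0, 0, 0, 74, 187, 0, 74, 0,
       22, 185, 19, 3, -19, 19, 355, -19, 375]),
     ([-133, 555, 524, 518, 28, -60, -100, 33, -33, 0, 73, -90, 0, 0, 0, 0, 141, 94, 0, -90, 0, 21,
       103, -1, 22, 1, -1, -59, 1, -59],
      [158, -59, -141, -140, -209, 447, 59, -100, 100, 0, -43, 53, 0, 0, 0, 0, 53, 133, 0, 53, 0,
       -177, -61, 206, -383, -206, 206, 34, -206, 241]),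
     ([141, 453, 279, 277, 134, -286, 2, -139, 139, 0, -1, 2, 0, 0, 0, 0, 232, 325, 0, 2, 0, -284,
       -2, 356, -130, 154, -154, 1, 154, -132],
      [148, -55, -132, -131, -213, 455, 55, -93, 93, 0, -40, 49, 0, 0, 0, 0, 49, 125, 0, 49, 0,
       -165, -57, 193, -88, 77, -77, 32, 77, 532]),
     ([1, 505, 404, 400, 80, -170, -50, -51, 51, 0, 37, -45, 0, 0, 0, 0, 185, 207, 0, -45, 0, -128,
       52, 174, -302, -174, 174, -29, 336, 145],
      [74, -28, -66, -65, -242, 516, 27, -47, 47, 0, -20, 25, 0, 0, 0, 0, 25, 62, 0, 25, 0, -83,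
       -28, 96, -179, -96, 96, 16, 174, 113])]
  radius := 3
  tol := 20

theorem newton_frameThirtyOne : frameThirtyOne.Newton where
  start := by decide +kernel
  contract := by decide +kernel
  error := by decide +kernel
  coord_axis := by decide +kernel
  inv_axis := by decide +kernel

theorem planar_frameThirtyOne : frameThirtyOne.Planar where
  axis_le := by decide +kernel
  source_lt := by decide +kernel
  target_lt := by decide +kernel
  simple := by decide +kernel
  inj := by decide +kernel
  sep := by decide +kernel
  deg := by decide +kernel
  two := by decide +kernel

/-- Half of a mirror-symmetric graph with 34 vertices. -/
def frameThirtyFour : MirrorFrame where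
  axis := 2
  half := 18
  point :=
    [(0, 0), (2000000, 0), (18237, 999834), (36475, 1999667), (750000, 2700297), (875000, 484123),
     (893237, 1483957), (1000000, 1732051), (1250000, 3566322), (1750000, 968246),
     (1750000, 2700297), (1750000, 4432347), (1856763, 1216340), (1875000, 2216174),
     (2250000, 3566322), (2713525, 700629), (2731763, 1700463), (2750000, 2700297)]
  edge :=
    [(0, 2), (0, 5), (1, 9), (1, 15), (2, 3), (2, 5), (2, 6), (3, 4), (3, 6), (3, 7), (4, 7),
     (4, 8), (4, 10), (5, 6), (5, 9), (6, 9), (7, 12), (7, 13), (8, 10), (8, 11), (8, 14), (9, 15),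
     (10, 14), (10, 17), (11, 14), (12, 13), (12, 15), (12, 16), (13, 16), (13, 17), (14, 17),
     (15, 16), (16, 17)]
  inverse :=
    [([], []),
     ([-280, 577, 405, -559, -280, 0, 0, 559, 2820, -2927, -405, 0, 500, 0, 577, 2820, -2820, -577,
       0, 0, 0, 2927, 0, 500, 0, 0, -2820, 0, 0, -577, 0, 280, 280], []),
     ([-27, 572, -206, -72, -36, -289, -289, 72, 364, -378, -52, 0, 65, 289, 283, 75, -364, -75, 0,
       0, 0, 378, 0, 65, 0, 0, -364, 0, 0, -75, 0, 36, 36],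
      [501, -10, 4, 1, 1, 5, 5, -1, -7, 7, 1, 0, -1, -5, -5, -1, 7, 1, 0, 0, 0, -7, 0, -1, 0, 0, 7,
       0, 0, 1, 0, -1, -1]),
     ([226, 567, -412, -144, 226, 0, 0, 144, 151, -756, -104, 0, 129, 0, 567, 151, -728, -149, 0, 0,
       0, 756, 0, 129, 0, 0, -728, 0, 0, -149, 0, 72, 72],
      [496, -10, 8, 3, 496, 0, 0, -3, -3, 14, 2, 0, -2, 0, -10, -3, 13, 3, 0, 0, 0, -14, 0, -2, 0,
       0, 13, 0, 0, 3, 0, -1, -1]),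
     ([403, 563, -556, -195, 403, 0, 0, 349, -326, 39, -253, 0, -188, 0, 563, -326, -251, 216, 0, 0,
       0, 366, 0, -188, 0, 0, -251, 0, 0, 216, 0, -105, -105],
      [316, -7, 154, 54, 316, 0, 0, 502, 483, -795, 153, 0, 320, 0, -7, 483, -472, -370, 0, 0, 0,
       383, 0, 320, 0, 0, -472, 0, 0, -370, 0, 179, 179]),
     ([-157, 575, -100, -35, -17, 140, -140, 35, 176, -183, -25, 0, 31, 140, 137, 37, -176, -36, 0,
       0, 0, 183, 0, 31, 0, 0, -176, 0, 0, -36, 0, 17, 17],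
      [284, -6, 180, 63, 32, -253, 253, -63, -319, 331, 46, 0, -56, -253, -248, -66, 319, 65, 0, 0,
       0, -331, 0, -56, 0, 0, 319, 0, 0, 65, 0, -32, -32]),
     ([95, 569, -306, -107, -54, -149, 149, 107, 540, -561, -77, 0, 96, 149, 421, 112, -540, -111,
       0, 0, 0, 561, 0, 96, 0, 0, -540, 0, 0, -111, 0, 54, 54],
      [280, -6, 184, 64, 32, -247, 247, -64, -325, 338, 47, 0, -58, 247, -253, -67, 325, 67, 0, 0,
       0, -338, 0, -58, 0, 0, 325, 0, 0, 67, 0, -32, -32]),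
     ([158, 568, -357, -125, 158, 0, 0, 280, 333, -500, -202, 0, 250, 0, 568, 333, -910, -289, 0, 0,
       0, 905, 0, 250, 0, 0, -910, 0, 0, -289, 0, 140, 140],
      [253, -5, 206, 72, 253, 0, 0, 484, 653, -934, -350, 0, 433, 0, -5, 653, -642, -500, 0, 0, 0,
       522, 0, 433, 0, 0, -642, 0, 0, -500, 0, 242, 242]),
     ([621, 558, -735, -257, 621, 0, 0, 412, -915, 520, -74, 250, 187, 0, 558, -915, 338, 221, -250,
       0, -250, -116, 250, -63, 0, 0, 338, 0, 0, 221, -250, -324, -324],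
      [189, -4, 257, 90, 189, 0, 0, 466, 823, -1073, 50, 433, 104, 0, -4, 823, -812, -372, 144, 0,
       144, 661, -144, 248, 0, 0, -812, 0, 0, -372, 144, 305, 305]),
     ([-35, 572, -199, -70, -35, 0, 0, 70, 353, -366, -51, 0, 63, 0, 572, 353, -353, -72, 0, 0, 0,
       366, 0, 63, 0, 0, -353, 0, 0, -72, 0, 35, 35],
      [63, -1, 360, 126, 63, 0, 0, -126, -637, 661, 91, 0, -113, 0, -1, -637, 637, 130, 0, 0, 0,
       -661, 0, -113, 0, 0, 637, 0, 0, 130, 0, -63, -63]),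
     ([403, 563, -556, -195, 403, 0, 0, 349, -326, 39, -253, 0, 312, 0, 563, -326, -251, 216, 0, 0,
       0, 366, 0, -188, 0, 0, -251, 0, 0, 216, 0, -105, -105],
      [63, -1, 360, 126, 63, 0, 0, 430, 1163, -1351, -53, 289, 176, 0, -1, 1163, -1152, -375, -289,
       0, 289, 939, -289, 176, 0, 0, -1152, 0, 0, -375, 289, 432, 432]),
     ([840, 554, -913, -320, 840, 0, 0, 474, -1504, 1002, 104, 500, 62, 0, 554, -1504, 927, 226, 0,
       500, 0, -598, 0, 62, -500, 0, 927, 0, 0, 226, -500, -542, -542],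
      [63, -1, 360, 126, 63, 0, 0, 430, 1163, -1351, -53, 289, 176, 0, -1, 1163, -1152, -375, 0,
       289, 0, 939, 0, 176, 289, 0, -1152, 0, 0, -375, 289, 432, 432]),
     ([28, 571, -251, -88, 28, 0, 0, 242, 684, -787, -175, 0, 217, 0, 571, 684, -833, -101, 0, 0, 0,
       1191, 0, 217, 0, -149, -1261, -149, 149, -250, 0, 270, 121],
      [36, -1, 382, 134, 36, 0, 0, 422, 1236, -1411, -306, 0, 378, 0, -1, 1236, -1483, -189, 0, 0,
       0, 999, 0, 378, 0, -247, -1225, -247, 247, -436, 0, 458, 211]),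
     ([280, 566, -456, -160, 280, 0, 0, 314, 4, -231, -228, 0, 281, 0, 566, 4, -441, 113, 0, 0, 0,
       635, 0, 281, 0, -140, -581, 140, -140, -325, 0, 17, 157],
      [32, -1, 386, 135, 32, 0, 0, 421, 1248, -1421, -305, 0, 377, 0, -1, 1248, -1490, -193, 0, 0,
       0, 1009, 0, 377, 0, 253, -1238, -253, 253, -435, 0, 463, 210]),
     ([621, 558, -735, -257, 621, 0, 0, 412, -915, 520, -74, 250, 187, 0, 558, -915, 338, 221, -250,
       0, 250, -116, 250, -63, 0, 0, 338, 0, 0, 221, -250, -324, -324],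
      [-63, 1, 463, 162, -63, 0, 0, 394, 1503, -1630, -156, 144, 248, 0, 1, 1503, -1493, -377, -144,
       0, 144, 1218, 144, 104, 0, 0, -1493, 0, 0, -377, 433, 558, 558]),
     ([-103, 574, -144, -51, -103, 0, 0, 205, 1035, -1074, -148, 0, 183, 0, 574, 1035, -1035, -212,
       0, 0, 0, 1478, 0, 183, 0, 0, -1035, 0, 0, -212, 0, 103, 103],
      [-180, 4, 559, 196, -180, 0, 0, 360, 1819, -1887, -261, 0, 322, 0, 4, 1819, -1819, -372, 0, 0,
       0, 1475, 0, 322, 0, 0, -1819, 0, 0, -372, 0, 180, 180]),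
     ([150, 568, -350, -123, 150, 0, 0, 277, 354, -518, -201, 0, 248, 0, 568, 354, -643, 2, 0, 0, 0,
       922, 0, 248, 0, -289, -932, 289, 289, -286, 0, 148, 139],
      [-185, 4, 563, 197, -185, 0, 0, 359, 1831, -1898, -260, 0, 321, 0, 4, 1831, -1826, -376, 0, 0,
       0, 1486, 0, 321, 0, 5, -1820, -5, -5, -371, 0, 679, 180]),
     ([403, 563, -556, -195, 403, 0, 0, 349, -326, 39, -253, 0, 312, 0, 563, -326, -251, 216, 0, 0,
       0, 366, 0, 312, 0, 0, -251, 0, 0, 216, 0, -105, -105],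
      [-189, 4, 566, 198, -189, 0, 0, 358, 1843, -1908, -259, 0, 320, 0, 4, 1843, -1833, -380, 0, 0,
       0, 1496, 0, 320, 0, 0, -1833, 0, 0, -380, 0, 684, 684])]
  radius := 5
  tol := 118

theorem newton_frameThirtyFour : frameThirtyFour.Newton where
  start := by decide +kernel
  contract := by decide +kernel
  error := by decide +kernel
  coord_axis := by decide +kernel
  inv_axis := by decide +kernel

theorem planar_frameThirtyFour : frameThirtyFour.Planar where
  axis_le := by decide +kernel
  source_lt := by decide +kernel
  target_lt := by decide +kernel
  simple := by decide +kernel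
  inj := by decide +kernel
  sep := by decide +kernel
  deg := by decide +kernel
  two := by decide +kernel

/-- Half of a mirror-symmetric graph with 35 vertices. -/
def frameThirtyFive : MirrorFrame where
  axis := 3
  half := 19
  point :=
    [(0, 0), (270091, 0), (2121320, 0), (-1716184, 3440329), (-1320900, 2521771),
     (-925615, 1603212), (-790569, 612372), (-723047, 3323376), (-327762, 2404818), (0, 1224745),
     (135045, 990839), (135045, 2215584), (270091, 3206424), (925615, 1603212), (1060660, 1369306),
     (1060660, 2594051), (1195706, 378467), (1851230, 1981679), (1986275, 990839)]
  edge :=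
    [(0, 6), (0, 10), (1, 10), (1, 16), (2, 16), (2, 18), (3, 4), (3, 7), (4, 5), (4, 7), (4, 8),
     (5, 6), (5, 8), (5, 9), (6, 9), (6, 10), (7, 8), (7, 12), (8, 12), (9, 11), (9, 13), (10, 14),
     (11, 12), (11, 13), (11, 15), (12, 15), (13, 15), (13, 17), (14, 16), (14, 17), (14, 18),
     (15, 17), (16, 18), (17, 18)]
  inverse :=
    [([], []),
     ([-286, 2028, -1814, -805, -42, 286, 0, 0, 0, 0, 0, 572, 512, -414, -2995, 2886, 0, 0, 512,
       -591, -2886, 3447, -591, 0, 0, 286, 0, -2886, 207, 2995, 858, 286, -858, -572], []),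
     ([-395, 1388, -1242, -181, 546, -42, 0, 0, 0, 0, 0, 791, 707, -572, -4139, 3988, 0, 0, 707,
       -816, -3988, 4372, -816, 0, 0, 395, 0, -3988, 602, 4139, 749, 395, -749, -791], []),
     ([101, 4295, -3842, -561, 47, -320, 68, -530, 68, 0, 0, 640, 523, -402, -1986, 1703, 0, -530,
       523, -288, -2057, 2891, -288, 0, 0, -320, 0, -2057, 220, 2558, 673, -320, -673, -993],
      [554, 3243, -2900, -423, 3, -19, 573, -228, 573, 0, 0, 952, 436, -176, -1651, 1076, 0, -228,
       436, -368, -1533, 1972, -368, 0, 0, -19, 0, -1533, 134, 1729, 476, -19, -476, -495]),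
     ([-31, 3519, -3148, -459, 27, -187, 0, 0, -198, -265, -265, 374, 478, -448, -1456, 1325, 265,
       -265, 213, -88, -1678, 2298, -88, 0, 0, -187, 0, -1678, 169, 2028, 541, -187, -541, -728],
      [497, 2909, -2601, -380, -5, 38, 0, 0, 459, -114, -114, 838, 417, -195, -1423, 913, 114, -114,
       303, -282, -1370, 1717, -282, 0, 0, 38, 0, -1370, 112, 1501, 419, 38, -419, -381]),
     ([-164, 2743, -2453, -358, 8, -55, 0, 0, 0, 0, 0, 109, -98, -493, -926, 946, 0, 0, -98, 113,
       -1300, 1705, 113, 0, 0, -55, 0, -1300, 119, 1498, 408, -55, -408, -463],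
      [440, 2575, -2303, -336, -14, 95, 0, 0, 0, 0, 0, 724, 169, -215, -1195, 751, 0, 0, 169, -195,
       -1207, 1462, -195, 0, 0, 95, 0, -1207, 90, 1273, 362, 95, -362, -267]),
     ([-307, 1906, -1705, -249, -13, 88, 0, 0, 0, 0, 0, 177, 158, -128, -926, 538, 0, 0, 158, -183,
       -892, 1065, -183, 0, 0, 88, 0, -892, 64, 926, 265, 88, -265, -177],
      [420, 2460, -2201, -321, -17, 114, 0, 0, 0, 0, 0, 228, 204, -165, -1195, 695, 0, 0, 204, -236,
       -1151, 1375, -236, 0, 0, 114, 0, -1151, 83, 1195, 342, 114, -342, -228]),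
     ([84, 4197, -3754, -548, 44, -303, 0, 0, 34, 34, -34, 606, 517, -408, -1919, 1655, 34, -497,
       484, -263, -2009, 2815, -263, 0, 0, -303, 0, -2009, 213, 2491, 656, -303, -656, -959],
      [411, 2403, -2150, -314, -18, 124, 0, 0, 287, 287, -287, 665, 387, -225, -1078, 667, 287, 58,
       101, -151, -1124, 1331, -151, 0, 0, 124, 0, -1124, 79, 1156, 333, 124, -333, -209]),
     ([-48, 3420, -3059, -446, 25, -170, 0, 0, -231, -231, 231, 341, 472, -453, -1388, 1277, 231,
       -231, 173, -62, -1630, 2222, -62, 0, 0, -170, 0, -1630, 163, 1960, 524, -170, -524, -694],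
      [353, 2069, -1851, -270, -26, 181, 0, 0, 173, 173, -173, 551, 368, -244, -850, 504, -173, 173,
       -33, -65, -961, 1076, -65, 0, 0, 181, 0, -961, 57, 928, 276, 181, -276, -95]),
     ([-219, 2423, -2167, -316, 0, 0, 0, 0, 0, 0, 0, 0, 0, 0, -707, 791, 0, 0, 0, 0, -1144, 1460, 0,
       0, 0, 0, 0, -1144, 98, 1279, 354, 0, -354, -354],
      [306, 1792, -1603, -234, -33, 228, 0, 0, 0, 0, 0, 456, 408, -330, -661, 369, 0, 0, 408, -471,
       -826, 865, -471, 0, 0, 228, 0, -826, 39, 739, 228, 228, -228, 0]),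
     ([-143, 2865, -2758, -402, -21, 143, 0, 0, 0, 0, 0, 286, 256, -207, -1498, 1443, 0, 0, 256,
       -295, -1443, 1723, -295, 0, 0, 143, 0, -1443, 103, 1498, 429, 143, -429, -286],
      [19, 114, 376, 55, 3, -19, 0, 0, 0, 0, 0, -39, -35, 28, 204, -197, 0, 0, -35, 40, 197, -235,
       40, 0, 0, -19, 0, 197, -14, -204, -58, -19, 58, 39]),
     ([-75, 3261, -2916, -425, 21, -143, 0, 0, 0, 0, 0, 286, 256, -207, -1279, 1199, 0, 0, 256,
       -228, -1266, 2100, -295, -286, -286, 143, 286, -1552, 152, 1851, 497, -143, -497, -640],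
      [287, 1678, -1501, -219, -36, 248, 0, 0, 0, 0, 0, 417, 373, -302, -583, 314, 0, 0, 373, 64,
       -809, 778, -431, 39, 39, 209, -39, -770, 32, 661, 209, 248, -209, 39]),
     ([68, 4098, -3665, -535, 42, -286, 0, 0, 0, 0, 0, 572, 512, -414, -1851, 1607, 0, 0, 512, -237,
       -1960, 2740, -237, 0, 0, -286, 0, -1960, 207, 2423, 640, -286, -640, -926],
      [267, 1564, -1399, -204, -39, 267, 0, 0, 0, 0, 0, 378, 339, -274, -505, 258, 0, 0, 339, 66,
       -714, 690, 66, 0, 0, 267, 0, -714, 24, 583, 189, 267, -189, 78]),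
     ([-164, 2743, -2453, -358, 8, -55, 0, 0, 0, 0, 0, 109, 98, -79, -926, 946, 0, 0, 98, -222,
       -837, 1705, -113, 109, -109, 55, 109, -1300, 119, 1498, 408, -55, -408, -463],
      [173, 1010, -904, -132, -53, 362, 0, 0, 0, 0, 0, 189, 169, -137, -126, -12, 0, 0, 169, 72,
       -255, 267, -195, -267, 267, 95, -267, -444, -12, 204, 95, 362, -95, 267]),
     ([-198, 2545, -2277, -332, 3, -21, 0, 0, 0, 0, 0, 395, 354, -286, -2070, 1994, 0, 0, 354, -408,
       -1994, 2698, -408, 0, 0, 198, 0, -1994, 106, 2070, 374, 198, -374, -395],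
      [153, 896, -802, -117, -56, 381, 0, 0, 0, 0, 0, -306, -274, 222, 1603, -1545, 0, 0, -274, 316,
       1545, -1297, 316, 0, 0, -153, 0, 1545, -19, -1603, 75, -153, -75, 306]),
     ([-21, 3580, -3202, -467, 29, -198, 0, 0, 0, 0, 0, 395, 354, -286, -1498, 1355, 0, 0, 354,
       -231, -1531, 2344, -408, -177, 177, 198, 177, -1708, 173, 2070, 551, -198, -551, -749],
      [153, 896, -802, -117, -56, 381, 0, 0, 0, 0, 0, 150, 134, -109, -48, -68, 0, 0, 134, 73, -161,
       180, -155, -228, 228, 75, 228, -389, -19, 126, 75, 381, -75, 306]),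
     ([-341, 1708, -1528, -223, -18, 122, 0, 0, 0, 0, 0, 681, 609, -493, -3567, 3437, 0, 0, 609,
       -704, -3437, 3909, -704, 0, 0, 341, 0, -3437, 405, 3567, 803, 341, -803, -681],
      [134, 782, -700, -102, -58, 401, 0, 0, 0, 0, 0, -267, -239, 193, 1399, -1348, 0, 0, -239, 276,
       1348, -1132, 276, 0, 0, -134, 0, 1348, -483, -1399, 134, -134, -134, 267]),
     ([-109, 3063, -2740, -400, 16, -109, 0, 0, 0, 0, 0, 219, 195, -158, -1144, 1102, 0, 0, 195,
       -226, -1102, 1949, -226, 0, 0, 109, 0, -1102, 139, 1716, 463, 109, -463, -572],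
      [39, 228, -204, -30, -72, 495, 0, 0, 0, 0, 0, -78, -70, 56, 408, -393, 0, 0, -70, 81, 393,
       -330, 81, 0, 0, -39, 0, 393, -63, -330, -39, -39, 39, 534]),
     ([-252, 2226, -1991, -290, -5, 34, 0, 0, 0, 0, 0, 505, 451, -365, -2642, 2545, 0, 0, 451, -521,
       -2545, 3161, -521, 0, 0, 252, 0, -2545, 85, 2642, 892, 252, -320, -505],
      [19, 114, -102, -15, -75, 515, 0, 0, 0, 0, 0, -39, -35, 28, 204, -197, 0, 0, -35, 40, 197,
       -165, 40, 0, 0, -19, 0, 197, -71, -204, 19, -19, 58, 39])]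
  radius := 4
  tol := 146

theorem newton_frameThirtyFive : frameThirtyFive.Newton where
  start := by decide +kernel
  contract := by decide +kernel
  error := by decide +kernel
  coord_axis := by decide +kernel
  inv_axis := by decide +kernel

theorem planar_frameThirtyFive : frameThirtyFive.Planar where
  axis_le := by decide +kernel
  source_lt := by decide +kernel
  target_lt := by decide +kernel
  simple := by decide +kernel
  inj := by decide +kernel
  sep := by decide +kernel
  deg := by decide +kernel
  two := by decide +kernel

/-- Half of a mirror-symmetric graph with 36 vertices. -/
def frameThirtySix : MirrorFrame where
  axis := 2
  half := 19
  point :=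
    [(0, 0), (3923050, 0), (333381, 942792), (666762, 1885584), (983172, 182680),
     (1316554, 1125472), (1438599, 2521405), (1603317, 1535065), (1966345, 365359),
     (2204417, 3164463), (2375154, 2170886), (2461384, 2198043), (2539873, 1184545),
     (2718352, 1231623), (2912877, 3870213), (2962545, 278263), (3169845, 2903793),
     (3426812, 1937373), (3683780, 970953)]
  edge :=
    [(0, 2), (0, 4), (1, 15), (1, 18), (2, 3), (2, 4), (2, 5), (3, 5), (3, 6), (3, 7), (4, 5),
     (4, 8), (5, 8), (6, 7), (6, 9), (6, 10), (7, 10), (7, 12), (8, 12), (8, 15), (9, 11), (9, 14),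
     (9, 16), (10, 12), (10, 13), (11, 13), (11, 16), (11, 17), (12, 15), (13, 17), (13, 18),
     (14, 16), (15, 18), (16, 17), (17, 18)]
  inverse :=
    [([], []),
     ([-105, 544, 561, -161, -105, 0, 0, 107, -62, -61, 0, 544, 107, 16, -46, -16, -16, -45, 82,
       560, 44, 0, -48, 146, -149, 92, 48, -48, 67, 48, -64, 0, 66, -48, -97], []),
     ([31, 498, 33, -133, -136, -272, -272, 188, -51, -137, 272, 226, -84, 13, -38, -13, -13, -124,
       138, 89, 36, 0, -40, 121, -123, 76, 40, -40, -41, 40, -53, 0, 55, -40, -80],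
      [519, -176, -12, 47, 48, 96, 96, -67, 18, 48, -96, -80, 30, -5, 14, 5, 5, 44, -49, -32, -13,
       0, 14, -43, 44, -27, -14, 14, 14, -14, 19, 0, -20, 14, 28]),
     ([167, 452, 66, -267, 167, 0, 0, -167, -103, -273, 0, 452, -167, 26, -77, -27, -26, -248, 275,
       178, 73, 0, -80, 242, -247, 153, 80, -80, -81, 80, -106, 0, 110, -80, -160],
      [471, -160, -23, 94, 471, 0, 0, 59, 36, 97, 0, -160, 59, -9, 27, 9, 9, 88, -97, -63, -26, 0,
       28, -86, 87, -54, -28, 28, 29, -28, 37, 0, -39, 28, 57]),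
     ([-79, 535, 6, -26, -26, 53, -53, 37, -10, -26, 53, 44, -16, 2, -7, -3, -2, -24, 27, 17, 7, 0,
       -8, 23, -24, 15, 8, -8, -8, 8, -10, 0, 11, -8, -16],
      [425, -144, -35, 139, 142, -284, 284, -196, 54, 143, -284, -236, 87, -13, 40, 14, 13, 129,
       -143, -93, -38, 0, 42, -126, 129, -80, -42, 42, 42, -42, 55, 0, -58, 42, 84]),
     ([57, 489, 40, -159, -162, -219, 219, 225, -61, -163, 219, 270, -100, 15, -46, -16, -15, -148,
       164, 106, 43, 0, -48, 144, -147, 91, 48, -48, -48, 48, -63, 0, 66, -48, -96],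
      [377, -128, -46, 186, 190, -188, 188, -263, 72, 191, 188, -315, 117, -18, 53, 19, 18, 173,
       -192, -124, -51, 0, 56, -169, 172, -107, -56, 56, 57, -56, 74, 0, -77, 56, 112]),
     ([259, 421, 89, -356, 259, 0, 0, -91, 248, -49, 0, 421, -91, -149, -102, -219, 149, -198, 204,
       238, 97, 0, -107, 140, -330, 204, 107, -107, -108, 107, -141, 0, 147, -107, -214],
      [359, -122, -51, 203, 359, 0, 0, -33, 396, -175, 0, -122, -33, 203, 58, 243, -203, 28, -11,
       -136, -55, 0, 61, 38, 188, -116, -61, 61, 62, -61, 81, 0, -84, 61, 122]),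
     ([117, 469, 54, -217, 117, 0, 0, -210, 18, 172, 0, 469, -210, -80, -62, 80, -122, -275, 314,
       145, 59, 0, -65, 298, -201, 124, 65, -65, -66, 65, -86, 0, 90, -65, -130],
      [336, -114, -56, 227, 336, 0, 0, -53, 358, -138, 0, -114, -53, -292, 65, 293, -248, 15, 8,
       -152, -62, 0, 68, 65, 210, -130, -68, 68, 69, -68, 90, 0, -94, 68, 136]),
     ([-53, 526, 13, -52, -53, 0, 0, 73, -20, -53, 0, 526, 73, 5, -15, -5, -5, -48, 53, 35, 14, 0,
       -16, 47, -48, 30, 16, -16, -16, 16, -21, 0, 21, -16, -31],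
      [283, -96, -69, 278, 283, 0, 0, -393, 107, 285, 0, -96, -393, -27, 80, 28, 27, 258, -287,
       -186, -76, 0, 84, -252, 257, -159, -84, 84, 85, -84, 110, 0, -115, 84, 167]),
     ([352, 389, 111, -447, 352, 0, 0, -37, 386, -167, 0, 389, -37, 10, 394, -6, -10, -157, 150,
       273, -223, 0, -146, 74, -74, -77, 146, -146, -116, 146, -154, 0, 162, -146, -292],
      [249, -84, -78, 312, 249, 0, 0, -98, 232, -35, 0, -84, -98, 14, 245, -11, -14, -21, 53, -178,
       325, 0, 108, 116, -117, 218, -108, 108, 70, -108, 95, 0, -101, 108, 215]),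
     ([209, 438, 76, -307, 209, 0, 0, -133, 166, 30, 0, 438, -133, -255, -88, 254, 255, -225, 243,
       205, 84, 0, -92, 196, -284, 176, 92, -92, -93, 92, -122, 0, 127, -92, -184],
      [224, -76, -84, 336, 224, 0, 0, -146, 177, 35, 0, -76, -146, -80, 97, 81, 80, -45, 95, -225,
       -91, 0, 101, 188, 311, -192, -101, 101, 102, -101, 133, 0, -139, 101, 202]),
     ([213, 436, 77, -311, 213, 0, 0, 27, 261, -158, 0, 436, 27, -6, 254, 8, 6, -164, 113, 384,
       -240, 0, 265, -63, 66, -355, -265, -293, -234, 293, -286, 0, 289, 265, -28],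
      [211, -72, -87, 348, 211, 0, 0, -81, 199, -33, 0, -72, -81, 10, 207, -7, -10, -23, 43, -148,
       -197, 0, 217, 80, -80, 144, -217, 69, 39, -69, 60, 0, -67, 217, 285]),
     ([66, 486, 42, -167, 66, 0, 0, -252, -65, 251, 0, 486, -252, 16, -48, -17, -16, 267, 354, 112,
       46, 0, -50, 152, -155, 96, 50, -50, -51, 50, -66, 0, 69, -50, -101],
      [200, -68, -89, 359, 200, 0, 0, -166, 138, 72, 0, -68, -166, -35, 103, 36, 35, 37, 113, -240,
       -98, 0, 108, -326, 332, -206, -108, 108, 109, -108, 143, 0, -149, 108, 216]),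
     ([73, 484, 43, -174, 73, 0, 0, 92, 135, -149, 0, 484, 92, -21, 113, 22, 21, -170, 75, 494,
       -107, 0, 119, -201, 205, -226, -119, 119, -353, -119, -418, 0, 417, 119, 237],
      [174, -59, -96, 384, 174, 0, 0, -64, 166, -30, 0, -59, -64, 5, 170, -4, -5, -25, 33, -119,
       -161, 0, 178, 43, -43, -339, -178, 178, 7, -178, 25, 0, -33, 178, 356]),
     ([455, 354, 136, -547, 455, 0, 0, -84, 478, -174, 0, 354, -84, 21, 496, -16, -21, -152, 177,
       193, 88, 558, -39, 175, -175, 127, 39, -39, -29, 39, -57, -407, 68, -446, -485],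
      [146, -50, -103, 412, 146, 0, 0, -51, 140, -28, 0, -50, -51, 2, 142, -1, -2, -26, 26, -97, 14,
       148, 0, 15, -15, 14, 0, 0, -17, 0, -2, 409, -7, 409, 409]),
     ([-65, 531, 10, -39, -65, 0, 0, 108, -15, -85, 0, 531, 108, 4, -11, -4, -4, -82, 77, 550, 11,
       0, -12, 36, -36, 23, 12, -12, -62, 12, -16, 0, 16, -12, -24],
      [139, -47, -104, 419, 139, 0, 0, 2, 161, -85, 0, -47, 2, -40, 120, 42, 40, -125, -16, -36,
       -114, 0, 126, -380, 388, -240, -126, 126, -448, -126, 166, 0, -173, 126, 252]),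
     ([315, 402, 102, -410, 315, 0, 0, -20, 352, -165, 0, 402, -20, 6, 356, -2, -6, -159, 140, 303,
       -337, 0, 372, 37, -36, -152, 186, -186, -148, 186, -189, 0, 196, -35, -221],
      [109, -37, -112, 448, 109, 0, 0, -34, 107, -26, 0, -37, -34, -2, 105, 3, 2, -28, 16, -68, -99,
       0, 109, -21, 22, -60, 39, -39, -48, 39, -37, 0, 27, 518, 479]),
     ([175, 449, 68, -274, 175, 0, 0, 45, 227, -156, 0, 449, 45, -10, 216, 12, 10, -165, 103, 413,
       -204, 0, 226, -101, 104, -430, -226, 226, -266, 332, -322, 0, 324, 226, 44],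
      [72, -24, -121, 484, 72, 0, 0, -17, 74, -24, 0, -24, -17, -6, 67, 7, 6, -30, 6, -38, -64, 0,
       70, -58, 59, -134, -70, 70, -80, 78, -72, 0, 61, 70, 550]),
     ([35, 497, 34, -137, 35, 0, 0, 109, 101, -147, 0, 497, 109, -25, 76, 26, 25, -172, 65, 524,
       -72, 0, 79, -239, 243, -150, -79, 79, -385, -79, 104, 0, 452, 79, 158],
      [35, -12, -130, 521, 35, 0, 0, 0, 40, -21, 0, -12, 0, -10, 30, 10, 10, -31, -4, -9, -28, 0,
       31, -95, 97, -60, -31, 31, -112, -31, 41, 0, 95, 31, 63])]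
  radius := 3
  tol := 21

theorem newton_frameThirtySix : frameThirtySix.Newton where
  start := by decide +kernel
  contract := by decide +kernel
  error := by decide +kernel
  coord_axis := by decide +kernel
  inv_axis := by decide +kernel

theorem planar_frameThirtySix : frameThirtySix.Planar where
  axis_le := by decide +kernel
  source_lt := by decide +kernel
  target_lt := by decide +kernel
  simple := by decide +kernel
  inj := by decide +kernel
  sep := by decide +kernel
  deg := by decide +kernel
  two := by decide +kernel

/-- Half of a mirror-symmetric graph with 40 vertices. -/
def frameForty : MirrorFrame where
  axis := 2
  half := 21
  point :=
    [(0, 0), (3802835, 0), (206813, 978381), (413625, 1956761), (833711, 2864246), (950709, 310085),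
     (1157521, 1288466), (1253796, 3771730), (1409573, 2046699), (1829658, 2954183),
     (1901418, 620170), (2081710, 4332586), (2153469, 3335164), (2405520, 2136636),
     (2645314, 1288466), (2852126, 310085), (2909623, 4893443), (2981382, 3896021),
     (3053141, 2898599), (3389210, 1956761), (3596022, 978381)]
  edge :=
    [(0, 2), (0, 5), (1, 15), (1, 20), (2, 3), (2, 5), (2, 6), (3, 4), (3, 6), (3, 8), (4, 7),
     (4, 8), (4, 9), (5, 6), (5, 10), (6, 10), (7, 9), (7, 11), (7, 12), (8, 9), (8, 13), (9, 13),
     (10, 14), (10, 15), (11, 12), (11, 16), (11, 17), (12, 17), (12, 18), (13, 18), (13, 19),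
     (14, 15), (14, 19), (14, 20), (15, 20), (16, 17), (17, 18), (18, 19), (19, 20)]
  inverse :=
    [([], []),
     ([-179, 565, 565, -179, -179, 0, 0, 24, 262, -243, 24, 0, 0, 0, 565, 262, -50, 0, 43, 0, -243,
       -50, 262, 565, 0, 0, 0, 0, 43, -35, -252, 0, 262, 0, 0, 0, 0, 48, -179], []),
     ([-38, 534, 31, -141, -141, -282, -282, 19, 207, -192, 19, 0, 0, 282, 252, -76, -39, 0, 34, 0,
       -192, -39, 207, 31, 0, 0, 0, 0, 34, -28, -199, 0, 207, 0, 0, 0, 0, 38, -141],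
      [519, -113, -6, 30, 30, 60, 60, -4, -44, 41, -4, 0, 0, -60, -53, 16, 8, 0, -7, 0, 41, 8, -44,
       -6, 0, 0, 0, 0, -7, 6, 42, 0, -44, 0, 0, 0, 0, -8, 30]),
     ([103, 503, 61, -282, 103, 0, 0, 38, -151, -384, 38, 0, 0, 0, 503, -151, -78, 0, 68, 0, -384,
       -78, 413, 61, 0, 0, 0, 0, 68, -55, -398, 0, 413, 0, 0, 0, 0, 76, -282],
      [489, -106, -13, 60, 489, 0, 0, -8, 32, 81, -8, 0, 0, 0, -106, 32, 17, 0, -14, 0, 81, 17, -87,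
       -13, 0, 0, 0, 0, -14, 12, 84, 0, -87, 0, 0, 0, 0, -16, 60]),
     ([234, 475, 90, -413, 234, 0, 0, 161, -115, 66, -49, -262, -262, 0, 475, -115, 100, 0, -87,
       262, -196, -162, 377, 90, 0, 0, 0, 0, -87, 70, -339, 0, 377, 0, 0, 0, 0, -97, -413],
      [429, -93, -26, 120, 429, 0, 0, 486, 15, -127, 32, 121, 121, 0, -93, 15, -66, 0, 57, -121, -6,
       55, -71, -26, 0, 0, 0, 0, 57, -46, 57, 0, -71, 0, 0, 0, 0, 64, 120]),
     ([-134, 555, 10, -45, -45, 90, -90, 6, 66, -61, 6, 0, 0, 90, 80, -24, -12, 0, 11, 0, -61, -12,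
       66, 10, 0, 0, 0, 0, 11, -9, -63, 0, 66, 0, 0, 0, 0, 12, -45],
      [412, -90, -30, 137, 137, -274, 274, -18, -201, 186, -18, 0, 0, -274, -245, 74, 38, 0, -33, 0,
       186, 38, -201, -30, 0, 0, 0, 0, -33, 27, 193, 0, -201, 0, 0, 0, 0, -37, 137]),
     ([7, 524, 40, -186, -186, -193, 193, 25, 272, -253, 25, 0, 0, 193, 331, -100, -52, 0, 45, 0,
       -253, -52, 272, 40, 0, 0, 0, 0, 45, -36, -262, 0, 272, 0, 0, 0, 0, 50, -186],
      [382, -83, -36, 167, 167, -215, 215, -22, -245, 227, -22, 0, 0, 215, -298, 90, 46, 0, -40, 0,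
       227, 46, -245, -36, 0, 0, 0, 0, -40, 33, 235, 0, -245, 0, 0, 0, 0, -45, 167]),
     ([365, 446, 118, -544, 365, 0, 0, 337, -79, -8, 337, 0, 0, 0, 446, -79, -245, 0, -242, 0, -8,
       -245, 341, 118, 0, 0, 0, 0, -242, 196, -280, 0, 341, 0, 0, 0, 0, -270, -544],
      [368, -80, -39, 181, 368, 0, 0, 405, -2, -93, 405, 0, 0, 0, -80, -2, 94, 0, 129, 0, -93, 94,
       -54, -39, 0, 0, 0, 0, 129, -104, 29, 0, -54, 0, 0, 0, 0, 144, 181]),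
     ([116, 501, 64, -295, 116, 0, 0, 3, -148, 133, 29, 26, -26, 0, 501, -148, -61, 0, 53, 26, -365,
       -87, 410, 64, 0, 0, 0, 0, 53, -43, -392, 0, 410, 0, 0, 0, 0, 59, -295],
      [345, -75, -44, 203, 345, 0, 0, 375, -8, -80, 87, -288, 288, 0, -75, -8, -180, 0, 156, -288,
       -125, 108, -47, -44, 0, 0, 0, 0, 156, -126, 19, 0, -47, 0, 0, 0, 0, 174, 203]),
     ([247, 472, 93, -426, 247, 0, 0, 179, -111, 59, -57, -236, 236, 0, 472, -111, 118, 0, -102,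
       236, -177, -170, 373, 93, 0, 0, 0, 0, -102, 83, -333, 0, 373, 0, 0, 0, 0, -114, -426],
      [285, -62, -57, 264, 285, 0, 0, 293, -25, -46, 127, -166, 166, 0, -62, -25, -262, 0, 227, 166,
       -212, 146, -31, -57, 0, 0, 0, 0, 227, -184, -8, 0, -31, 0, 0, 0, 0, 254, 264]),
     ([-90, 545, 19, -90, -90, 0, 0, 12, 131, -122, 12, 0, 0, 0, 545, 131, -25, 0, 22, 0, -122, -25,
       131, 19, 0, 0, 0, 0, 22, -17, -126, 0, 131, 0, 0, 0, 0, 24, -90],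
      [274, -60, -60, 274, 274, 0, 0, -37, -402, 373, -37, 0, 0, 0, -60, -402, 76, 0, -66, 0, 373,
       76, -402, -60, 0, 0, 0, 0, -66, 53, 387, 0, -402, 0, 0, 0, 0, -74, 274]),
     ([446, 429, 136, -625, 446, 0, 0, 445, -56, -53, 445, 0, 0, 0, 429, -56, -179, 414, -59, 0,
       -53, -179, 318, 136, -162, 0, -162, 162, -220, 128, -243, 0, 318, 0, 0, 0, -162, -377, -625],
      [248, -54, -65, 300, 248, 0, 0, 245, -35, -26, 245, 0, 0, 0, -54, -35, -4, 280, -142, 0, -26,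
       -4, -20, -65, 239, 0, 239, -239, 97, -5, -25, 0, -20, 0, 0, 0, 239, 302, 300]),
     ([302, 460, 105, -481, 302, 0, 0, 252, -96, 28, 252, 0, 0, 0, 460, -96, -296, 126, 191, 0, 28,
       -296, 358, 105, -126, 0, 126, -126, -259, 248, -308, 0, 358, 0, 0, 0, 126, -187, -481],
      [238, -52, -68, 311, 238, 0, 0, 231, -38, -20, 231, 0, 0, 0, -52, -38, -12, 260, -124, 0, -20,
       -12, -18, -68, -260, 0, 260, -260, 95, 4, -29, 0, -18, 0, 0, 0, 260, 316, 311]),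
     ([129, 498, 67, -308, 129, 0, 0, 21, -144, 126, 21, 0, 0, 0, 498, -144, -43, 0, 37, 0, 126,
       -43, 406, 67, 0, 0, 0, 0, 37, -30, -386, 0, 406, 0, 0, 0, 0, 42, -308],
      [202, -44, -76, 347, 202, 0, 0, 182, -48, 1, 182, 0, 0, 0, -44, -48, -376, 0, 326, 0, 1, -376,
       -7, -76, 0, 0, 0, 0, 326, -263, -46, 0, -7, 0, 0, 0, 0, 364, 347]),
     ([7, 524, 40, -186, 7, 0, 0, -1, -10, 9, -1, 0, 0, 0, 524, -10, 2, 0, -2, 0, 9, 2, 362, 233, 0,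
       0, 0, 0, -2, 1, 10, -193, -10, -193, 193, 0, 0, -2, 7],
      [167, -36, -83, 382, 167, 0, 0, -22, -245, 227, -22, 0, 0, 0, -36, -245, 46, 0, -40, 0, 227,
       46, 90, -298, 0, 0, 0, 0, -40, 33, 235, 215, -245, 215, -215, 0, 0, -45, 167]),
     ([-134, 555, 10, -45, -134, 0, 0, 18, 197, -182, 18, 0, 0, 0, 555, 197, -37, 0, 32, 0, -182,
       -37, 286, 485, 0, 0, 0, 0, 32, -26, -189, -90, 197, 90, -90, 0, 0, 36, -134],
      [137, -30, -90, 412, 137, 0, 0, -18, -201, 186, -18, 0, 0, 0, -30, -201, 38, 0, -33, 0, 186,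
       38, 74, -245, 0, 0, 0, 0, -33, 27, 193, -274, -201, 274, -274, 0, 0, -37, 137]),
     ([527, 411, 154, -706, 527, 0, 0, 554, -34, -99, 554, 0, 0, 0, 411, -34, -113, 576, -199, 0,
       -99, -113, 296, 154, 0, 576, 0, 0, -199, 61, -207, 0, 296, 0, 0, -324, -324, -484, -706],
      [129, -28, -91, 420, 129, 0, 0, 85, -68, 42, 85, 0, 0, 0, -28, -68, -101, 41, 66, 0, 42, -101,
       13, -91, 0, 41, 0, 0, 66, 94, -79, 0, 13, 0, 0, 478, 478, 460, 420]),
     ([383, 443, 122, -562, 383, 0, 0, 361, -74, -18, 361, 0, 0, 0, 443, -74, -230, 288, 51, 0, -18,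
       -230, 336, 122, -288, 0, 288, 288, -237, 181, -272, 0, 336, 0, 0, 0, -36, -294, -562],
      [119, -26, -94, 430, 119, 0, 0, 71, -71, 48, 71, 0, 0, 0, -26, -71, -109, 21, 84, 0, 48, -109,
       16, -94, -21, 0, 21, 21, 63, 103, -83, 0, 16, 0, 0, 0, 499, 474, 430]),
     ([239, 474, 91, -418, 239, 0, 0, 168, -114, 64, 168, 0, 0, 0, 474, -114, -347, 0, 301, 0, 64,
       -347, 376, 91, 0, 0, 0, 0, 301, 301, -337, 0, 376, 0, 0, 0, 0, -104, -418],
      [108, -24, -96, 441, 108, 0, 0, 57, -74, 54, 57, 0, 0, 0, -24, -74, -118, 0, 102, 0, 54, -118,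
       19, -96, 0, 0, 0, 0, 102, 112, -88, 0, 19, 0, 0, 0, 0, 488, 441]),
     ([103, 503, 61, -282, 103, 0, 0, -14, -151, 140, -14, 0, 0, 0, 503, -151, 29, 0, -25, 0, 140,
       29, 413, 61, 0, 0, 0, 0, -25, 20, 146, 0, 413, 0, 0, 0, 0, -28, -282],
      [60, -13, -106, 489, 60, 0, 0, -8, -87, 81, -8, 0, 0, 0, -13, -87, 17, 0, -14, 0, 81, 17, 32,
       -106, 0, 0, 0, 0, -14, 12, 84, 0, 32, 0, 0, 0, 0, -16, 489]),
     ([-38, 534, 31, -141, -38, 0, 0, 5, 55, -51, 5, 0, 0, 0, 534, 55, -11, 0, 9, 0, -51, -11, 338,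
       313, 0, 0, 0, 0, 9, -7, -53, -282, 55, 282, 282, 0, 0, 10, -38],
      [30, -6, -113, 519, 30, 0, 0, -4, -44, 41, -4, 0, 0, 0, -6, -44, 8, 0, -7, 0, 41, 8, 16, -53,
       0, 0, 0, 0, -7, 6, 42, -60, -44, 60, 60, 0, 0, -8, 30])]
  radius := 5
  tol := 44

theorem newton_frameForty : frameForty.Newton where
  start := by decide +kernel
  contract := by decide +kernel
  error := by decide +kernel
  coord_axis := by decide +kernel
  inv_axis := by decide +kernel

theorem planar_frameForty : frameForty.Planar where
  axis_le := by decide +kernel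
  source_lt := by decide +kernel
  target_lt := by decide +kernel
  simple := by decide +kernel
  inj := by decide +kernel
  sep := by decide +kernel
  deg := by decide +kernel
  two := by decide +kernel

/-- Half of a mirror-symmetric graph with 41 vertices. -/
def frameFortyOne : MirrorFrame where
  axis := 3
  half := 22
  point :=
    [(0, 0), (1944452, 0), (3906224, 0), (283426, 958994), (605354, 1905758), (927283, 2852522),
     (972226, 234043), (1249212, 3799286), (1264312, 1153578), (1586240, 2100342),
     (1908169, 3047106), (1953112, 428627), (2095935, 4331320), (2133328, 3332019),
     (2328644, 2139801), (2612069, 1180807), (2925338, 194584), (2942658, 4863354),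
     (2980051, 3864053), (3017444, 2864752), (3300870, 1905758), (3584296, 946764)]
  edge :=
    [(0, 3), (0, 6), (1, 6), (1, 16), (2, 16), (2, 21), (3, 4), (3, 6), (3, 8), (4, 5), (4, 8),
     (4, 9), (5, 7), (5, 9), (5, 10), (6, 11), (7, 10), (7, 12), (7, 13), (8, 9), (8, 11), (9, 10),
     (10, 14), (11, 15), (11, 16), (12, 13), (12, 17), (12, 18), (13, 18), (13, 19), (14, 15),
     (14, 19), (14, 20), (15, 20), (15, 21), (16, 21), (17, 18), (18, 19), (19, 20), (20, 21)]
  inverse :=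
    [([], []),
     ([-94, 542, 61, -450, -14, 41, -41, 56, -53, -42, -1, 1, -43, -1, 1, 516, 119, 0, -104, -50,
       -52, -50, 150, 276, 296, 0, 0, 0, 0, -104, 222, 86, -61, 61, 209, -212, 0, 0, -116, -176],
       []),
     ([-68, 534, -277, -275, 525, -46, -179, -112, 118, -112, 67, -67, -46, 67, -67, 726, 126, 0,
       -111, 109, 180, 42, 75, 233, 702, 0, 0, 0, 0, -111, 159, 91, -79, 79, 148, -154, 0, 0, -123,
       -202], []),
     ([226, 448, -929, -921, -28, 85, -85, -439, -108, -86, -2, 2, -88, -2, 2, 1057, 243, 0, -213,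
       -103, -107, -102, 307, 566, 607, 0, 0, 0, 0, -213, 454, 176, -124, 124, 428, -434, 0, 0,
       -237, -362],
      [454, -132, 275, 272, 8, -25, 25, 130, 32, 26, 0, 0, 26, 0, 0, -312, -72, 0, 63, 30, 32, 30,
       -91, -167, -179, 0, 0, 0, 0, 63, -134, -52, 37, -37, -126, 128, 0, 0, 70, 107]),
     ([288, 430, -621, -616, 42, -127, 14, -287, 280, -257, -384, -163, -95, 163, -163, 841, 261, 0,
       -229, 285, -101, 122, 124, 460, 465, 0, 0, 0, 0, -229, 302, 189, -168, 168, 280, -293, 0, 0,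
       -255, -423],
      [433, -126, 170, 168, -15, 47, 519, 78, -100, 84, 130, 55, 28, -55, 55, -239, -78, 0, 68,
       -102, 30, -46, -28, -131, -131, 0, 0, 0, 0, 68, -82, -57, 52, -52, -76, 80, 0, 0, 76, 128]),
     ([350, 412, -313, -310, 111, -338, 226, -135, 122, 6, -220, 220, -101, -220, -327, 624, 280, 0,
       -245, 127, -95, 346, -59, 354, 322, 0, 0, 0, 0, -245, 149, 203, -213, 213, 132, -152, 0, 0,
       -273, -485],
      [412, -120, 65, 65, -39, 119, 448, 27, -46, 522, 75, -75, 30, 75, 111, -165, -84, 0, 74, -48,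
       28, -122, 34, -95, -83, 0, 0, 0, 0, 74, -30, -61, 67, -67, -26, 32, 0, 0, 82, 149]),
     ([-47, 528, -227, -225, -7, 21, -21, 28, -26, -21, 0, 0, -21, 0, 0, 258, 59, 0, -52, -25, -26,
       -25, 75, 138, 148, 0, 0, 0, 0, -52, 111, 43, -30, 30, 104, -106, 0, 0, -58, -88],
      [195, -57, 942, 934, 28, -86, 86, -116, 110, 88, 2, -2, 89, 2, -2, -1072, -247, 0, 216, 105,
       109, 103, -311, -574, -615, 0, 0, 0, 0, 216, -461, -179, 126, -126, -434, 440, 0, 0, 240,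
       367]),
     ([412, 394, -5, -5, 180, -550, 437, 16, -36, 382, -55, 55, 327, -55, 55, 407, -249, 0, -261,
       -32, -89, 24, -243, 247, 180, 0, 0, 0, 0, -261, -4, 216, -257, 257, -15, -11, 0, 0, -290,
       -547],
      [391, -114, -40, -39, -63, 191, 376, -25, 7, 394, 19, -19, 413, 19, -19, -91, 95, 0, 79, 6,
       26, -13, 96, -59, -34, 0, 0, 0, 0, 79, 22, -66, 82, -82, 24, -16, 0, 0, 88, 170]),
     ([239, 445, -866, -858, -14, 41, -154, -408, 406, -121, 32, -32, -89, 32, -32, 1013, 247, 0,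
       -217, -23, -106, -56, 270, 544, 578, 0, 0, 0, 0, -217, 423, 179, -133, 133, 397, -405, 0, 0,
       -241, -374],
      [390, -114, -45, -44, -64, 194, 372, -28, 10, 203, -170, 170, 33, -170, 170, -88, -91, 0, 80,
       -372, 26, -202, 99, -57, -32, 0, 0, 0, 0, 80, 24, -66, 82, -82, 27, -18, 0, 0, 88, 171]),
     ([301, 427, -558, -553, 56, -170, 58, -256, 248, -292, -350, 350, -96, 196, -196, 796, 265, 0,
       -233, 252, -100, 168, 86, 438, 435, 0, 0, 0, 0, -233, 270, 192, -178, 178, 250, -264, 0, 0,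
       -259, -436],
      [369, -108, -149, -148, -87, 266, 300, -79, 64, 261, -40, 40, 35, -226, 226, -14, -97, 0, 85,
       63, 23, -278, 161, -21, 17, 0, 0, 0, 0, 85, 76, -70, 97, -97, 77, -66, 0, 0, 95, 192]),
     ([363, 409, -250, -248, 125, -382, 269, -104, 90, 83, -186, 186, -102, -186, 186, 579, 283, 0,
       -249, 94, -94, 280, -97, 332, 293, 0, 0, 0, 0, -249, 117, 205, -222, 222, 102, -123, 0, 0,
       -276, -498],
      [348, -102, -254, -252, -111, 338, 228, -131, 117, 133, -96, 96, 37, -96, 96, 59, -103, 0, 90,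
       116, 21, 212, 224, 15, 65, 0, 0, 0, 0, 90, 128, -75, 112, -112, 127, -114, 0, 0, 101, 213]),
     ([-34, 524, -163, -162, 7, -23, -90, -56, 59, -56, 33, -33, -23, 33, -33, 642, 63, 0, -55, 55,
       90, 21, 37, 116, 119, 0, 0, 0, 0, -55, 79, 46, -39, 39, 74, -77, 0, 0, -62, -101],
      [131, -38, 623, 617, -44, 133, 433, 307, -320, 265, -169, 169, 96, -169, 169, -440, -265, 0,
       233, -298, -478, -129, -122, -464, -468, 0, 0, 0, 0, 233, -302, -192, 172, -172, -281, 294,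
       0, 0, 259, 431]),
     ([502, 368, -61, -60, 201, -613, 501, -13, -11, 468, -33, 33, 435, -33, 33, 416, -175, 423,
       -117, -9, -43, 25, -178, 223, 238, -154, 0, -154, 154, -270, 19, 180, -210, 210, 8, -38, 0,
       -154, -428, -637],
      [248, -72, 49, 49, -96, 292, 274, 21, -33, 258, -17, 17, 241, -17, 17, -106, -22, 266, -150,
       -31, -48, -14, -7, -20, -127, 244, 0, 244, -244, 94, -14, -8, 7, -7, -13, 27, 0, 244, 306,
       313]),
     ([333, 417, 44, 44, 162, -494, 381, 42, -58, 307, -75, 75, 232, -75, 75, 399, -314, 135, 189,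
       -52, -130, 23, -300, 269, 128, -135, 0, 135, -135, -253, -23, 248, -298, 298, -36, 13, 0,
       135, -170, -468],
      [242, -71, 53, 53, -97, 296, 270, 23, -35, 252, -18, 18, 234, -18, 18, -107, -27, 255, -139,
       -32, -52, -14, -12, -19, -131, -255, 0, 255, -255, 95, -16, -5, 3, -3, -15, 29, 0, 255, 316,
       319]),
     ([109, 483, 264, 262, 123, -374, 261, 154, -162, 166, -96, 96, 70, -96, 96, 325, -195, 0, 171,
       -151, -252, -55, -124, 308, -60, 0, 0, 0, 0, 171, -118, -141, -434, 434, -133, 118, 0, 0,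
       190, -244],
      [231, -67, -16, -16, -112, 341, 225, -11, 1, 171, -54, 54, 117, -54, 54, -59, -325, 0, 285, 3,
       -52, 57, -340, 4, -99, 0, 0, 0, 0, 285, 18, -235, 14, -14, 18, -2, 0, 0, 317, 331]),
     ([-83, 539, 490, 485, 95, -289, 177, 268, -271, 80, -97, 97, -18, -97, 97, 237, 49, 0, -43,
       -254, -360, -157, 183, 333, -241, 0, 0, 0, 0, -43, 201, 35, -4, 4, -233, 225, 0, 0, -47,
       -52],
      [174, -51, 51, 50, -120, 366, 200, 23, -31, 146, -54, 54, 91, -54, 54, -85, -253, 0, 222, -27,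
       -84, 27, -249, 11, -152, 0, 0, 0, 0, 222, -409, -183, 141, -141, -11, 29, 0, 0, 246, 388]),
     ([-81, 538, -108, -107, 1, -2, -110, -28, 32, -77, 33, -33, -44, 33, -33, 621, 122, 0, -107,
       29, 64, -4, 112, 254, 499, 0, 0, 0, 0, -107, 190, 89, -70, 70, 178, -183, 0, 0, -119, -189],
      [-64, 19, 852, 844, -72, 219, 347, 423, -430, 177, -170, 170, 7, -170, 170, -529, -19, 0, 17,
       -402, -587, -232, 190, 110, -1024, 0, 0, 0, 0, 17, 158, -14, 46, -46, 153, -146, 0, 0, 18,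
       64]),
     ([592, 342, -117, -116, 222, -677, 565, -42, 15, 554, -11, 11, 543, -11, 11, 425, -101, 577,
       -280, 15, 4, 26, -113, 199, 297, 0, 577, 0, 0, -280, 41, 143, -162, 162, 32, -65, -307, -307,
       -565, -727],
      [105, -31, 138, 137, -129, 393, 173, 67, -73, 121, -52, 52, 69, -52, 52, -120, -140, 22, 109,
       -68, -122, -16, -110, 18, -221, 0, 22, 0, 0, 109, -50, 50, -68, 68, -51, 71, 489, 489, 525,
       456]),
     ([423, 391, -12, -12, 183, -557, 445, 13, -33, 392, -53, 53, 340, -53, 53, 408, -240, 288, 26,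
       -29, -84, 24, -235, 244, 187, -288, 0, 288, 288, -262, -1, 211, -251, 251, -12, -14, 0, -19,
       -307, -558],
      [99, -29, 142, 141, -131, 398, 168, 69, -75, 115, -53, 53, 62, -53, 53, -121, -145, 11, 120,
       -69, -126, -16, -115, 20, -225, -11, 0, 11, 11, 109, -51, 52, -72, 72, -52, 73, 0, 500, 534,
       462]),
     ([254, 440, 93, 92, 144, -438, 325, 67, -81, 231, -94, 94, 137, -94, 94, 391, -378, 0, 332,
       -73, -171, 22, -357, 290, 77, 0, 0, 0, 0, 332, -43, 279, -340, 340, -57, 37, 0, 0, -50,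
       -389],
      [93, -27, 146, 145, -132, 402, 164, 71, -77, 109, -55, 55, 54, -55, 55, -122, -150, 0, 132,
       -71, -129, -16, -119, 22, -229, 0, 0, 0, 0, 132, -53, 55, -75, 75, -54, 75, 0, 0, 544, 469]),
     ([62, 496, 319, 316, 116, -353, 241, 182, -189, 145, -96, 96, 49, -96, 96, 303, -135, 0, 119,
       -176, -278, -80, -49, 314, -104, 0, 0, 0, 0, 119, -143, -98, 90, 464, -157, 144, 0, 0, 132,
       -197],
      [36, -10, 213, 211, -140, 427, 139, 105, -109, 84, -55, 55, 28, -55, 55, -148, -78, 0, 68,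
       -102, -161, -46, -28, 29, -282, 0, 0, 0, 0, 68, -82, -57, 52, 112, -84, 106, 0, 0, 76, 526]),
     ([-130, 552, 545, 540, 88, -268, 156, 296, -297, 59, -98, 98, -39, -98, 98, 215, 108, 0, -95,
       -279, -386, -181, 258, 339, -286, 0, 0, 0, 0, -95, 312, 78, -35, 35, 296, 251, 0, 0, -105,
       -140],
      [-21, 6, 280, 277, -148, 452, 114, 139, -141, 58, -56, 56, 2, -56, 56, -174, -6, 0, 5, -132,
       -193, -76, 62, 36, -336, 0, 0, 0, 0, 5, 52, -4, 15, -15, 50, 138, 0, 0, 6, 21])]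
  radius := 4
  tol := 38

theorem newton_frameFortyOne : frameFortyOne.Newton where
  start := by decide +kernel
  contract := by decide +kernel
  error := by decide +kernel
  coord_axis := by decide +kernel
  inv_axis := by decide +kernel

theorem planar_frameFortyOne : frameFortyOne.Planar where
  axis_le := by decide +kernel
  source_lt := by decide +kernel
  target_lt := by decide +kernel
  simple := by decide +kernel
  inj := by decide +kernel
  sep := by decide +kernel
  deg := by decide +kernel
  two := by decide +kernel

/-- For each n ∈ {22, 30, 31, 34, 35, 36, 40, 41} there exists a (2,4)-regular
matchstick graph with exactly n vertices containing exactly two vertices of degree 2. -/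
theorem exists_twoFourRegular_matchstick_with_two_deg2
    (n : ℕ) (hn : n ∈ ({22, 30, 31, 34, 35, 36, 40, 41} : Finset ℕ)) :
    ∃ G : MatchstickGraph, G.IsTwoFourRegular ∧ G.V.card = n ∧
      (G.V.filter (fun v => G.degree v = 2)).card = 2 := by
  simp only [Finset.mem_insert, Finset.mem_singleton] at hn
  rcases hn with rfl | rfl | rfl | rfl | rfl | rfl | rfl | rfl
  · exact MirrorFrame.exists_matchstickGraph newton_frameTwentyTwo planar_frameTwentyTwo
  · exact MirrorFrame.exists_matchstickGraph newton_frameThirty planar_frameThirty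
  · exact MirrorFrame.exists_matchstickGraph newton_frameThirtyOne planar_frameThirtyOne
  · exact MirrorFrame.exists_matchstickGraph newton_frameThirtyFour planar_frameThirtyFour
  · exact MirrorFrame.exists_matchstickGraph newton_frameThirtyFive planar_frameThirtyFive
  · exact MirrorFrame.exists_matchstickGraph newton_frameThirtySix planar_frameThirtySix
  · exact MirrorFrame.exists_matchstickGraph newton_frameForty planar_frameForty
  · exact MirrorFrame.exists_matchstickGraph newton_frameFortyOne planar_frameFortyOne
end

section
/- For every natural number n with 62 < n < 121 and n ∉ {64, 65, 67, 69, 73, 74}, there exists a 4-regular matchstick graph with exactly n vertices. -/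
open scoped Classical

/-- A quantitative inverse function theorem for a system of unit length constraints: `(d₁ e, d₂ e)`
are approximate edge vectors and `P`, `Q` are their derivatives along approximately dual motions. -/
theorem exists_unit_length_solution {m : ℕ} (d₁ d₂ : Fin m → ℝ) (P Q : Fin m → Fin m → ℝ)
    (hdual : ∀ e, ∑ j, |(if e = j then 1 else 0) - 2 * (d₁ e * P e j + d₂ e * Q e j)| ≤ 1 / 4)
    (hP : ∀ e, ∑ j, |P e j| ≤ 70) (hQ : ∀ e, ∑ j, |Q e j| ≤ 70)
    (hd : ∀ e, |d₁ e ^ 2 + d₂ e ^ 2 - 1| ≤ 5 / 10 ^ 6) :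
    ∃ w : Fin m → ℝ, (∀ j, |w j| ≤ 1 / 10 ^ 5) ∧
      ∀ e, (d₁ e + ∑ j, w j * P e j) ^ 2 + (d₂ e + ∑ j, w j * Q e j) ^ 2 = 1 := by
  have hsum (c : Fin m → ℝ) (w : Fin m → ℝ) : |∑ j, w j * c j| ≤ ‖w‖ * ∑ j, |c j| := by
    rw [Finset.mul_sum]
    refine (Finset.abs_sum_le_sum_abs _ _).trans (Finset.sum_le_sum fun j _ => ?_)
    rw [abs_mul]
    exact mul_le_mul_of_nonneg_right (norm_le_pi_norm w j) (abs_nonneg _)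
  let T : (Fin m → ℝ) → Fin m → ℝ := fun w e =>
    w e - ((d₁ e + ∑ j, w j * P e j) ^ 2 + (d₂ e + ∑ j, w j * Q e j) ^ 2 - 1)
  let s := Metric.closedBall (0 : Fin m → ℝ) (1 / 10 ^ 5)
  have hT {v w : Fin m → ℝ} (hv : v ∈ s) (hw : w ∈ s) : dist (T v) (T w) ≤ 1 / 2 * dist v w := by
    rw [dist_pi_le_iff (by positivity)]
    intro e
    have hvn : ‖v‖ ≤ 1 / 10 ^ 5 := mem_closedBall_zero_iff.1 hv
    have hwn : ‖w‖ ≤ 1 / 10 ^ 5 := mem_closedBall_zero_iff.1 hw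
    have hvw : ‖v + w‖ ≤ 2 / 10 ^ 5 := (norm_add_le v w).trans (by linarith)
    have hquad (c : Fin m → ℝ) (hc : ∑ j, |c j| ≤ 70) :
        |(∑ j, (v - w) j * c j) * ∑ j, (v + w) j * c j| ≤ 1 / 10 * ‖v - w‖ := by
      have h0 : 0 ≤ ∑ j, |c j| := Finset.sum_nonneg fun j _ => abs_nonneg _
      rw [abs_mul]
      calc _ ≤ (‖v - w‖ * ∑ j, |c j|) * (‖v + w‖ * ∑ j, |c j|) :=
            mul_le_mul (hsum c _) (hsum c _) (abs_nonneg _) (by positivity)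
        _ ≤ (‖v - w‖ * 70) * (2 / 10 ^ 5 * 70) := by gcongr
        _ ≤ 1 / 10 * ‖v - w‖ := by nlinarith [norm_nonneg (v - w)]
    have hsplit : T v e - T w e
        = (∑ j, (v - w) j * ((if e = j then 1 else 0) - 2 * (d₁ e * P e j + d₂ e * Q e j)))
          - (∑ j, (v - w) j * P e j) * (∑ j, (v + w) j * P e j)
          - (∑ j, (v - w) j * Q e j) * ∑ j, (v + w) j * Q e j := by
      have h1 : ∑ j, (v - w) j * ((if e = j then 1 else 0) - 2 * (d₁ e * P e j + d₂ e * Q e j))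
          = v e - w e - 2 * d₁ e * (∑ j, v j * P e j - ∑ j, w j * P e j)
            - 2 * d₂ e * (∑ j, v j * Q e j - ∑ j, w j * Q e j) := by
        have : v e - w e = ∑ j, (v - w) j * (if e = j then 1 else 0) := by simp
        rw [this, ← Finset.sum_sub_distrib, ← Finset.sum_sub_distrib, Finset.mul_sum,
          Finset.mul_sum, ← Finset.sum_sub_distrib, ← Finset.sum_sub_distrib]
        refine Finset.sum_congr rfl fun j _ => ?_
        simp only [Pi.sub_apply]
        ring
      rw [h1]
      simp only [T, Pi.sub_apply, Pi.add_apply, sub_mul, add_mul, Finset.sum_sub_distrib,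
        Finset.sum_add_distrib]
      ring
    have h1 := (hsum (fun j => (if e = j then 1 else 0) - 2 * (d₁ e * P e j + d₂ e * Q e j))
      (v - w)).trans (mul_le_mul_of_nonneg_left (hdual e) (norm_nonneg _))
    have h2 := hquad _ (hP e)
    have h3 := hquad _ (hQ e)
    rw [Real.dist_eq, hsplit, dist_eq_norm]
    rw [abs_le] at h1 h2 h3 ⊢
    constructor <;> linarith [norm_nonneg (v - w)]
  have h0 : (0 : Fin m → ℝ) ∈ s := Metric.mem_closedBall_self (by positivity)
  have hmaps : Set.MapsTo T s s := by
    intro w hw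
    have hT0 : dist (T 0) 0 ≤ 5 / 10 ^ 6 := by
      rw [dist_pi_le_iff (by positivity)]
      intro e
      simpa [T, Real.dist_eq, abs_sub_comm] using hd e
    have := hT hw h0
    rw [Metric.mem_closedBall] at hw ⊢
    linarith [dist_triangle (T w) (T 0) 0]
  have hcontr : ContractingWith (1 / 2) (hmaps.restrict T s s) := by
    refine ⟨by norm_num, LipschitzWith.of_dist_le_mul fun v w => ?_⟩
    have := hT v.2 w.2
    rw [Subtype.dist_eq, Subtype.dist_eq]
    simpa using this
  obtain ⟨w, hws, hfix, -⟩ := hcontr.exists_fixedPoint' Metric.isClosed_closedBall.isComplete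
    hmaps h0 (edist_ne_top _ _)
  refine ⟨w, fun j => (norm_le_pi_norm w j).trans (mem_closedBall_zero_iff.1 hws), fun e => ?_⟩
  have := congrFun hfix e
  simp only [T] at this
  linarith

/-- A bar-and-joint framework with approximate joint positions, in units of `10⁻⁶`. The joints in
`onY` are to lie on the line `re = 0` and the joints in `onX` on the line `im = 0`. -/
structure Framework where
  pos : List (ℤ × ℤ)
  bars : List (ℕ × ℕ)
  onY : List ℕ
  onX : List ℕ

/-- A list is pairwise related by a Boolean relation. -/
def allPairs {α : Type*} (r : α → α → Bool) : List α → Bool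
  | [] => true
  | a :: l => l.all (r a) && allPairs r l

theorem pairwise_of_allPairs {α : Type*} {r : α → α → Bool} {l : List α} (h : allPairs r l = true) :
    l.Pairwise fun a b => r a b = true := by
  induction l with
  | nil => exact List.Pairwise.nil
  | cons a l ih =>
    rw [allPairs, Bool.and_eq_true, List.all_eq_true] at h
    exact List.Pairwise.cons h.1 (ih h.2)

namespace Framework

/-- The vector along the bar `b` for joints located at `l`. -/
def edgeVector (l : List (ℤ × ℤ)) (b : ℕ × ℕ) : ℤ × ℤ :=
  let p := l.getD b.1 (0, 0)
  let q := l.getD b.2 (0, 0)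
  (p.1 - q.1, p.2 - q.2)

/-- The dot product of two integer vectors. -/
def dot (p q : ℤ × ℤ) : ℤ := p.1 * q.1 + p.2 * q.2

section Inverse

/-! Motions are given in units of `10⁻⁴`. Nothing depends on the correctness of the approximate
Gauss elimination in this section, as its output is verified by `Framework.isSolvable`. -/

/-- The derivative of the squared length of the bar `b` along the motion `u`. -/
def stretch (F : Framework) (b : ℕ × ℕ) (u : List (ℤ × ℤ)) : ℤ :=
  2 * dot (edgeVector F.pos b) (edgeVector u b) / 10 ^ 6

/-- The motions of a single joint along a coordinate direction that respect the constraints. -/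
def freeMotions (F : Framework) : List (List (ℤ × ℤ)) :=
  let n := List.range F.pos.length
  (n.filter (· ∉ F.onY)).map (fun i => n.map fun j => if i = j then (10 ^ 4, 0) else (0, 0)) ++
  (n.filter (· ∉ F.onX)).map (fun i => n.map fun j => if i = j then (0, 10 ^ 4) else (0, 0))

/-- The motion `u - c • v`. -/
def reduceMotion (u v : List (ℤ × ℤ)) (c : ℤ) : List (ℤ × ℤ) :=
  if c = 0 then u
  else List.zipWith (fun x y => (x.1 - c * y.1 / 10 ^ 4, x.2 - c * y.2 / 10 ^ 4)) u v

/-- Extract an element with the largest key from the nonempty list `a :: l`. -/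
def extractMax {α : Type*} : ℤ × α → List (ℤ × α) → (ℤ × α) × List (ℤ × α)
  | a, [] => (a, [])
  | a, b :: l =>
    if b.1.natAbs ≤ a.1.natAbs then
      let r := extractMax a l
      (r.1, b :: r.2)
    else
      let r := extractMax b l
      (r.1, a :: r.2)

/-- Given motions `free` that stretch none of the bars treated so far and motions `done` dual to
these bars, treat the remaining bars one by one. -/
def eliminate (F : Framework) :
    List (ℕ × ℕ) → List (List (ℤ × ℤ)) → List (List (ℤ × ℤ)) → List (List (ℤ × ℤ))
  | b :: bs, u :: free, done =>
    let r := extractMax (F.stretch b u, u) (free.map fun u => (F.stretch b u, u))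
    let v := r.1.2.map fun x => (x.1 * 10 ^ 4 / r.1.1, x.2 * 10 ^ 4 / r.1.1)
    eliminate F bs (r.2.map fun u => reduceMotion u.2 v u.1)
      (done.map (fun u => reduceMotion u v (F.stretch b u)) ++ [v])
  | _, _, done => done

/-- Motions of the joints that are approximately dual to the bars. -/
def dualMotions (F : Framework) : List (List (ℤ × ℤ)) :=
  F.eliminate F.bars F.freeMotions []

end Inverse

/-- The `j`-th entry of the list of motions `Y` at the joint `i`. -/
def motion (Y : List (List (ℤ × ℤ))) (j i : ℕ) : ℤ × ℤ := (Y.getD j []).getD i (0, 0)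

/-- The bars have almost unit length, and the motions `Y` are almost dual to them, are bounded, and
preserve the constraints. -/
def isSolvable (F : Framework) (Y : List (List (ℤ × ℤ))) : Bool :=
  let m := List.range F.bars.length
  F.bars.all (fun b => let d := edgeVector F.pos b
    decide ((dot d d - 10 ^ 12).natAbs ≤ 5 * 10 ^ 6)) &&
  m.all (fun e => let b := F.bars.getD e (0, 0)
    let d := edgeVector F.pos b
    decide ((m.map fun j => ((if e = j then 10 ^ 10 else 0)
      - 2 * dot d (edgeVector (Y.getD j []) b)).natAbs).sum ≤ 25 * 10 ^ 8)) &&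
  (List.range F.pos.length).all (fun i =>
    decide ((m.map fun j => (motion Y j i).1.natAbs).sum ≤ 350000) &&
    decide ((m.map fun j => (motion Y j i).2.natAbs).sum ≤ 350000)) &&
  F.onY.all (fun i => decide ((F.pos.getD i (0, 0)).1 = 0) &&
    m.all fun j => decide ((motion Y j i).1 = 0)) &&
  F.onX.all (fun i => decide ((F.pos.getD i (0, 0)).2 = 0) &&
    m.all fun j => decide ((motion Y j i).2 = 0))

/-- The direction `n` separates the bars `b` and `c` even when the joints are perturbed by
`350 * 10⁻⁶` in each coordinate. -/
def isSeparated (F : Framework) (b c : ℕ × ℕ) (n : ℤ × ℤ) : Bool :=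
  let p := dot n (F.pos.getD b.1 (0, 0))
  let q := dot n (F.pos.getD b.2 (0, 0))
  let r := dot n (F.pos.getD c.1 (0, 0))
  let s := dot n (F.pos.getD c.2 (0, 0))
  let t := 700 * ((n.1.natAbs : ℤ) + n.2.natAbs)
  decide (r + t < p) && decide (s + t < p) && decide (r + t < q) && decide (s + t < q) ||
  decide (p + t < r) && decide (q + t < r) && decide (p + t < s) && decide (q + t < s)

/-- The bars `b` and `c` meet at most in one common joint. -/
def isCompatible (F : Framework) (b c : ℕ × ℕ) : Bool :=
  let d := edgeVector F.pos b
  let e := edgeVector F.pos c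
  decide (b.1 = c.1 ∧ b.2 ≠ c.2) || decide (b.2 = c.2 ∧ b.1 ≠ c.1) ||
  decide (b.1 = c.2 ∧ b.2 ≠ c.1) || decide (b.2 = c.1 ∧ b.1 ≠ c.2) ||
  F.isSeparated b c (1, 0) || F.isSeparated b c (0, 1) ||
  F.isSeparated b c (-d.2, d.1) || F.isSeparated b c (-e.2, e.1) ||
  F.isSeparated b c d || F.isSeparated b c e

/-- The joints `p` and `q` stay apart when they are perturbed. -/
def isDistinct (p q : ℤ × ℤ) : Bool :=
  decide (700 < (p.1 - q.1).natAbs) || decide (700 < (p.2 - q.2).natAbs)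

/-- The framework has a matchstick realization close to the approximate positions. -/
def isCertified (F : Framework) : Bool :=
  F.isSolvable F.dualMotions && allPairs isDistinct F.pos && allPairs F.isCompatible F.bars &&
  F.bars.all fun b => decide (b.1 < F.pos.length) && decide (b.2 < F.pos.length) &&
    decide (b.1 ≠ b.2)

/-- The number of bars at the joint `i`. -/
def degree (F : Framework) (i : ℕ) : ℕ := F.bars.countP fun b => decide (b.1 = i ∨ b.2 = i)

/-- The points `z` are close to the approximate positions of the joints. -/
def Near (F : Framework) (z : ℕ → ℂ) : Prop :=
  ∀ i < F.pos.length, |(z i).re * 10 ^ 6 - (F.pos.getD i (0, 0)).1| ≤ 350 ∧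
    |(z i).im * 10 ^ 6 - (F.pos.getD i (0, 0)).2| ≤ 350

theorem sum_map_range {M : Type*} [AddCommMonoid M] (m : ℕ) (f : ℕ → M) :
    ((List.range m).map f).sum = ∑ j : Fin m, f j :=
  Finset.sum_range f

theorem exists_realization {F : Framework} {Y : List (List (ℤ × ℤ))} (h : F.isSolvable Y = true)
    (hb : ∀ b ∈ F.bars, b.1 < F.pos.length ∧ b.2 < F.pos.length) :
    ∃ z : ℕ → ℂ, F.Near z ∧ (∀ i ∈ F.onY, (z i).re = 0) ∧ (∀ i ∈ F.onX, (z i).im = 0) ∧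
      ∀ b ∈ F.bars, dist (z b.1) (z b.2) = 1 := by
  simp only [isSolvable, Bool.and_eq_true, List.all_eq_true, decide_eq_true_eq, List.mem_range,
    sum_map_range] at h
  obtain ⟨⟨⟨⟨hunit, hdual⟩, hbound⟩, hY⟩, hX⟩ := h
  let m := F.bars.length
  let b : Fin m → ℕ × ℕ := fun e => F.bars.getD e (0, 0)
  have hbm (e : Fin m) : b e ∈ F.bars := by
    simp only [b, List.getD_eq_getElem _ _ e.2]
    exact List.getElem_mem _
  let x : ℕ → ℝ := fun i => ((F.pos.getD i (0, 0)).1 : ℝ) / 10 ^ 6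
  let y : ℕ → ℝ := fun i => ((F.pos.getD i (0, 0)).2 : ℝ) / 10 ^ 6
  let u : ℕ → Fin m → ℝ := fun i j => ((motion Y j i).1 : ℝ) / 10 ^ 4
  let v : ℕ → Fin m → ℝ := fun i j => ((motion Y j i).2 : ℝ) / 10 ^ 4
  have hu {i : ℕ} (hi : i < F.pos.length) : ∑ j, |u i j| ≤ 35 := by
    have := (Nat.cast_le (α := ℝ)).2 (hbound i hi).1
    simp only [u, abs_div, ← Finset.sum_div]
    push_cast [Nat.cast_natAbs] at this
    rw [div_le_iff₀ (by positivity), abs_of_pos (by positivity)]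
    linarith
  have hv {i : ℕ} (hi : i < F.pos.length) : ∑ j, |v i j| ≤ 35 := by
    have := (Nat.cast_le (α := ℝ)).2 (hbound i hi).2
    simp only [v, abs_div, ← Finset.sum_div]
    push_cast [Nat.cast_natAbs] at this
    rw [div_le_iff₀ (by positivity), abs_of_pos (by positivity)]
    linarith
  have hsub {f : ℕ → Fin m → ℝ} (hf : ∀ i < F.pos.length, ∑ j, |f i j| ≤ 35) (e : Fin m) :
      ∑ j, |f (b e).1 j - f (b e).2 j| ≤ 70 := by
    obtain ⟨h1, h2⟩ := hb _ (hbm e)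
    calc _ ≤ ∑ j, (|f (b e).1 j| + |f (b e).2 j|) := Finset.sum_le_sum fun j _ => abs_sub _ _
      _ ≤ 70 := by rw [Finset.sum_add_distrib]; linarith [hf _ h1, hf _ h2]
  have hdual' (e : Fin m) : ∑ j, |(if e = j then 1 else 0) - 2 * ((x (b e).1 - x (b e).2) *
      (u (b e).1 j - u (b e).2 j) + (y (b e).1 - y (b e).2) * (v (b e).1 j - v (b e).2 j))|
      ≤ 1 / 4 := by
    have := (Nat.cast_le (α := ℝ)).2 (hdual e e.2)
    push_cast [Nat.cast_natAbs, dot, edgeVector] at this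
    have hscale (j : Fin m) : (if e = j then (1 : ℝ) else 0) - 2 * ((x (b e).1 - x (b e).2) *
        (u (b e).1 j - u (b e).2 j) + (y (b e).1 - y (b e).2) * (v (b e).1 j - v (b e).2 j))
        = ((if (e : ℕ) = j then 10 ^ 10 else 0) - 2 * dot (edgeVector F.pos (b e))
          (edgeVector (Y.getD j []) (b e)) : ℤ) / 10 ^ 10 := by
      simp only [x, y, u, v, motion, dot, edgeVector, Fin.ext_iff]
      split_ifs <;> (push_cast; ring)
    simp only [hscale, abs_div, ← Finset.sum_div]
    rw [div_le_iff₀ (by positivity), abs_of_pos (by positivity)]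
    push_cast [dot, edgeVector]
    convert this using 1
    norm_num
  have hunit' (e : Fin m) : |(x (b e).1 - x (b e).2) ^ 2 + (y (b e).1 - y (b e).2) ^ 2 - 1|
      ≤ 5 / 10 ^ 6 := by
    have := (Nat.cast_le (α := ℝ)).2 (hunit _ (hbm e))
    push_cast [Nat.cast_natAbs, dot, edgeVector] at this
    simp only [x, y]
    rw [abs_le] at this ⊢
    constructor <;> nlinarith
  obtain ⟨w, hw, hsol⟩ := exists_unit_length_solution (fun e => x (b e).1 - x (b e).2)
    (fun e => y (b e).1 - y (b e).2) (fun e j => u (b e).1 j - u (b e).2 j)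
    (fun e j => v (b e).1 j - v (b e).2 j) hdual' (hsub fun i => hu) (hsub fun i => hv) hunit'
  have hdisp {c : Fin m → ℝ} (hc : ∑ j, |c j| ≤ 35) : |∑ j, w j * c j| ≤ 350 / 10 ^ 6 := by
    calc _ ≤ ∑ j, |w j * c j| := Finset.abs_sum_le_sum_abs _ _
      _ ≤ ∑ j, 1 / 10 ^ 5 * |c j| := Finset.sum_le_sum fun j _ => by
        rw [abs_mul]; exact mul_le_mul_of_nonneg_right (hw j) (abs_nonneg _)
      _ ≤ _ := by rw [← Finset.mul_sum]; linarith
  refine ⟨fun i => ⟨x i + ∑ j, w j * u i j, y i + ∑ j, w j * v i j⟩, fun i hi => ⟨?_, ?_⟩,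
    fun i hi => ?_, fun i hi => ?_, fun c hc => ?_⟩
  · have := hdisp (hu hi)
    rw [abs_le] at this ⊢
    simp only [x]
    constructor <;> linarith
  · have := hdisp (hv hi)
    rw [abs_le] at this ⊢
    simp only [y]
    constructor <;> linarith
  · have h0 (j : Fin m) : u i j = 0 := by simp [u, (hY i hi).2 j j.2]
    simp only [x, (hY i hi).1, h0]
    simp
  · have h0 (j : Fin m) : v i j = 0 := by simp [v, (hX i hi).2 j j.2]
    simp only [y, (hX i hi).1, h0]
    simp
  · obtain ⟨e, he, rfl⟩ := List.getElem_of_mem hc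
    have := hsol ⟨e, he⟩
    simp only [b, List.getD_eq_getElem _ _ he, mul_sub, Finset.sum_sub_distrib] at this
    rw [Complex.dist_eq_re_im, Real.sqrt_eq_one, ← this]
    ring

end Framework

/-- The segments from `a` to `b` and from `c` to `d` meet only in common endpoints. -/
def MeetAtEnds (a b c d : ℂ) : Prop :=
  ∀ p ∈ segment ℝ a b, p ∈ segment ℝ c d → (p = a ∨ p = b) ∧ (p = c ∨ p = d)

theorem MeetAtEnds.symm {a b c d : ℂ} (h : MeetAtEnds a b c d) : MeetAtEnds c d a b :=
  fun p hp hp' => (h p hp' hp).symm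

theorem MeetAtEnds.congr {a b c d a' b' c' d' : ℂ} (h : MeetAtEnds a b c d)
    (hab : s(a', b') = s(a, b)) (hcd : s(c', d') = s(c, d)) : MeetAtEnds a' b' c' d' := by
  intro p hp hp'
  rcases Sym2.eq_iff.1 hab with ⟨rfl, rfl⟩ | ⟨rfl, rfl⟩ <;>
  rcases Sym2.eq_iff.1 hcd with ⟨rfl, rfl⟩ | ⟨rfl, rfl⟩ <;>
  simpa only [or_comm] using h p (by first | exact hp | rwa [segment_symm])
    (by first | exact hp' | rwa [segment_symm])

theorem endpoint_of_isMax {ℓ : ℂ →ₗ[ℝ] ℝ} {a b p : ℂ} {r : ℝ} (ha : ℓ a ≤ r) (hb : ℓ b ≤ r)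
    (hab : ℓ a ≠ r ∨ ℓ b ≠ r) (hp : p ∈ segment ℝ a b) (hpr : r ≤ ℓ p) : p = a ∨ p = b := by
  obtain ⟨s, t, hs, ht, hst, rfl⟩ := hp
  simp only [map_add, map_smul, smul_eq_mul] at hpr
  obtain rfl : s = 1 - t := by linarith
  rcases hab with h | h
  · have h' := lt_of_le_of_ne ha h
    obtain h0 : 1 - t = 0 := by
      by_contra h0
      have : 0 < 1 - t := lt_of_le_of_ne hs (Ne.symm h0)
      nlinarith
    right
    simp [show t = 1 by linarith]
  · have h' := lt_of_le_of_ne hb h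
    obtain h0 : t = 0 := by
      by_contra h0
      have : 0 < t := lt_of_le_of_ne ht (Ne.symm h0)
      nlinarith
    left
    simp [h0]

theorem le_of_mem_segment {ℓ : ℂ →ₗ[ℝ] ℝ} {a b p : ℂ} {r : ℝ} (ha : ℓ a ≤ r) (hb : ℓ b ≤ r)
    (hp : p ∈ segment ℝ a b) : ℓ p ≤ r := by
  obtain ⟨s, t, hs, ht, hst, rfl⟩ := hp
  simp only [map_add, map_smul, smul_eq_mul]
  calc s * ℓ a + t * ℓ b ≤ s * r + t * r := by gcongr
    _ = r := by rw [← add_mul, hst, one_mul]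

/-- Two segments on opposite sides of a line that contains neither of them meet only in common
endpoints. -/
theorem meetAtEnds_of_separated {ℓ : ℂ →ₗ[ℝ] ℝ} {a b c d : ℂ} {r : ℝ}
    (ha : ℓ a ≤ r) (hb : ℓ b ≤ r) (hab : ℓ a ≠ r ∨ ℓ b ≠ r)
    (hc : r ≤ ℓ c) (hd : r ≤ ℓ d) (hcd : ℓ c ≠ r ∨ ℓ d ≠ r) :
    s(a, b) ≠ s(c, d) ∧ MeetAtEnds a b c d := by
  refine ⟨fun h => ?_, fun p hp hp' => ?_⟩
  · rcases Sym2.eq_iff.1 h with ⟨rfl, rfl⟩ | ⟨rfl, rfl⟩ <;>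
    rcases hab with hab | hab <;> exact hab (le_antisymm ‹_› ‹_›)
  · have h1 := le_of_mem_segment ha hb hp
    have h2 := le_of_mem_segment (ℓ := -ℓ) (r := -r) (neg_le_neg hc) (neg_le_neg hd) hp'
    simp only [LinearMap.neg_apply, neg_le_neg_iff] at h2
    exact ⟨endpoint_of_isMax ha hb hab hp h2,
      endpoint_of_isMax (ℓ := -ℓ) (r := -r) (neg_le_neg hc) (neg_le_neg hd)
        (by simpa using hcd) hp' (neg_le_neg h1)⟩

/-- Different unit segments with a common endpoint meet only there. -/
theorem meetAtEnds_of_common {a b c : ℂ} (hb : dist a b = 1) (hc : dist a c = 1) (hbc : b ≠ c) :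
    s(a, b) ≠ s(a, c) ∧ MeetAtEnds a b a c := by
  refine ⟨fun h => hbc (Sym2.congr_right.1 h), fun p hp hp' => ?_⟩
  rw [segment_eq_image'] at hp hp'
  obtain ⟨s, hs, rfl⟩ := hp
  obtain ⟨t, ht, h⟩ := hp'
  have h' : t • (c - a) = s • (b - a) := add_left_cancel h
  have hn := congrArg norm h'
  rw [norm_smul, norm_smul, ← dist_eq_norm, ← dist_eq_norm, dist_comm, hc, dist_comm b, hb,
    mul_one, mul_one, Real.norm_of_nonneg hs.1, Real.norm_of_nonneg ht.1] at hn
  subst hn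
  by_cases h0 : t = 0
  · simp [h0]
  · exact absurd (sub_left_injective (smul_right_injective ℂ h0 h')).symm hbc

/-- The edges `E` have unit length and meet only in common endpoints. -/
structure IsMatchstick (E : Finset (Sym2 ℂ)) : Prop where
  unit : ∀ {a b : ℂ}, s(a, b) ∈ E → dist a b = 1
  noncross : ∀ {a b c d : ℂ}, s(a, b) ∈ E → s(c, d) ∈ E → s(a, b) ≠ s(c, d) → MeetAtEnds a b c d

theorem IsMatchstick.ne {E : Finset (Sym2 ℂ)} (h : IsMatchstick E) {a b : ℂ} (hab : s(a, b) ∈ E) :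
    a ≠ b := by
  rintro rfl
  simpa using h.unit hab

/-- The number of edges at `v`. -/
noncomputable def edgeDegree (E : Finset (Sym2 ℂ)) (v : ℂ) : ℕ := (E.filter (v ∈ ·)).card

theorem edgeDegree_ne_zero {E : Finset (Sym2 ℂ)} {v : ℂ} :
    edgeDegree E v ≠ 0 ↔ ∃ c, s(v, c) ∈ E := by
  simp only [edgeDegree, Finset.card_ne_zero, Finset.Nonempty, Finset.mem_filter]
  constructor
  · rintro ⟨e, he, c, rfl⟩
    exact ⟨c, he⟩
  · rintro ⟨c, hc⟩
    exact ⟨_, hc, Sym2.mem_mk_left _ _⟩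

theorem edgeDegree_eq_zero {E : Finset (Sym2 ℂ)} {v : ℂ} (h : ∀ c, s(v, c) ∉ E) :
    edgeDegree E v = 0 := by
  by_contra h'
  obtain ⟨c, hc⟩ := edgeDegree_ne_zero.1 h'
  exact h c hc

/-- The edges in `E` and the edges in `F` are different and meet only in common endpoints. -/
def Compatible (E F : Finset (Sym2 ℂ)) : Prop :=
  ∀ ⦃a b c d : ℂ⦄, s(a, b) ∈ E → s(c, d) ∈ F → s(a, b) ≠ s(c, d) ∧ MeetAtEnds a b c d

namespace Compatible

variable {E F : Finset (Sym2 ℂ)}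

theorem disjoint (h : Compatible E F) : Disjoint E F := by
  rw [Finset.disjoint_left]
  intro e
  induction e with
  | _ a b => exact fun hE hF => (h hE hF).1 rfl

theorem card_union (h : Compatible E F) : (E ∪ F).card = E.card + F.card :=
  Finset.card_union_of_disjoint h.disjoint

theorem edgeDegree_union (h : Compatible E F) (v : ℂ) :
    edgeDegree (E ∪ F) v = edgeDegree E v + edgeDegree F v := by
  rw [edgeDegree, Finset.filter_union, Finset.card_union_of_disjoint]
  · rfl
  · exact Finset.disjoint_filter_filter h.disjoint

theorem isMatchstick_union (h : Compatible E F) (hE : IsMatchstick E) (hF : IsMatchstick F) :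
    IsMatchstick (E ∪ F) where
  unit hab := (Finset.mem_union.1 hab).elim hE.unit hF.unit
  noncross hab hcd hne := by
    rcases Finset.mem_union.1 hab with hab | hab <;> rcases Finset.mem_union.1 hcd with hcd | hcd
    · exact hE.noncross hab hcd hne
    · exact (h hab hcd).2
    · exact (h hcd hab).2.symm
    · exact hF.noncross hab hcd hne

theorem union_left {G : Finset (Sym2 ℂ)} (hE : Compatible E G) (hF : Compatible F G) :
    Compatible (E ∪ F) G := fun _ _ _ _ hab hcd =>
  (Finset.mem_union.1 hab).elim (fun h => hE h hcd) fun h => hF h hcd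

end Compatible

/-- The image of the edges `E` under an isometry. -/
noncomputable def moveEdges (f : ℂ ≃ᵃⁱ[ℝ] ℂ) (E : Finset (Sym2 ℂ)) : Finset (Sym2 ℂ) :=
  E.map ⟨Sym2.map f, Sym2.map.injective f.injective⟩

section Move

variable {f : ℂ ≃ᵃⁱ[ℝ] ℂ} {E : Finset (Sym2 ℂ)}

theorem mem_moveEdges {a b : ℂ} : s(f a, f b) ∈ moveEdges f E ↔ s(a, b) ∈ E :=
  Finset.mem_map' (⟨Sym2.map f, Sym2.map.injective f.injective⟩ : Sym2 ℂ ↪ Sym2 ℂ) (a := s(a, b))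

theorem card_moveEdges : (moveEdges f E).card = E.card := Finset.card_map _

theorem edgeDegree_moveEdges (v : ℂ) : edgeDegree (moveEdges f E) (f v) = edgeDegree E v := by
  rw [edgeDegree, moveEdges, Finset.filter_map, Finset.card_map, edgeDegree]
  congr 1
  refine Finset.filter_congr fun e _ => ?_
  simp [Sym2.mem_map]

theorem exists_of_mem_moveEdges {a b : ℂ} (h : s(a, b) ∈ moveEdges f E) :
    ∃ a' b', a = f a' ∧ b = f b' ∧ s(a', b') ∈ E := by
  obtain ⟨a, rfl⟩ := f.surjective a
  obtain ⟨b, rfl⟩ := f.surjective b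
  exact ⟨a, b, rfl, rfl, mem_moveEdges.1 h⟩

theorem MeetAtEnds.move {a b c d : ℂ} (h : MeetAtEnds a b c d) :
    MeetAtEnds (f a) (f b) (f c) (f d) := by
  intro p hp hp'
  obtain ⟨p, rfl⟩ := f.surjective p
  have hf (a b : ℂ) : f p ∈ segment ℝ (f a) (f b) ↔ p ∈ segment ℝ a b := by
    rw [← f.injective.mem_set_image (s := segment ℝ a b)]
    exact Iff.of_eq (congrArg (f p ∈ ·) (image_segment ℝ f.toAffineEquiv.toAffineMap a b).symm)
  simpa only [f.injective.eq_iff] using h p ((hf _ _).1 hp) ((hf _ _).1 hp')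

theorem IsMatchstick.move (h : IsMatchstick E) : IsMatchstick (moveEdges f E) where
  unit hab := by
    obtain ⟨a, b, rfl, rfl, hab'⟩ := exists_of_mem_moveEdges hab
    rw [f.dist_map, h.unit hab']
  noncross hab hcd hne := by
    obtain ⟨a, b, rfl, rfl, hab'⟩ := exists_of_mem_moveEdges hab
    obtain ⟨c, d, rfl, rfl, hcd'⟩ := exists_of_mem_moveEdges hcd
    refine (h.noncross hab' hcd' fun h => hne ?_).move
    simpa using congrArg (Sym2.map f) h

end Move

/-- Edges on one side of the line `ℓ = 0` can be united with their mirror image. -/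
theorem IsMatchstick.mirror {E : Finset (Sym2 ℂ)} (hE : IsMatchstick E) {ℓ : ℂ →ₗ[ℝ] ℝ}
    {f : ℂ ≃ᵃⁱ[ℝ] ℂ} (hf : ∀ v, f (f v) = v) (hℓ : ∀ v, ℓ (f v) = -ℓ v)
    (hfix : ∀ v, ℓ v = 0 → f v = v) (hpos : ∀ a b, s(a, b) ∈ E → 0 ≤ ℓ a ∧ (ℓ a ≠ 0 ∨ ℓ b ≠ 0)) :
    IsMatchstick (E ∪ moveEdges f E) ∧ (E ∪ moveEdges f E).card = 2 * E.card ∧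
      ∀ v c, s(v, c) ∈ E ∪ moveEdges f E → ∃ v' c', s(v', c') ∈ E ∧
        (v = v' ∧ c = c' ∨ v = f v' ∧ c = f c') ∧
        edgeDegree (E ∪ moveEdges f E) v = (if ℓ v' = 0 then 2 else 1) * edgeDegree E v' := by
  have hpos' {a b : ℂ} (h : s(a, b) ∈ E) : 0 ≤ ℓ b := (hpos b a (Sym2.eq_swap ▸ h)).1
  have hcomp : Compatible E (moveEdges f E) := by
    intro a b c d hab hcd
    obtain ⟨c, d, rfl, rfl, hcd'⟩ := exists_of_mem_moveEdges hcd
    have ha := hpos _ _ hab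
    have hc := hpos _ _ hcd'
    refine meetAtEnds_of_separated (ℓ := -ℓ) (r := 0) (neg_nonpos.2 ha.1)
      (neg_nonpos.2 (hpos' hab)) ?_ ?_ ?_ ?_
    · simpa only [LinearMap.neg_apply, neg_ne_zero] using ha.2
    · simpa [hℓ] using hc.1
    · simpa [hℓ] using hpos' hcd'
    · simpa only [LinearMap.neg_apply, hℓ, neg_neg] using hc.2
  have hdeg (v : ℂ) : edgeDegree (E ∪ moveEdges f E) v = edgeDegree E v + edgeDegree E (f v) := by
    rw [hcomp.edgeDegree_union, ← edgeDegree_moveEdges (f := f) (f v), hf]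
  have hdeg' {v c : ℂ} (h : s(v, c) ∈ E) :
      edgeDegree E v + edgeDegree E (f v) = (if ℓ v = 0 then 2 else 1) * edgeDegree E v := by
    split_ifs with h0
    · rw [hfix v h0, two_mul]
    · rw [edgeDegree_eq_zero (v := f v), add_zero, one_mul]
      intro c' hc'
      have h1 := (hpos _ _ hc').1
      rw [hℓ] at h1
      exact h0 (le_antisymm (by linarith) (hpos _ _ h).1)
  refine ⟨hcomp.isMatchstick_union hE hE.move, ?_, fun v c hvc => ?_⟩
  · rw [hcomp.card_union, card_moveEdges, two_mul]
  · rcases Finset.mem_union.1 hvc with h | h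
    · exact ⟨v, c, h, Or.inl ⟨rfl, rfl⟩, by rw [hdeg, hdeg' h]⟩
    · obtain ⟨v, c, rfl, rfl, h'⟩ := exists_of_mem_moveEdges h
      exact ⟨v, c, h', Or.inr ⟨rfl, rfl⟩, by rw [hdeg, hf, add_comm, hdeg' h']⟩

/-- There are edges that form a 4-regular matchstick graph with `n` vertices. -/
def HasFourRegular (n : ℕ) : Prop :=
  ∃ E : Finset (Sym2 ℂ), IsMatchstick E ∧ E.card = 2 * n ∧ ∀ v c, s(v, c) ∈ E → edgeDegree E v = 4

theorem HasFourRegular.exists_matchstickGraph {n : ℕ} (h : HasFourRegular n) :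
    ∃ G : MatchstickGraph, G.IsFourRegular ∧ G.V.card = n := by
  obtain ⟨E, hE, hcard, hdeg⟩ := h
  let g : ℂ ≃ₗᵢ[ℝ] EuclideanSpace ℝ (Fin 2) := Complex.orthonormalBasisOneI.repr
  let V : Finset ℂ := E.biUnion Sym2.toFinset
  have hV {v : ℂ} : v ∈ V ↔ ∃ c, s(v, c) ∈ E := by
    simp only [V, Finset.mem_biUnion, Sym2.mem_toFinset]
    constructor
    · rintro ⟨e, he, c, rfl⟩
      exact ⟨c, he⟩
    · rintro ⟨c, hc⟩
      exact ⟨_, hc, Sym2.mem_mk_left _ _⟩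
  have hVcard : V.card = n := by
    have h := Finset.sum_card_bipartiteAbove_eq_sum_card_bipartiteBelow (s := V) (t := E)
      fun (v : ℂ) (e : Sym2 ℂ) => v ∈ e
    rw [Finset.sum_const_nat (m := 4), Finset.sum_const_nat (m := 2)] at h
    · omega
    · intro e he
      rw [show V.bipartiteBelow (· ∈ ·) e = e.toFinset from ?_]
      · refine Sym2.card_toFinset_of_not_isDiag e ?_
        induction e with
        | _ a b => exact hE.ne he
      · ext v
        rw [Finset.mem_bipartiteBelow, Sym2.mem_toFinset, and_iff_right_iff_imp]
        exact fun hv => Finset.mem_biUnion.2 ⟨e, he, Sym2.mem_toFinset.2 hv⟩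
    · intro v hv
      obtain ⟨c, hc⟩ := hV.1 hv
      exact hdeg v c hc
  let φ : Sym2 ℂ ↪ Sym2 (EuclideanSpace ℝ (Fin 2)) := ⟨Sym2.map g, Sym2.map.injective g.injective⟩
  have hφ {u v : EuclideanSpace ℝ (Fin 2)} (h : s(u, v) ∈ E.map φ) :
      ∃ a b, s(a, b) ∈ E ∧ g a = u ∧ g b = v := by
    obtain ⟨a, rfl⟩ := g.surjective u
    obtain ⟨b, rfl⟩ := g.surjective v
    exact ⟨a, b, (Finset.mem_map' φ (a := s(a, b))).1 h, rfl, rfl⟩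
  refine ⟨⟨V.map ⟨g, g.injective⟩, E.map φ, ?_, ?_, ?_, ?_⟩, ?_, ?_⟩
  · rintro _ he u v rfl
    obtain ⟨a, b, hab, rfl, rfl⟩ := hφ he
    exact ⟨Finset.mem_map_of_mem _ (hV.2 ⟨b, hab⟩),
      Finset.mem_map_of_mem _ (hV.2 ⟨a, Sym2.eq_swap ▸ hab⟩)⟩
  · intro e he hdiag
    induction e with
    | _ u v =>
      obtain ⟨a, b, hab, rfl, rfl⟩ := hφ he
      exact hE.ne hab (g.injective hdiag)
  · rintro _ he u v rfl
    obtain ⟨a, b, hab, rfl, rfl⟩ := hφ he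
    rw [g.dist_map, hE.unit hab]
  · rintro _ he _ he' hne u v x y rfl rfl
    obtain ⟨a, b, hab, rfl, rfl⟩ := hφ he
    obtain ⟨c, d, hcd, rfl, rfl⟩ := hφ he'
    rintro p ⟨hp, hp'⟩
    obtain ⟨p, rfl⟩ := g.surjective p
    have hg (a b : ℂ) : g p ∈ segment ℝ (g a) (g b) ↔ p ∈ segment ℝ a b := by
      rw [← g.injective.mem_set_image (s := segment ℝ a b)]
      exact Iff.of_eq (congrArg (g p ∈ ·)
        (image_segment ℝ g.toLinearEquiv.toLinearMap.toAffineMap a b).symm)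
    have := hE.noncross hab hcd (fun h => hne (by simpa using congrArg (Sym2.map g) h)) p
      ((hg _ _).1 hp) ((hg _ _).1 hp')
    simpa [g.injective.eq_iff] using this
  · intro v hv
    obtain ⟨v, hv', rfl⟩ := Finset.mem_map.1 hv
    obtain ⟨c, hc⟩ := hV.1 hv'
    rw [MatchstickGraph.degree, Finset.filter_map, Finset.card_map, ← hdeg v c hc, edgeDegree]
    congr 1
    refine Finset.filter_congr fun e _ => ?_
    simp [φ, Sym2.mem_map]
  · rw [Finset.card_map, hVcard]

/-- The edges `E` form a matchstick graph with `2 * w` edges in which `a` and `b` have degree 2 and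
all other vertices have degree 4. -/
structure IsArc (E : Finset (Sym2 ℂ)) (a b : ℂ) (w : ℕ) : Prop where
  isMatchstick : IsMatchstick E
  card : E.card = 2 * w
  ne : a ≠ b
  left : edgeDegree E a = 2
  right : edgeDegree E b = 2
  degree : ∀ v c, s(v, c) ∈ E → v = a ∨ v = b ∨ edgeDegree E v = 4

/-- The edges `E` and `F` lie on different sides of a line through `p` that contains no other
vertex. -/
def TouchAt (p : ℂ) (E F : Finset (Sym2 ℂ)) : Prop :=
  ∃ ℓ : ℂ →ₗ[ℝ] ℝ, (∀ v c, s(v, c) ∈ E → v = p ∨ ℓ p < ℓ v) ∧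
    ∀ v c, s(v, c) ∈ F → v = p ∨ ℓ v < ℓ p

section Arcs

variable {E F G : Finset (Sym2 ℂ)} {a b c p : ℂ} {k m n : ℕ}

theorem TouchAt.symm (h : TouchAt p E F) : TouchAt p F E := by
  obtain ⟨ℓ, hE, hF⟩ := h
  exact ⟨-ℓ, by simpa using hF, by simpa using hE⟩

theorem TouchAt.eq (h : TouchAt p E F) {v : ℂ} (hE : edgeDegree E v ≠ 0)
    (hF : edgeDegree F v ≠ 0) : v = p := by
  obtain ⟨ℓ, hE', hF'⟩ := h
  obtain ⟨c, hc⟩ := edgeDegree_ne_zero.1 hE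
  obtain ⟨d, hd⟩ := edgeDegree_ne_zero.1 hF
  rcases hE' _ _ hc with h | h
  · exact h
  · exact (hF' _ _ hd).resolve_right h.not_gt

theorem TouchAt.compatible (h : TouchAt p E F) (hE : IsMatchstick E) (hF : IsMatchstick F) :
    Compatible E F := by
  obtain ⟨ℓ, hE', hF'⟩ := h
  have key {E : Finset (Sym2 ℂ)} (hE : IsMatchstick E) {ℓ : ℂ →ₗ[ℝ] ℝ}
      (h : ∀ v c, s(v, c) ∈ E → v = p ∨ ℓ v < ℓ p) {a b : ℂ} (hab : s(a, b) ∈ E) :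
      ℓ a ≤ ℓ p ∧ ℓ b ≤ ℓ p ∧ (ℓ a ≠ ℓ p ∨ ℓ b ≠ ℓ p) := by
    have ha := h _ _ hab
    have hb := h _ _ (Sym2.eq_swap ▸ hab : s(b, a) ∈ E)
    refine ⟨ha.elim (fun h => h ▸ le_rfl) le_of_lt, hb.elim (fun h => h ▸ le_rfl) le_of_lt, ?_⟩
    rcases ha with rfl | ha
    · exact Or.inr (hb.resolve_left (hE.ne hab).symm).ne
    · exact Or.inl ha.ne
  intro a b c d hab hcd
  obtain ⟨ha, hb, hab⟩ := key hE (ℓ := -ℓ) (by simpa using hE') hab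
  obtain ⟨hc, hd, hcd⟩ := key hF hF' hcd
  refine meetAtEnds_of_separated (ℓ := -ℓ) (r := -ℓ p) ha hb hab ?_ ?_ ?_ <;> simpa

/-- Arcs from `a` to `b` and from `b` to `c` can be joined. -/
theorem IsArc.append (hE : IsArc E a b m) (hF : IsArc F b c n) (h : TouchAt b E F) (hac : a ≠ c) :
    IsArc (E ∪ F) a c (m + n) := by
  have hcomp := h.compatible hE.isMatchstick hF.isMatchstick
  have hF0 {v : ℂ} (hv : v ≠ b) (hE : edgeDegree E v ≠ 0) : edgeDegree F v = 0 := by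
    by_contra h'
    exact hv (h.eq hE h')
  have hE0 {v : ℂ} (hv : v ≠ b) (hF : edgeDegree F v ≠ 0) : edgeDegree E v = 0 := by
    by_contra h'
    exact hv (h.eq h' hF)
  have hb : edgeDegree (E ∪ F) b = 4 := by rw [hcomp.edgeDegree_union, hE.right, hF.left]
  refine ⟨hcomp.isMatchstick_union hE.isMatchstick hF.isMatchstick, ?_, hac, ?_, ?_,
    fun v d hvd => ?_⟩
  · rw [hcomp.card_union, hE.card, hF.card, mul_add]
  · rw [hcomp.edgeDegree_union, hF0 hE.ne (by simp [hE.left]), hE.left]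
  · rw [hcomp.edgeDegree_union, hE0 hF.ne.symm (by simp [hF.right]), hF.right]
  · rcases eq_or_ne v b with rfl | hv
    · exact Or.inr (Or.inr hb)
    rw [hcomp.edgeDegree_union]
    rcases Finset.mem_union.1 hvd with h | h
    · rw [hF0 hv (edgeDegree_ne_zero.2 ⟨d, h⟩)]
      have := hE.degree v d h
      tauto
    · rw [hE0 hv (edgeDegree_ne_zero.2 ⟨d, h⟩), zero_add]
      have := hF.degree v d h
      tauto

/-- Arcs from `a` to `b` and from `b` to `a` can be joined. -/
theorem IsArc.hasFourRegular (hE : IsArc E a b m) (hF : IsArc F b a n) (hcomp : Compatible E F)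
    (h : ∀ v, edgeDegree E v ≠ 0 → edgeDegree F v ≠ 0 → v = a ∨ v = b) :
    HasFourRegular (m + n) := by
  refine ⟨E ∪ F, hcomp.isMatchstick_union hE.isMatchstick hF.isMatchstick, ?_, fun v d hvd => ?_⟩
  · rw [hcomp.card_union, hE.card, hF.card, mul_add]
  rw [hcomp.edgeDegree_union]
  rcases eq_or_ne v a with rfl | ha
  · rw [hE.left, hF.right]
  rcases eq_or_ne v b with rfl | hb
  · rw [hE.right, hF.left]
  have h' := h v
  rcases Finset.mem_union.1 hvd with hv | hv
  · have h1 := hE.degree v d hv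
    have h2 := edgeDegree_ne_zero.2 ⟨d, hv⟩
    grind
  · have h1 := hF.degree v d hv
    have h2 := edgeDegree_ne_zero.2 ⟨d, hv⟩
    grind

/-- Three arcs can be joined to a ring. -/
theorem IsArc.ring (hE : IsArc E a b k) (hF : IsArc F b c m) (hG : IsArc G c a n)
    (hb : TouchAt b E F) (hc : TouchAt c F G) (ha : TouchAt a G E) :
    HasFourRegular (k + m + n) := by
  have hEF := hb.compatible hE.isMatchstick hF.isMatchstick
  refine (hE.append hF hb hG.ne.symm).hasFourRegular hG ?_ fun v hv hv' => ?_
  · exact (ha.symm.compatible hE.isMatchstick hG.isMatchstick).union_left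
      (hc.compatible hF.isMatchstick hG.isMatchstick)
  · rw [hEF.edgeDegree_union] at hv
    by_cases h : edgeDegree E v = 0
    · exact Or.inr (hc.eq (by simpa [h] using hv) hv')
    · exact Or.inl (ha.eq hv' h)

theorem IsArc.move (h : IsArc E a b n) (f : ℂ ≃ᵃⁱ[ℝ] ℂ) : IsArc (moveEdges f E) (f a) (f b) n where
  isMatchstick := h.isMatchstick.move
  card := by rw [card_moveEdges, h.card]
  ne := f.injective.ne h.ne
  left := by rw [edgeDegree_moveEdges, h.left]
  right := by rw [edgeDegree_moveEdges, h.right]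
  degree v d hvd := by
    obtain ⟨v, d, rfl, rfl, h'⟩ := exists_of_mem_moveEdges hvd
    simpa only [f.injective.eq_iff, edgeDegree_moveEdges] using h.degree v d h'

end Arcs

/-- The edges `E` form an arc with base from `0` to `L` that stays above the line of slope `-σ`
through `0` and the line of slope `σ` through `L`. -/
structure IsBar (σ : ℝ) (w : ℕ) (L : ℝ) (E : Finset (Sym2 ℂ)) : Prop where
  pos : 0 < L
  isArc : IsArc E 0 L w
  bound : ∀ v c, s(v, c) ∈ E → v = 0 ∨ v = L ∨
    0 < v.re ∧ v.re < L ∧ -(σ * v.re) < v.im ∧ -(σ * (L - v.re)) < v.im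

section Bars

open Complex

variable {E F G : Finset (Sym2 ℂ)} {σ L M N : ℝ} {k m n : ℕ}

theorem IsBar.append (hE : IsBar σ m L E) (hF : IsBar σ n M F) (hσ : 0 < σ) :
    ∃ G, IsBar σ (m + n) (L + M) G := by
  let f := AffineIsometryEquiv.constVAdd ℝ ℂ (L : ℂ)
  have hf (v : ℂ) : f v = L + v := rfl
  have hL := hE.pos
  have hM := hF.pos
  have hF' := hF.isArc.move f
  rw [hf, hf, add_zero, ← ofReal_add] at hF'
  refine ⟨E ∪ moveEdges f F, add_pos hL hM, hE.isArc.append hF' ⟨-reLm, ?_, ?_⟩ ?_, ?_⟩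
  · intro v c hv
    rcases hE.bound v c hv with rfl | rfl | h
    · right; simpa using hL
    · left; rfl
    · right; simpa using h.2.1
  · intro v c hv
    obtain ⟨v, c, rfl, rfl, hv'⟩ := exists_of_mem_moveEdges hv
    rcases hF.bound v c hv' with rfl | rfl | h
    · left; simp [hf]
    · right; simpa [hf] using hM
    · right; simpa [hf] using h.1
  · rw [← ofReal_zero, Ne, ofReal_inj]
    linarith
  · intro v c hv
    rcases Finset.mem_union.1 hv with hv | hv
    · rcases hE.bound v c hv with rfl | rfl | ⟨h0, h1, h2, h3⟩
      · left; rfl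
      · right; right; simp only [ofReal_re, ofReal_im]
        refine ⟨hL, by linarith, by nlinarith, by nlinarith⟩
      · right; right
        exact ⟨h0, by linarith, h2, by nlinarith⟩
    · obtain ⟨v, c, rfl, rfl, hv'⟩ := exists_of_mem_moveEdges hv
      simp only [hf, add_re, add_im, ofReal_re, ofReal_im]
      rcases hF.bound v c hv' with rfl | rfl | ⟨h0, h1, h2, h3⟩
      · right; right; simp only [zero_re, zero_im]
        refine ⟨by linarith, by linarith, by nlinarith, by nlinarith⟩
      · right; left; simp
      · right; right
        exact ⟨by linarith, by linarith, by nlinarith, by nlinarith⟩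

/-- A bar above the real line and its mirror image form a 4-regular matchstick graph. -/
theorem IsBar.lens (h : IsBar 0 n L E) (hL : 1 < L) : HasFourRegular (2 * n) := by
  have hE := h.isArc.isMatchstick
  have him {v c : ℂ} (hv : s(v, c) ∈ E) : v = 0 ∨ v = L ∨ 0 < v.im := by
    have := h.bound v c hv
    simp only [zero_mul, neg_zero] at this
    tauto
  have hside (a b : ℂ) (hab : s(a, b) ∈ E) : 0 ≤ imLm a ∧ (imLm a ≠ 0 ∨ imLm b ≠ 0) := by
    have hu := hE.unit hab
    have ha := him hab
    have hb := him (Sym2.eq_swap ▸ hab : s(b, a) ∈ E)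
    have habs : |L| ≠ 1 := by rw [abs_of_pos h.pos]; exact hL.ne'
    refine ⟨?_, ?_⟩
    · rcases ha with rfl | rfl | h
      · simp
      · simp
      · exact h.le
    · rcases ha with rfl | rfl | h
      · rcases hb with rfl | rfl | h
        · simp at hu
        · simp [habs] at hu
        · exact Or.inr h.ne'
      · rcases hb with rfl | rfl | h
        · simp [habs] at hu
        · simp at hu
        · exact Or.inr h.ne'
      · exact Or.inl h.ne'
  obtain ⟨hm, hcard, hdeg⟩ := hE.mirror (ℓ := imLm) (f := conjLIE.toAffineIsometryEquiv)
    (fun v => by simp) (fun v => by simp) (fun v hv => by simpa using conj_eq_iff_im.2 hv) hside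
  refine ⟨_, hm, by rw [hcard, h.isArc.card], fun v c hv => ?_⟩
  obtain ⟨v', c', hv', -, h'⟩ := hdeg v c hv
  rw [h']
  rcases him hv' with rfl | rfl | h0
  · simp [h.isArc.left]
  · simp [h.isArc.right]
  · have h1 := h.isArc.degree _ _ hv'
    have h2 : v' ≠ 0 := by rintro rfl; simp at h0
    have h3 : v' ≠ L := by rintro rfl; simp at h0
    simp only [h2, h3, false_or] at h1
    simp [h1, h0.ne']

/-- The isometry `v ↦ u * (c + v)`. -/
noncomputable def place (u : Circle) (c : ℂ) : ℂ ≃ᵃⁱ[ℝ] ℂ :=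
  (AffineIsometryEquiv.constVAdd ℝ ℂ c).trans (rotation u).toAffineIsometryEquiv

theorem place_apply (u : Circle) (c v : ℂ) : place u c v = u * (c + v) := rfl

/-- Consecutive bars that are tangent to a circle of radius `r` around `0` touch at their
common end. -/
theorem IsBar.touchAt {x y z r : ℝ} (hE : IsBar σ m (x + y) E) (hF : IsBar σ n (y + z) F)
    {u v : Circle} (huv : (u * (y + r * I) : ℂ) = v * (-y + r * I)) (hy : 0 < y) (hr : 0 < r)
    (hσ : σ * y ≤ r) :
    TouchAt (u * (y + r * I)) (moveEdges (place u (-x + r * I)) E)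
      (moveEdges (place v (-y + r * I)) F) := by
  have hunit (u : Circle) (a b : ℂ) :
      (starRingEnd ℂ) (u * a) * (u * b) = (starRingEnd ℂ) a * b := by
    rw [map_mul, ← Circle.coe_inv_eq_conj, Circle.coe_inv]
    field_simp [u.coe_ne_zero]
  have hxy := hE.pos
  have hyz := hF.pos
  refine ⟨imLm ∘ₗ LinearMap.mulLeft ℝ ((starRingEnd ℂ) (u * (y + r * I))), ?_, ?_⟩
  · intro p q hp
    obtain ⟨p, q, rfl, rfl, hp'⟩ := exists_of_mem_moveEdges hp
    simp only [place_apply, LinearMap.comp_apply, LinearMap.mulLeft_apply, hunit]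
    rcases hE.bound p q hp' with rfl | rfl | ⟨h0, h1, h2, h3⟩
    · right
      simp
      nlinarith
    · left
      push_cast
      ring
    · right
      simp
      nlinarith
  · intro p q hp
    obtain ⟨p, q, rfl, rfl, hp'⟩ := exists_of_mem_moveEdges hp
    rw [huv]
    simp only [place_apply, LinearMap.comp_apply, LinearMap.mulLeft_apply, hunit]
    rcases hF.bound p q hp' with rfl | rfl | ⟨h0, h1, h2, h3⟩
    · left
      simp
    · right
      simp
      nlinarith
    · right
      simp
      nlinarith

/-- Three bars can be placed along the sides of a triangle with tangent lengths `x`, `y`, `z` whose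
angles are not too small. -/
theorem IsBar.ring {x y z : ℝ} (hx : 0 < x) (hy : 0 < y) (hz : 0 < z) (hE : IsBar σ k (x + y) E)
    (hF : IsBar σ m (y + z) F) (hG : IsBar σ n (z + x) G)
    (hσx : σ ^ 2 * x * (x + y + z) ≤ y * z) (hσy : σ ^ 2 * y * (x + y + z) ≤ z * x)
    (hσz : σ ^ 2 * z * (x + y + z) ≤ x * y) : HasFourRegular (k + m + n) := by
  have hs : 0 < x + y + z := by positivity
  let r := √(x * y * z / (x + y + z))
  have hr : 0 < r := Real.sqrt_pos.2 (by positivity)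
  have hr2 : r ^ 2 * (x + y + z) = x * y * z := by
    rw [Real.sq_sqrt (by positivity), div_mul_cancel₀ _ hs.ne']
  have hr2' : (r : ℂ) ^ 2 * (x + y + z) = x * y * z := mod_cast hr2
  have hσ {t : ℝ} (ht : (σ * t) ^ 2 * (x + y + z) ≤ x * y * z) : σ * t ≤ r :=
    Real.le_sqrt_of_sq_le ((le_div_iff₀ hs).2 ht)
  have hturn (t : ℝ) : ∃ u : Circle, (u * (-t + r * I) : ℂ) = t + r * I ∧ (-t + r * I : ℂ) ≠ 0 := by
    have h0 : (r + t * I : ℂ) ≠ 0 := fun h => hr.ne' (by simpa using congrArg re h)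
    refine ⟨Circle.ofConjDivSelf _ h0, ?_, fun h => hr.ne' (by simpa using congrArg im h)⟩
    change (starRingEnd ℂ) _ / _ * _ = _
    rw [div_mul_eq_mul_div, div_eq_iff h0]
    simp only [map_add, map_mul, conj_I, conj_ofReal]
    linear_combination -(2 * r * t) * I_sq
  obtain ⟨v, hv, hv0⟩ := hturn y
  obtain ⟨w, hw, hw0⟩ := hturn z
  have hone : ((1 : Circle) * (y + r * I) : ℂ) = v * (-y + r * I) := by rw [hv]; simp
  have hvw : (v * (z + r * I) : ℂ) = (v * w : Circle) * (-z + r * I) := by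
    rw [Circle.coe_mul, mul_assoc, hw]
  have hclose : ((v * w : Circle) * (x + r * I) : ℂ) = (1 : Circle) * (-x + r * I) := by
    refine mul_right_cancel₀ (mul_ne_zero hv0 hw0) ?_
    rw [Circle.coe_mul, Circle.coe_one]
    linear_combination (w * (-z + r * I) * (x + r * I)) * hv + (y + r * I) * (x + r * I) * hw
      - 2 * hr2' + 2 * (x + y + z) * r ^ 2 * I_sq
  have h1 := hE.isArc.move (place 1 (-x + r * I))
  have h2 := hF.isArc.move (place v (-y + r * I))
  have h3 := hG.isArc.move (place (v * w) (-z + r * I))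
  have hend (u : Circle) (s t : ℝ) : place u (-s + r * I) ((s + t : ℝ) : ℂ) = u * (t + r * I) := by
    rw [place_apply]; push_cast; ring
  rw [hend, place_apply, add_zero] at h1 h2 h3
  rw [← hone] at h2
  rw [← hvw, hclose] at h3
  refine h1.ring h2 h3 (hE.touchAt hF hone hy hr (hσ ?_)) (hF.touchAt hG hvw hz hr (hσ ?_)) ?_
  · nlinarith
  · nlinarith
  · rw [← hclose]
    exact hG.touchAt hE hclose hx hr (hσ (by nlinarith))

end Bars

namespace Framework

variable {F : Framework} {z : ℕ → ℂ}

theorem Near.isDistinct_ne (h : F.Near z) {i j : ℕ} (hi : i < F.pos.length) (hj : j < F.pos.length)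
    (hij : isDistinct (F.pos.getD i (0, 0)) (F.pos.getD j (0, 0)) = true) : z i ≠ z j := by
  intro hz
  obtain ⟨h1, h2⟩ := h i hi
  obtain ⟨h3, h4⟩ := h j hj
  rw [hz] at h1 h2
  have key {a b : ℤ} {x : ℝ} (ha : |x - a| ≤ 350) (hb : |x - b| ≤ 350) :
      ¬ 700 < (a - b).natAbs := by
    rw [abs_le] at ha hb
    have h1 : a - b ≤ 700 := by exact_mod_cast (by linarith : (a : ℝ) - b ≤ 700)
    have h2 : -700 ≤ a - b := by exact_mod_cast (by linarith : (-700 : ℝ) ≤ a - b)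
    omega
  rw [isDistinct, Bool.or_eq_true, decide_eq_true_eq, decide_eq_true_eq] at hij
  exact hij.elim (key h1 h3) (key h2 h4)

theorem Near.injOn (h : F.Near z) (hd : allPairs isDistinct F.pos = true) {i j : ℕ}
    (hi : i < F.pos.length) (hj : j < F.pos.length) (hij : z i = z j) : i = j := by
  have hp := List.pairwise_iff_getElem.1 (pairwise_of_allPairs hd)
  have key {i j : ℕ} (hi : i < F.pos.length) (hj : j < F.pos.length) (hlt : i < j) : z i ≠ z j :=
    h.isDistinct_ne hi hj (by
      rw [List.getD_eq_getElem _ _ hi, List.getD_eq_getElem _ _ hj]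
      exact hp i j hi hj hlt)
  rcases lt_trichotomy i j with hlt | rfl | hlt
  · exact absurd hij (key hi hj hlt)
  · rfl
  · exact absurd hij.symm (key hj hi hlt)

/-- The linear functional `p ↦ n.1 * re p + n.2 * im p`. -/
noncomputable def normalMap (n : ℤ × ℤ) : ℂ →ₗ[ℝ] ℝ :=
  (n.1 : ℝ) • Complex.reLm + (n.2 : ℝ) • Complex.imLm

theorem Near.normalMap_sub_le (h : F.Near z) (n : ℤ × ℤ) {i : ℕ} (hi : i < F.pos.length) :
    |normalMap n (z i) * 10 ^ 6 - dot n (F.pos.getD i (0, 0))| ≤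
      350 * (|(n.1 : ℝ)| + |(n.2 : ℝ)|) := by
  obtain ⟨h1, h2⟩ := h i hi
  calc _ = |n.1 * ((z i).re * 10 ^ 6 - (F.pos.getD i (0, 0)).1) +
        n.2 * ((z i).im * 10 ^ 6 - (F.pos.getD i (0, 0)).2)| := by
        simp only [normalMap, dot, LinearMap.add_apply, LinearMap.smul_apply, Complex.reLm_coe,
          Complex.imLm_coe, smul_eq_mul]
        push_cast
        congr 1
        ring
    _ ≤ |(n.1 : ℝ)| * 350 + |(n.2 : ℝ)| * 350 := by
      refine (abs_add_le _ _).trans ?_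
      rw [abs_mul, abs_mul]
      gcongr
    _ = _ := by ring

theorem Near.meetAtEnds_of_isSeparated (h : F.Near z) {b c : ℕ × ℕ} {n : ℤ × ℤ}
    (hb : b.1 < F.pos.length ∧ b.2 < F.pos.length) (hc : c.1 < F.pos.length ∧ c.2 < F.pos.length)
    (hs : F.isSeparated b c n = true) :
    s(z b.1, z b.2) ≠ s(z c.1, z c.2) ∧ MeetAtEnds (z b.1) (z b.2) (z c.1) (z c.2) := by
  have key {i j : ℕ} (hi : i < F.pos.length) (hj : j < F.pos.length)
      (hij : dot n (F.pos.getD i (0, 0)) + 700 * ((n.1.natAbs : ℤ) + n.2.natAbs) <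
        dot n (F.pos.getD j (0, 0))) : normalMap n (z i) < normalMap n (z j) := by
    have h1 := abs_le.1 (h.normalMap_sub_le n hi)
    have h2 := abs_le.1 (h.normalMap_sub_le n hj)
    have h3 : (dot n (F.pos.getD i (0, 0)) : ℝ) + 700 * (|(n.1 : ℝ)| + |(n.2 : ℝ)|) <
        dot n (F.pos.getD j (0, 0)) := by
      have := (Int.cast_lt (R := ℝ)).2 hij
      push_cast [Nat.cast_natAbs] at this
      exact this
    linarith
  have sep {a b c d : ℂ} {ℓ : ℂ →ₗ[ℝ] ℝ} (h1 : ℓ a < ℓ c) (h2 : ℓ b < ℓ c) (h3 : ℓ a < ℓ d)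
      (h4 : ℓ b < ℓ d) : s(a, b) ≠ s(c, d) ∧ MeetAtEnds a b c d := by
    obtain ⟨r, hr1, hr2⟩ := exists_between
      (max_lt (lt_min h1 h3) (lt_min h2 h4) : max (ℓ a) (ℓ b) < min (ℓ c) (ℓ d))
    rw [max_lt_iff] at hr1
    rw [lt_min_iff] at hr2
    exact meetAtEnds_of_separated hr1.1.le hr1.2.le (Or.inl hr1.1.ne) hr2.1.le hr2.2.le
      (Or.inl hr2.1.ne')
  simp only [isSeparated, Bool.or_eq_true, Bool.and_eq_true, decide_eq_true_eq] at hs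
  rcases hs with ⟨⟨⟨h1, h2⟩, h3⟩, h4⟩ | ⟨⟨⟨h1, h2⟩, h3⟩, h4⟩
  · have := sep (key hc.1 hb.1 h1) (key hc.2 hb.1 h2) (key hc.1 hb.2 h3) (key hc.2 hb.2 h4)
    exact ⟨this.1.symm, this.2.symm⟩
  · exact sep (key hb.1 hc.1 h1) (key hb.2 hc.1 h2) (key hb.1 hc.2 h3) (key hb.2 hc.2 h4)

theorem Near.meetAtEnds_of_isCompatible (h : F.Near z) (hd : allPairs isDistinct F.pos = true)
    {b c : ℕ × ℕ} (hb : b.1 < F.pos.length ∧ b.2 < F.pos.length)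
    (hc : c.1 < F.pos.length ∧ c.2 < F.pos.length) (hb1 : dist (z b.1) (z b.2) = 1)
    (hc1 : dist (z c.1) (z c.2) = 1) (hs : F.isCompatible b c = true) :
    s(z b.1, z b.2) ≠ s(z c.1, z c.2) ∧ MeetAtEnds (z b.1) (z b.2) (z c.1) (z c.2) := by
  have common {i j k : ℕ} (hj : j < F.pos.length) (hk : k < F.pos.length) (hjk : j ≠ k)
      (h1 : dist (z i) (z j) = 1) (h2 : dist (z i) (z k) = 1) {a b c d : ℂ}
      (hab : s(a, b) = s(z i, z j)) (hcd : s(c, d) = s(z i, z k)) :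
      s(a, b) ≠ s(c, d) ∧ MeetAtEnds a b c d := by
    have := meetAtEnds_of_common h1 h2 fun h' => hjk (h.injOn hd hj hk h')
    exact ⟨by rw [hab, hcd]; exact this.1, this.2.congr hab hcd⟩
  have hb1' := dist_comm (z b.1) (z b.2) ▸ hb1
  have hc1' := dist_comm (z c.1) (z c.2) ▸ hc1
  simp only [isCompatible, Bool.or_eq_true, decide_eq_true_eq] at hs
  rcases hs with
    ((((((((⟨h1, h2⟩ | ⟨h1, h2⟩) | ⟨h1, h2⟩) | ⟨h1, h2⟩) | hs) | hs) | hs) | hs) | hs) | hs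
  · exact common hb.2 hc.2 h2 hb1 (h1 ▸ hc1) rfl (by rw [h1])
  · exact common hb.1 hc.1 h2 hb1' (h1 ▸ hc1') Sym2.eq_swap (by rw [h1, Sym2.eq_swap])
  · exact common hb.2 hc.1 h2 hb1 (h1 ▸ hc1') rfl (by rw [h1, Sym2.eq_swap])
  · exact common hb.1 hc.2 h2 hb1' (h1 ▸ hc1) Sym2.eq_swap (by rw [h1])
  all_goals exact h.meetAtEnds_of_isSeparated hb hc hs

/-- The edges of the framework `F` with its joints at `z`. -/
noncomputable def edges (F : Framework) (z : ℕ → ℂ) : Finset (Sym2 ℂ) :=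
  (F.bars.map fun b => s(z b.1, z b.2)).toFinset

theorem exists_of_mem_edges {v c : ℂ} (h : s(v, c) ∈ F.edges z) :
    ∃ i j, ((i, j) ∈ F.bars ∨ (j, i) ∈ F.bars) ∧ v = z i ∧ c = z j := by
  simp only [edges, List.mem_toFinset, List.mem_map, Sym2.eq_iff, Prod.exists] at h
  obtain ⟨i, j, hij, ⟨rfl, rfl⟩ | ⟨rfl, rfl⟩⟩ := h
  · exact ⟨i, j, Or.inl hij, rfl, rfl⟩
  · exact ⟨j, i, Or.inr hij, rfl, rfl⟩

/-- A certified framework has a nearby realization that is a matchstick graph. -/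
theorem exists_isMatchstick (h : F.isCertified = true) :
    ∃ z : ℕ → ℂ, F.Near z ∧ (∀ i ∈ F.onY, (z i).re = 0) ∧ (∀ i ∈ F.onX, (z i).im = 0) ∧
      IsMatchstick (F.edges z) ∧ (F.edges z).card = F.bars.length ∧
      (∀ i < F.pos.length, edgeDegree (F.edges z) (z i) = F.degree i) ∧
      ∀ b ∈ F.bars, b.1 < F.pos.length ∧ b.2 < F.pos.length := by
  simp only [isCertified, Bool.and_eq_true, List.all_eq_true, decide_eq_true_eq] at h
  obtain ⟨⟨⟨hsolv, hdist⟩, hcomp⟩, hbars⟩ := h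
  have hb : ∀ b ∈ F.bars, b.1 < F.pos.length ∧ b.2 < F.pos.length := fun b hb => (hbars b hb).1
  obtain ⟨z, hz, hY, hX, hunit⟩ := exists_realization hsolv hb
  have hpair : F.bars.Pairwise fun b c => s(z b.1, z b.2) ≠ s(z c.1, z c.2) ∧
      MeetAtEnds (z b.1) (z b.2) (z c.1) (z c.2) :=
    (pairwise_of_allPairs hcomp).imp_of_mem fun {b c} hbm hcm h =>
      hz.meetAtEnds_of_isCompatible hdist (hb b hbm) (hb c hcm) (hunit b hbm) (hunit c hcm) h
  have hnodup : (F.bars.map fun b => s(z b.1, z b.2)).Nodup := by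
    rw [List.Nodup, List.pairwise_map]
    exact hpair.imp fun h => h.1
  refine ⟨z, hz, hY, hX, ⟨fun {a b} hab => ?_, fun {a b c d} hab hcd hne => ?_⟩, ?_,
    fun i hi => ?_, hb⟩
  · obtain ⟨i, j, hij | hij, rfl, rfl⟩ := exists_of_mem_edges hab
    · exact hunit _ hij
    · rw [dist_comm]; exact hunit _ hij
  · simp only [edges, List.mem_toFinset, List.mem_map] at hab hcd
    obtain ⟨b, hbm, hab⟩ := hab
    obtain ⟨c, hcm, hcd⟩ := hcd
    have hbc : b ≠ c := by
      rintro rfl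
      exact hne (hab.symm.trans hcd)
    have : Std.Symm fun b c : ℕ × ℕ => s(z b.1, z b.2) ≠ s(z c.1, z c.2) ∧
        MeetAtEnds (z b.1) (z b.2) (z c.1) (z c.2) := ⟨fun _ _ h => ⟨h.1.symm, h.2.symm⟩⟩
    exact (hpair.forall hbm hcm hbc).2.congr hab.symm hcd.symm
  · rw [edges, List.toFinset_card_of_nodup hnodup, List.length_map]
  · have hfilter : (F.edges z).filter (z i ∈ ·) =
        ((F.bars.map fun b => s(z b.1, z b.2)).filter fun e => decide (z i ∈ e)).toFinset := by
      ext
      simp [edges]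
    rw [edgeDegree, hfilter, List.toFinset_card_of_nodup (hnodup.filter _),
      ← List.countP_eq_length_filter, List.countP_map, degree]
    refine List.countP_congr fun b hbm => ?_
    have h1 := hb b hbm
    have hinj {j : ℕ} (hj : j < F.pos.length) : z i = z j ↔ j = i :=
      ⟨fun h => (hz.injOn hdist hi hj h).symm, fun h => h ▸ rfl⟩
    simp [hinj h1.1, hinj h1.2]

/-- The framework is the right half of a bar that is symmetric about the line `re = 0`, has its
right end at the joint `0`, and stays above lines of slopes `-s / 100` and `s / 100` through its
ends. -/
def isHalfBar (F : Framework) (s : ℕ) : Bool :=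
  let t := F.pos.getD 0 (0, 0)
  F.isCertified && decide (0 < F.pos.length) && decide (0 ∈ F.onX) && decide (0 ∉ F.onY) &&
  decide (350 < t.1) && decide (F.degree 0 = 2) &&
  F.bars.all (fun b => decide (b.1 ∉ F.onY ∨ b.2 ∉ F.onY)) &&
  (List.range F.pos.length).all fun i => let p := F.pos.getD i (0, 0)
    decide (i = 0) || decide (p.1 + 700 < t.1) &&
      decide (35000 + 700 * s < 100 * p.2 + s * (t.1 - p.1)) &&
      if i ∈ F.onY then decide (F.degree i = 2)
      else decide (F.degree i = 4) && decide (350 < p.1)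

/-- The reflection in the line `re = 0`. -/
noncomputable def reflectRe : ℂ ≃ᵃⁱ[ℝ] ℂ :=
  (Complex.conjLIE.trans (LinearIsometryEquiv.neg ℝ)).toAffineIsometryEquiv

theorem reflectRe_apply (v : ℂ) : reflectRe v = -starRingEnd ℂ v := rfl

theorem Near.re_pos (h : F.Near z) {i : ℕ} (hi : i < F.pos.length)
    (hp : 350 < (F.pos.getD i (0, 0)).1) : 0 < (z i).re := by
  have h1 := abs_le.1 (h i hi).1
  have h2 : (350 : ℝ) < (F.pos.getD i (0, 0)).1 := by exact_mod_cast hp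
  linarith

theorem Near.im_pos (h : F.Near z) {i : ℕ} (hi : i < F.pos.length)
    (hp : 350 < (F.pos.getD i (0, 0)).2) : 0 < (z i).im := by
  have h1 := abs_le.1 (h i hi).2
  have h2 : (350 : ℝ) < (F.pos.getD i (0, 0)).2 := by exact_mod_cast hp
  linarith

theorem exists_isBar {s : ℕ} (h : F.isHalfBar s = true) :
    ∃ (L : ℝ) (E : Finset (Sym2 ℂ)), |L * 10 ^ 6 - 2 * (F.pos.getD 0 (0, 0)).1| ≤ 700 ∧
      IsBar (s / 100 : ℝ) F.bars.length L E := by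
  simp only [isHalfBar, Bool.and_eq_true, Bool.or_eq_true, List.all_eq_true, decide_eq_true_eq,
    List.mem_range] at h
  obtain ⟨⟨⟨⟨⟨⟨⟨hcert, h0⟩, h0X⟩, h0Y⟩, htip⟩, hdeg0⟩, hbars⟩, hjoint⟩ := h
  obtain ⟨z, hz, hY, hX, hE, hcard, hdeg, hlt⟩ := exists_isMatchstick hcert
  have hre {i : ℕ} (hi : i < F.pos.length) (hiY : i ∉ F.onY) : 0 < (z i).re := by
    refine hz.re_pos hi ?_
    rcases eq_or_ne i 0 with rfl | hi0
    · exact htip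
    · have := ((hjoint i hi).resolve_left hi0).2
      rw [if_neg hiY, Bool.and_eq_true, decide_eq_true_eq, decide_eq_true_eq] at this
      exact this.2
  have hre' {i : ℕ} (hi : i < F.pos.length) : 0 ≤ (z i).re := by
    by_cases hiY : i ∈ F.onY
    · exact (hY i hiY).ge
    · exact (hre hi hiY).le
  have hmirror := hE.mirror (ℓ := Complex.reLm) (f := reflectRe)
    (fun v => by simp [reflectRe_apply]) (fun v => by simp [reflectRe_apply])
    (fun v hv => by
      apply Complex.ext <;> simp_all [reflectRe_apply])
    (fun a b hab => by
      obtain ⟨i, j, hij, rfl, rfl⟩ := exists_of_mem_edges hab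
      have hlt' : i < F.pos.length ∧ j < F.pos.length := by
        rcases hij with hij | hij
        · exact hlt _ hij
        · exact (hlt _ hij).symm
      refine ⟨hre' hlt'.1, ?_⟩
      have hY' : i ∉ F.onY ∨ j ∉ F.onY := by
        rcases hij with hij | hij
        · exact hbars _ hij
        · exact (hbars _ hij).symm
      exact hY'.imp (fun h => (hre hlt'.1 h).ne') fun h => (hre hlt'.2 h).ne')
  obtain ⟨hE', hcard', hvert⟩ := hmirror
  set E' := F.edges z ∪ moveEdges reflectRe (F.edges z)
  set r := (z 0).re
  have hz0 : z 0 = r := Complex.ext rfl (hX 0 h0X)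
  have hr0 : 0 < r := hre h0 h0Y
  have htip' := abs_le.1 (hz 0 h0).1
  have hvert' : ∀ v c, s(v, c) ∈ E' → (v = r ∨ v = -r) ∧ edgeDegree E' v = 2 ∨
      |v.re| < r ∧ -(s / 100 * (r - |v.re|)) < v.im ∧ edgeDegree E' v = 4 := by
    intro v c hv
    obtain ⟨v', c', hv', hvv, hd⟩ := hvert v c hv
    obtain ⟨i, j, hij, rfl, -⟩ := exists_of_mem_edges hv'
    have hi : i < F.pos.length := by
      rcases hij with hij | hij
      · exact (hlt _ hij).1
      · exact (hlt _ hij).2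
    rw [hdeg i hi, Complex.reLm_coe] at hd
    rcases eq_or_ne i 0 with rfl | hi0
    · left
      refine ⟨hvv.imp (fun h => h.1.trans hz0) fun h => ?_, ?_⟩
      · rw [h.1, reflectRe_apply, hz0, Complex.conj_ofReal]
      · rw [hd, if_neg (hre h0 h0Y).ne', hdeg0]
    · right
      obtain ⟨⟨hXi, hYi⟩, hdi⟩ := (hjoint i hi).resolve_left hi0
      have hvre : |v.re| = (z i).re ∧ v.im = (z i).im := by
        rcases hvv with ⟨rfl, -⟩ | ⟨rfl, -⟩
        · exact ⟨abs_of_nonneg (hre' hi), rfl⟩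
        · simp [reflectRe_apply, abs_of_nonneg (hre' hi)]
      rw [hvre.1, hvre.2]
      obtain ⟨h1, h2⟩ := hz i hi
      rw [abs_le] at h1 h2
      have hXi' : ((F.pos.getD i (0, 0)).1 : ℝ) + 700 < (F.pos.getD 0 (0, 0)).1 := by
        exact_mod_cast hXi
      have hYi' : (35000 : ℝ) + 700 * s < 100 * (F.pos.getD i (0, 0)).2 +
          s * ((F.pos.getD 0 (0, 0)).1 - (F.pos.getD i (0, 0)).1) := by exact_mod_cast hYi
      refine ⟨by linarith, ?_, ?_⟩
      · have := mul_le_mul_of_nonneg_left (by linarith : ((F.pos.getD 0 (0, 0)).1 : ℝ) -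
          (F.pos.getD i (0, 0)).1 - 700 ≤ (r - (z i).re) * 10 ^ 6) (Nat.cast_nonneg (α := ℝ) s)
        linarith
      · rw [hd]
        by_cases hiY : i ∈ F.onY
        · rw [if_pos hiY, decide_eq_true_eq] at hdi
          rw [if_pos (hY i hiY), hdi]
        · rw [if_neg hiY, Bool.and_eq_true, decide_eq_true_eq] at hdi
          rw [if_neg (hre hi hiY).ne', hdi.1]
  have hend : edgeDegree E' r = 2 ∧ edgeDegree E' (-r : ℂ) = 2 := by
    obtain ⟨c, hc⟩ := edgeDegree_ne_zero.1 (by rw [hdeg 0 h0, hdeg0]; norm_num :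
      edgeDegree (F.edges z) (z 0) ≠ 0)
    have hr' : reflectRe (z 0) = -r := by rw [reflectRe_apply, hz0, Complex.conj_ofReal]
    have h1 := hvert' _ _ (Finset.mem_union_left _ hc)
    have h2 := hvert' _ _ (Finset.mem_union_right _ (mem_moveEdges.2 hc))
    rw [hz0] at h1
    rw [hr'] at h2
    simp only [Complex.neg_re, abs_neg, Complex.ofReal_re, abs_of_pos hr0, lt_irrefl, false_and,
      or_false] at h1 h2
    exact ⟨h1.2, h2.2⟩
  let f := AffineIsometryEquiv.constVAdd ℝ ℂ (r : ℂ)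
  have hf (v : ℂ) : f v = r + v := rfl
  have hfl : f (-r) = 0 := by rw [hf, add_neg_cancel]
  have hfr : f r = (2 * r : ℝ) := by rw [hf, ← two_mul]; push_cast; rfl
  refine ⟨2 * r, moveEdges f E', by rw [abs_le]; constructor <;> linarith, by linarith,
    ⟨hE'.move, ?_, ?_, ?_, ?_, fun v c hv => ?_⟩, fun v c hv => ?_⟩
  · rw [card_moveEdges, hcard', hcard]
  · exact_mod_cast (by linarith : 0 < 2 * r).ne
  · rw [← hfl, edgeDegree_moveEdges, hend.2]
  · rw [← hfr, edgeDegree_moveEdges, hend.1]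
  · obtain ⟨v, c, rfl, rfl, hv'⟩ := exists_of_mem_moveEdges hv
    rw [edgeDegree_moveEdges]
    rcases hvert' v c hv' with ⟨rfl | rfl, -⟩ | ⟨-, -, h⟩
    · exact Or.inr (Or.inl hfr)
    · exact Or.inl hfl
    · exact Or.inr (Or.inr h)
  · obtain ⟨v, c, rfl, rfl, hv'⟩ := exists_of_mem_moveEdges hv
    rcases hvert' v c hv' with ⟨rfl | rfl, -⟩ | ⟨h1, h2, -⟩
    · exact Or.inr (Or.inl hfr)
    · exact Or.inl hfl
    · right; right
      have hs := mul_le_mul_of_nonneg_left (neg_abs_le v.re) (Nat.cast_nonneg (α := ℝ) s)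
      have hs' := mul_le_mul_of_nonneg_left (le_abs_self v.re) (Nat.cast_nonneg (α := ℝ) s)
      simp only [hf, Complex.add_re, Complex.add_im, Complex.ofReal_re, Complex.ofReal_im, zero_add]
      rw [abs_lt] at h1
      refine ⟨by linarith, by linarith, by linarith, by linarith⟩

/-- The framework is a quarter of a 4-regular graph with the symmetries of a rectangle. -/
def isQuarter (F : Framework) : Bool :=
  F.isCertified &&
  F.bars.all (fun b => decide (b.1 ∉ F.onY ∨ b.2 ∉ F.onY) && decide (b.1 ∉ F.onX ∨ b.2 ∉ F.onX)) &&
  (List.range F.pos.length).all fun i => let p := F.pos.getD i (0, 0)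
    decide (i ∉ F.onY → 350 < p.1) && decide (i ∉ F.onX → 350 < p.2) &&
      decide ((if i ∈ F.onX then 2 else 1) * ((if i ∈ F.onY then 2 else 1) * F.degree i) = 4)

theorem hasFourRegular_of_isQuarter (h : F.isQuarter = true) :
    HasFourRegular (2 * F.bars.length) := by
  simp only [isQuarter, Bool.and_eq_true, List.all_eq_true, decide_eq_true_eq, List.mem_range] at h
  obtain ⟨⟨hcert, hbars⟩, hjoint⟩ := h
  obtain ⟨z, hz, hY, hX, hE, hcard, hdeg, hlt⟩ := exists_isMatchstick hcert
  have hre {i : ℕ} (hi : i < F.pos.length) : 0 ≤ (z i).re ∧ (i ∈ F.onY ↔ (z i).re = 0) := by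
    by_cases h : i ∈ F.onY
    · exact ⟨(hY i h).ge, by simp [h, hY i h]⟩
    · have := hz.re_pos hi ((hjoint i hi).1.1 h)
      exact ⟨this.le, by simp [h, this.ne']⟩
  have him {i : ℕ} (hi : i < F.pos.length) : 0 ≤ (z i).im ∧ (i ∈ F.onX ↔ (z i).im = 0) := by
    by_cases h : i ∈ F.onX
    · exact ⟨(hX i h).ge, by simp [h, hX i h]⟩
    · have := hz.im_pos hi ((hjoint i hi).1.2 h)
      exact ⟨this.le, by simp [h, this.ne']⟩
  have hpos {a b : ℂ} (hab : s(a, b) ∈ F.edges z) : (0 ≤ a.re ∧ (a.re ≠ 0 ∨ b.re ≠ 0)) ∧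
      0 ≤ a.im ∧ (a.im ≠ 0 ∨ b.im ≠ 0) := by
    obtain ⟨i, j, hij | hij, rfl, rfl⟩ := exists_of_mem_edges hab
    · obtain ⟨hi, hj⟩ := hlt _ hij
      have := hbars _ hij
      rw [(hre hi).2, (hre hj).2, (him hi).2, (him hj).2] at this
      exact ⟨⟨(hre hi).1, this.1⟩, (him hi).1, this.2⟩
    · obtain ⟨hj, hi⟩ := hlt _ hij
      have := hbars _ hij
      rw [(hre hi).2, (hre hj).2, (him hi).2, (him hj).2] at this
      exact ⟨⟨(hre hi).1, this.1.symm⟩, (him hi).1, this.2.symm⟩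
  obtain ⟨hE', hcard', hvert⟩ := hE.mirror (ℓ := Complex.reLm) (f := reflectRe)
    (fun v => by simp [reflectRe_apply]) (fun v => by simp [reflectRe_apply])
    (fun v hv => by apply Complex.ext <;> simp_all [reflectRe_apply]) fun a b hab => (hpos hab).1
  have him' {v v' c c' : ℂ} (h : v = v' ∧ c = c' ∨ v = reflectRe v' ∧ c = reflectRe c') :
      v.im = v'.im ∧ c.im = c'.im := by
    rcases h with ⟨rfl, rfl⟩ | ⟨rfl, rfl⟩ <;> simp [reflectRe_apply]
  have hpos' {a b : ℂ} (hab : s(a, b) ∈ F.edges z ∪ moveEdges reflectRe (F.edges z)) :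
      0 ≤ a.im ∧ (a.im ≠ 0 ∨ b.im ≠ 0) := by
    obtain ⟨a', b', hab', h, -⟩ := hvert a b hab
    rw [(him' h).1, (him' h).2]
    exact (hpos hab').2
  obtain ⟨hE'', hcard'', hvert'⟩ := hE'.mirror (ℓ := Complex.imLm)
    (f := Complex.conjLIE.toAffineIsometryEquiv)
    (fun v => by simp) (fun v => by simp)
    (fun v hv => by apply Complex.ext <;> simp_all) fun a b hab => hpos' hab
  refine ⟨_, hE'', by rw [hcard'', hcard', hcard], fun v c hv => ?_⟩
  obtain ⟨v', c', hv', -, hd'⟩ := hvert' v c hv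
  obtain ⟨v'', c'', hv'', h, hd⟩ := hvert v' c' hv'
  obtain ⟨i, j, hij, rfl, -⟩ := exists_of_mem_edges hv''
  have hi : i < F.pos.length := by
    rcases hij with hij | hij
    · exact (hlt _ hij).1
    · exact (hlt _ hij).2
  rw [hd', hd, hdeg i hi, Complex.reLm_coe, Complex.imLm_coe, (him' h).1, ← (hjoint i hi).2]
  simp only [(hre hi).2, (him hi).2]

end Framework

/-- There is a bar with slope `27 / 100` whose length is roughly `c * 10⁻⁶`. -/
def HasBar (w : ℕ) (c : ℤ) : Prop :=
  ∃ (L : ℝ) (E : Finset (Sym2 ℂ)), |L * 10 ^ 6 - c| ≤ 1400 ∧ IsBar (27 / 100) w L E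

theorem Framework.hasBar {F : Framework} (h : F.isHalfBar 27 = true) :
    HasBar F.bars.length (2 * (F.pos.getD 0 (0, 0)).1) := by
  obtain ⟨L, E, hL, hE⟩ := exists_isBar h
  refine ⟨L, E, ?_, hE⟩
  push_cast
  linarith

theorem Framework.hasBar_append {F G : Framework} (hF : F.isHalfBar 27 = true)
    (hG : G.isHalfBar 27 = true) : HasBar (F.bars.length + G.bars.length)
      (2 * (F.pos.getD 0 (0, 0)).1 + 2 * (G.pos.getD 0 (0, 0)).1) := by
  obtain ⟨L, E, hL, hE⟩ := exists_isBar hF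
  obtain ⟨M, E', hM, hE'⟩ := exists_isBar hG
  obtain ⟨E'', h⟩ := hE.append hE' (by norm_num)
  refine ⟨L + M, E'', ?_, h⟩
  rw [abs_le] at hL hM ⊢
  push_cast
  constructor <;> linarith

theorem Framework.hasFourRegular_of_isHalfBar {F : Framework} (h : F.isHalfBar 0 = true)
    (hF : 10 ^ 6 < (F.pos.getD 0 (0, 0)).1) : HasFourRegular (2 * F.bars.length) := by
  obtain ⟨L, E, hL, hE⟩ := exists_isBar h
  rw [Nat.cast_zero, zero_div] at hE
  have hF' : (10 ^ 6 : ℝ) < (F.pos.getD 0 (0, 0)).1 := by exact_mod_cast hF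
  refine hE.lens ?_
  rw [abs_le] at hL
  linarith

theorem HasBar.ring {k m n : ℕ} {a b c : ℤ} (hE : HasBar k a) (hF : HasBar m b) (hG : HasBar n c)
    (hab : 4200 < a + b - c ∧ 4200 < b + c - a ∧ 4200 < c + a - b)
    (hwide : ∀ p ∈ [(c + a - b, a + b - c, b + c - a), (a + b - c, b + c - a, c + a - b),
      (b + c - a, c + a - b, a + b - c)],
      27 ^ 2 * (p.1 + 4200) * (a + b + c + 4200) ≤ 100 ^ 2 * (p.2.1 - 4200) * (p.2.2 - 4200)) :
    HasFourRegular (k + m + n) := by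
  obtain ⟨L, E, hL, hE⟩ := hE
  obtain ⟨M, F, hM, hF⟩ := hF
  obtain ⟨N, G, hN, hG⟩ := hG
  rw [abs_le] at hL hM hN
  simp only [List.forall_mem_cons] at hwide
  obtain ⟨hx, hy, hz, -⟩ := hwide
  have hX : (4200 : ℝ) < (c + a - b : ℤ) := by exact_mod_cast hab.2.2
  have hY : (4200 : ℝ) < (a + b - c : ℤ) := by exact_mod_cast hab.1
  have hZ : (4200 : ℝ) < (b + c - a : ℤ) := by exact_mod_cast hab.2.1
  obtain ⟨x, hx0⟩ : ∃ x, x = (N + L - M) / 2 := ⟨_, rfl⟩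
  obtain ⟨y, hy0⟩ : ∃ y, y = (L + M - N) / 2 := ⟨_, rfl⟩
  obtain ⟨z, hz0⟩ : ∃ z, z = (M + N - L) / 2 := ⟨_, rfl⟩
  obtain rfl : L = x + y := by linarith
  obtain rfl : M = y + z := by linarith
  obtain rfl : N = z + x := by linarith
  clear hx0 hy0 hz0 hab
  have hx' : |2 * x * 10 ^ 6 - (c + a - b : ℤ)| ≤ 4200 := by
    push_cast
    exact abs_le.2 ⟨by linarith only [hL, hM, hN], by linarith only [hL, hM, hN]⟩
  have hy' : |2 * y * 10 ^ 6 - (a + b - c : ℤ)| ≤ 4200 := by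
    push_cast
    exact abs_le.2 ⟨by linarith only [hL, hM, hN], by linarith only [hL, hM, hN]⟩
  have hz' : |2 * z * 10 ^ 6 - (b + c - a : ℤ)| ≤ 4200 := by
    push_cast
    exact abs_le.2 ⟨by linarith only [hL, hM, hN], by linarith only [hL, hM, hN]⟩
  have hs : 2 * (x + y + z) * 10 ^ 6 ≤ (a + b + c : ℤ) + 4200 := by
    push_cast
    linarith only [hL, hM, hN]
  clear hL hM hN
  generalize c + a - b = p at *
  generalize a + b - c = q at *
  generalize b + c - a = r at *
  generalize a + b + c = s at *
  have key {p q r : ℤ} {x y z t : ℝ} (ht : 0 < t)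
      (h : 27 ^ 2 * (p + 4200) * (s + 4200) ≤ 100 ^ 2 * (q - 4200) * (r - 4200))
      (hp : (4200 : ℝ) < p) (hq : (4200 : ℝ) < q) (hr : (4200 : ℝ) < r)
      (hx : |2 * x * 10 ^ 6 - p| ≤ 4200) (hy : |2 * y * 10 ^ 6 - q| ≤ 4200)
      (hz : |2 * z * 10 ^ 6 - r| ≤ 4200) (hs : 2 * t * 10 ^ 6 ≤ s + 4200) :
      (27 / 100 : ℝ) ^ 2 * x * t ≤ y * z := by
    rw [abs_le] at hx hy hz
    have h' : (27 ^ 2 * (p + 4200) * (s + 4200) : ℝ) ≤ 100 ^ 2 * (q - 4200) * (r - 4200) := by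
      exact_mod_cast h
    have h1 : (2 * x * 10 ^ 6) * (2 * t * 10 ^ 6) ≤ (p + 4200) * (s + 4200) :=
      mul_le_mul (by linarith) hs (by positivity) (by linarith)
    have h2 : ((q : ℝ) - 4200) * (r - 4200) ≤ (2 * y * 10 ^ 6) * (2 * z * 10 ^ 6) :=
      mul_le_mul (by linarith) (by linarith) (by linarith) (by linarith)
    linarith
  have pos {p : ℤ} {x : ℝ} (hp : (4200 : ℝ) < p) (hx : |2 * x * 10 ^ 6 - p| ≤ 4200) : 0 < x := by
    linarith [(abs_le.1 hx).1]
  have hx0 := pos hX hx'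
  have hy0 := pos hY hy'
  have hz0 := pos hZ hz'
  have hs0 := add_pos (add_pos hx0 hy0) hz0
  exact IsBar.ring hx0 hy0 hz0 hE hF hG (key hs0 hx hX hY hZ hx' hy' hz' hs)
    (key hs0 hy hY hZ hX hy' hz' hx' hs) (key hs0 hz hZ hX hY hz' hx' hy' hs)

/-- The right half of a symmetric bar with `2 * 21` edges. -/
def halfBar21 : Framework where
  pos := [
    (2936682, 0), (2375825, 827913), (1939260, -71759), (1814969, 1655826), (1378403, 756154),
    (997422, 1079965), (941838, -143518), (907485, 2075912), (179875, 504103), (89937, 1500050),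
    (0, -479587), (0, 2495997)]
  bars := [
    (9, 11), (0, 1), (0, 2), (8, 10), (7, 11), (3, 7), (4, 6), (5, 8), (2, 4), (1, 4), (7, 9),
    (5, 9), (1, 3), (8, 9), (1, 2), (5, 7), (2, 6), (3, 4), (3, 5), (6, 10), (6, 8)]
  onY := [10, 11]
  onX := [0]

/-- The right half of a symmetric bar with `2 * 29` edges. -/
def halfBar29 : Framework where
  pos := [
    (3948470, 0), (3430999, 855701), (2948676, -20292), (2913528, 1711402), (2431205, 835408),
    (2221511, 989520), (1948882, -40585), (1942352, 1949765), (1267113, 690983),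
    (1250335, 1227884), (974441, -265230), (971176, 2188129), (292672, 466339), (279159, 1466247),
    (0, -489874), (0, 2426492)]
  bars := [
    (0, 2), (0, 1), (11, 15), (10, 14), (13, 15), (12, 14), (5, 7), (6, 8), (7, 9), (3, 4),
    (8, 12), (3, 7), (1, 2), (11, 13), (3, 5), (2, 4), (2, 6), (5, 9), (10, 12), (8, 10), (1, 3),
    (1, 4), (9, 11), (12, 13), (7, 11), (5, 8), (9, 13), (6, 10), (4, 6)]
  onY := [14, 15]
  onX := [0]

/-- The right half of a symmetric bar with `2 * 30` edges. -/
def halfBar30 : Framework where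
  pos := [
    (3745991, 0), (3223287, 852514), (2746340, -26418), (2700583, 1705029), (2223636, 826097),
    (1857743, 1166864), (1813099, 2165867), (1746689, -52836), (1014903, 628700),
    (970259, 1627702), (925615, 2626705), (925615, 645027), (790569, -345813), (790569, 1635866),
    (0, 266560), (0, 1023494), (0, 2248238)]
  bars := [
    (13, 16), (0, 2), (11, 14), (12, 14), (0, 1), (10, 16), (5, 9), (7, 8), (3, 4), (3, 6),
    (3, 5), (11, 15), (13, 15), (2, 7), (7, 12), (5, 6), (10, 13), (8, 12), (4, 7), (1, 2),
    (2, 4), (11, 13), (1, 4), (6, 9), (11, 12), (8, 9), (1, 3), (5, 8), (6, 10), (9, 10)]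
  onY := [14, 15, 16]
  onX := [0]

/-- The right half of a symmetric bar with `2 * 32` edges. -/
def halfBar32 : Framework where
  pos := [
    (3860112, 0), (3280586, 814953), (2864579, -94409), (2701059, 1629906), (2285052, 720545),
    (1874022, 1067758), (1869045, -188817), (1800706, 2065067), (1093563, 442552),
    (973669, 1502919), (934523, -544721), (934523, 1429824), (900353, 2500227), (775483, 442552),
    (73316, 1938079), (0, -188817), (0, 1073920), (0, 2935388)]
  bars := [
    (10, 15), (13, 15), (14, 17), (12, 17), (0, 1), (0, 2), (11, 16), (3, 4), (3, 7), (3, 5),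
    (6, 8), (13, 16), (2, 6), (9, 12), (12, 14), (11, 14), (5, 7), (10, 13), (1, 2), (4, 6),
    (9, 14), (8, 10), (1, 4), (1, 3), (6, 10), (11, 13), (2, 4), (5, 9), (8, 11), (7, 12), (7, 9),
    (5, 8)]
  onY := [15, 16, 17]
  onX := [0]

/-- The right half of a symmetric bar with `2 * 33` edges. -/
def halfBar33 : Framework where
  pos := [
    (3552052, 0), (3408903, 989701), (3265755, 1979402), (2632711, 2753518), (2623371, 370880),
    (2480223, 1360582), (2278829, 1818228), (1999667, 3527634), (1694690, 741761),
    (1645785, 2592344), (1483957, 2670872), (1291903, 1657054), (999834, 3545872),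
    (968246, 1814109), (700629, 850583), (484123, 2689109), (0, 1564109), (0, 3564109)]
  bars := [
    (0, 4), (14, 16), (13, 16), (0, 1), (12, 17), (15, 17), (8, 11), (3, 7), (2, 5), (6, 9),
    (7, 10), (9, 11), (7, 9), (12, 15), (6, 11), (2, 3), (1, 4), (13, 14), (3, 9), (10, 12),
    (7, 12), (13, 15), (1, 5), (4, 5), (8, 14), (10, 15), (1, 2), (3, 6), (4, 8), (10, 13),
    (11, 14), (5, 8), (2, 6)]
  onY := [16, 17]
  onX := [0]

/-- The right half of a symmetric bar with `2 * 34` edges. -/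
def halfBar34 : Framework where
  pos := [
    (3440329, 0), (3323376, 993137), (3206424, 1986275), (2594051, 2776844), (2521771, 395285),
    (2404818, 1388422), (2215584, 1851230), (1981679, 3567414), (1603212, 2641799),
    (1603212, 790569), (1369306, 2776844), (1224745, 1716184), (990839, 1851230),
    (990839, 3702459), (612372, 925615), (378467, 2911890), (0, 1716184), (0, 1986275),
    (0, 3837505)]
  bars := [
    (12, 17), (13, 18), (14, 16), (15, 18), (0, 4), (0, 1), (7, 10), (3, 7), (9, 11), (6, 8),
    (2, 5), (7, 8), (12, 16), (15, 17), (1, 4), (1, 2), (3, 8), (11, 14), (13, 15), (10, 15),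
    (1, 5), (9, 14), (6, 11), (8, 11), (4, 5), (12, 14), (4, 9), (3, 6), (10, 13), (5, 9),
    (7, 13), (10, 12), (2, 3), (2, 6)]
  onY := [16, 17, 18]
  onX := [0]

/-- The right half of a symmetric bar with `2 * 35` edges. -/
def halfBar35 : Framework where
  pos := [
    (3868949, 0), (3169831, 715006), (2900176, -247951), (2529601, 1483190), (2195270, 461350),
    (2184450, 544643), (1933451, -503767), (1889371, 2251373), (1544220, 1312826),
    (1228545, 205534), (1199068, 374279), (1132991, 1597240), (966725, -759583),
    (944686, 2579350), (376612, 943107), (261819, -50282), (188306, 1925217), (0, -1015399),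
    (0, 2907328)]
  bars := [
    (15, 17), (13, 18), (0, 2), (0, 1), (16, 18), (8, 10), (12, 15), (5, 8), (4, 6), (11, 14),
    (4, 9), (3, 7), (7, 11), (7, 8), (12, 17), (2, 4), (5, 10), (13, 16), (3, 8), (9, 15),
    (11, 16), (14, 16), (2, 6), (7, 13), (9, 12), (6, 9), (11, 13), (3, 5), (1, 5), (6, 12),
    (10, 14), (14, 15), (1, 2), (4, 10), (1, 3)]
  onY := [17, 18]
  onX := [0]

/-- The right half of a symmetric bar with `2 * 36` edges. -/
def halfBar36 : Framework where
  pos := [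
    (3797763, 0), (3583977, 976881), (3370191, 1953761), (2844867, 303296), (2683240, 2680464),
    (2631081, 1280177), (2397372, 1722195), (1996288, 3407167), (1891971, 606592),
    (1710420, 2448898), (1444476, 2573199), (1424553, 1490629), (998144, 3468066),
    (892664, 643815), (892664, 1739230), (446332, 2634098), (55994, 1191523), (0, 193091),
    (0, 2189954), (0, 3528965)]
  bars := [
    (0, 3), (13, 17), (0, 1), (16, 18), (14, 18), (12, 19), (15, 19), (2, 6), (5, 8), (4, 7),
    (7, 9), (7, 10), (16, 17), (2, 5), (14, 16), (12, 15), (1, 3), (4, 9), (6, 11), (9, 11),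
    (8, 11), (13, 16), (6, 9), (1, 5), (10, 12), (11, 13), (7, 12), (1, 2), (4, 6), (10, 15),
    (3, 5), (14, 15), (3, 8), (10, 14), (8, 13), (2, 4)]
  onY := [17, 18, 19]
  onX := [0]

/-- A quarter of a 4-regular graph with 70 vertices. -/
def quarter70 : Framework where
  pos := [
    (0, 990839), (0, 3440329), (395285, 2521771), (790569, 1603212), (925615, 612372),
    (993137, 3323376), (1388422, 2404818), (1716184, 1224745), (1716184, 0), (1851230, 990839),
    (1851230, 2215584), (1986275, 0), (1986275, 3206424), (2641799, 1603212), (2776844, 1369306),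
    (2776844, 2594051), (2911890, 378467), (3567414, 1981679), (3702459, 990839), (3837505, 0)]
  bars := [
    (18, 19), (4, 8), (1, 2), (8, 9), (0, 3), (11, 16), (16, 19), (1, 5), (7, 10), (6, 12),
    (15, 17), (14, 17), (13, 17), (10, 12), (0, 4), (2, 5), (13, 15), (16, 18), (4, 9), (5, 12),
    (17, 18), (14, 18), (5, 6), (2, 3), (3, 7), (9, 11), (2, 6), (10, 15), (14, 16), (3, 6),
    (10, 13), (9, 14), (12, 15), (4, 7), (7, 13)]
  onY := [0, 1]
  onX := [8, 11, 19]

theorem halfBar21_isHalfBar : halfBar21.isHalfBar 27 = true := by decide +kernel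

theorem halfBar29_isHalfBar : halfBar29.isHalfBar 27 = true := by decide +kernel

theorem halfBar30_isHalfBar : halfBar30.isHalfBar 27 = true := by decide +kernel

theorem halfBar32_isHalfBar : halfBar32.isHalfBar 27 = true := by decide +kernel

theorem halfBar33_isHalfBar : halfBar33.isHalfBar 27 = true := by decide +kernel

theorem halfBar34_isHalfBar : halfBar34.isHalfBar 27 = true := by decide +kernel

theorem halfBar35_isHalfBar : halfBar35.isHalfBar 27 = true := by decide +kernel

theorem halfBar36_isHalfBar : halfBar36.isHalfBar 27 = true := by decide +kernel

theorem hasBar21 : HasBar 21 5873364 := Framework.hasBar halfBar21_isHalfBar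

theorem hasBar29 : HasBar 29 7896940 := Framework.hasBar halfBar29_isHalfBar

theorem hasBar30 : HasBar 30 7491982 := Framework.hasBar halfBar30_isHalfBar

theorem hasBar32 : HasBar 32 7720224 := Framework.hasBar halfBar32_isHalfBar

theorem hasBar33 : HasBar 33 7104104 := Framework.hasBar halfBar33_isHalfBar

theorem hasBar34 : HasBar 34 6880658 := Framework.hasBar halfBar34_isHalfBar

theorem hasBar35 : HasBar 35 7737898 := Framework.hasBar halfBar35_isHalfBar

theorem hasBar36 : HasBar 36 7595526 := Framework.hasBar halfBar36_isHalfBar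

theorem hasBar42 : HasBar 42 11746728 :=
  Framework.hasBar_append halfBar21_isHalfBar halfBar21_isHalfBar

theorem hasBar54 : HasBar 54 12977468 :=
  Framework.hasBar_append halfBar21_isHalfBar halfBar33_isHalfBar

theorem hasFourRegular66 : HasFourRegular 66 :=
  Framework.hasFourRegular_of_isHalfBar (F := halfBar33) (by decide +kernel) (by decide +kernel)

theorem hasFourRegular68 : HasFourRegular 68 :=
  Framework.hasFourRegular_of_isHalfBar (F := halfBar34) (by decide +kernel) (by decide +kernel)

theorem hasFourRegular70 : HasFourRegular 70 :=
  Framework.hasFourRegular_of_isQuarter (F := quarter70) (by decide +kernel)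

/-- For every natural number n with 62 < n < 121 and
n ∉ {64, 65, 67, 69, 73, 74}, there exists a 4-regular matchstick graph with
exactly n vertices. -/
theorem exists_fourRegular_matchstick_63_to_120
    (n : ℕ) (h1 : 62 < n) (h2 : n < 121)
    (h3 : n ∉ ({64, 65, 67, 69, 73, 74} : Finset ℕ)) :
    ∃ G : MatchstickGraph, G.IsFourRegular ∧ G.V.card = n := by
  suffices HasFourRegular n from this.exists_matchstickGraph
  interval_cases n
  · exact hasBar21.ring hasBar21 hasBar21 (by norm_num) (by norm_num)
  · simp at h3
  · simp at h3
  · exact hasFourRegular66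
  · simp at h3
  · exact hasFourRegular68
  · simp at h3
  · exact hasFourRegular70
  · exact hasBar21.ring hasBar21 hasBar29 (by norm_num) (by norm_num)
  · exact hasBar21.ring hasBar21 hasBar30 (by norm_num) (by norm_num)
  · simp at h3
  · simp at h3
  · exact hasBar21.ring hasBar21 hasBar33 (by norm_num) (by norm_num)
  · exact hasBar21.ring hasBar21 hasBar34 (by norm_num) (by norm_num)
  · exact hasBar21.ring hasBar21 hasBar35 (by norm_num) (by norm_num)
  · exact hasBar21.ring hasBar21 hasBar36 (by norm_num) (by norm_num)
  · exact hasBar21.ring hasBar29 hasBar29 (by norm_num) (by norm_num)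
  · exact hasBar21.ring hasBar29 hasBar30 (by norm_num) (by norm_num)
  · exact hasBar21.ring hasBar30 hasBar30 (by norm_num) (by norm_num)
  · exact hasBar21.ring hasBar29 hasBar32 (by norm_num) (by norm_num)
  · exact hasBar21.ring hasBar29 hasBar33 (by norm_num) (by norm_num)
  · exact hasBar21.ring hasBar30 hasBar33 (by norm_num) (by norm_num)
  · exact hasBar21.ring hasBar30 hasBar34 (by norm_num) (by norm_num)
  · exact hasBar21.ring hasBar32 hasBar33 (by norm_num) (by norm_num)
  · exact hasBar29.ring hasBar29 hasBar29 (by norm_num) (by norm_num)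
  · exact hasBar29.ring hasBar29 hasBar30 (by norm_num) (by norm_num)
  · exact hasBar29.ring hasBar30 hasBar30 (by norm_num) (by norm_num)
  · exact hasBar30.ring hasBar30 hasBar30 (by norm_num) (by norm_num)
  · exact hasBar29.ring hasBar30 hasBar32 (by norm_num) (by norm_num)
  · exact hasBar30.ring hasBar30 hasBar32 (by norm_num) (by norm_num)
  · exact hasBar29.ring hasBar32 hasBar32 (by norm_num) (by norm_num)
  · exact hasBar30.ring hasBar32 hasBar32 (by norm_num) (by norm_num)
  · exact hasBar30.ring hasBar30 hasBar35 (by norm_num) (by norm_num)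
  · exact hasBar32.ring hasBar32 hasBar32 (by norm_num) (by norm_num)
  · exact hasBar29.ring hasBar32 hasBar36 (by norm_num) (by norm_num)
  · exact hasBar30.ring hasBar32 hasBar36 (by norm_num) (by norm_num)
  · exact hasBar33.ring hasBar33 hasBar33 (by norm_num) (by norm_num)
  · exact hasBar32.ring hasBar32 hasBar36 (by norm_num) (by norm_num)
  · exact hasBar33.ring hasBar34 hasBar34 (by norm_num) (by norm_num)
  · exact hasBar34.ring hasBar34 hasBar34 (by norm_num) (by norm_num)
  · exact hasBar32.ring hasBar35 hasBar36 (by norm_num) (by norm_num)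
  · exact hasBar32.ring hasBar36 hasBar36 (by norm_num) (by norm_num)
  · exact hasBar35.ring hasBar35 hasBar35 (by norm_num) (by norm_num)
  · exact hasBar35.ring hasBar35 hasBar36 (by norm_num) (by norm_num)
  · exact hasBar35.ring hasBar36 hasBar36 (by norm_num) (by norm_num)
  · exact hasBar36.ring hasBar36 hasBar36 (by norm_num) (by norm_num)
  · exact hasBar32.ring hasBar35 hasBar42 (by norm_num) (by norm_num)
  · exact hasBar32.ring hasBar36 hasBar42 (by norm_num) (by norm_num)
  · exact hasBar33.ring hasBar36 hasBar42 (by norm_num) (by norm_num)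
  · exact hasBar35.ring hasBar35 hasBar42 (by norm_num) (by norm_num)
  · exact hasBar35.ring hasBar36 hasBar42 (by norm_num) (by norm_num)
  · exact hasBar36.ring hasBar36 hasBar42 (by norm_num) (by norm_num)
  · exact hasBar29.ring hasBar32 hasBar54 (by norm_num) (by norm_num)
  · exact hasBar32.ring hasBar42 hasBar42 (by norm_num) (by norm_num)
  · exact hasBar33.ring hasBar42 hasBar42 (by norm_num) (by norm_num)
  · exact hasBar34.ring hasBar42 hasBar42 (by norm_num) (by norm_num)
  · exact hasBar35.ring hasBar42 hasBar42 (by norm_num) (by norm_num)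
  · exact hasBar36.ring hasBar42 hasBar42 (by norm_num) (by norm_num)
end
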